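/- (Almost-sure homogenization for G-equations; Theorem for part (i).) Assume the G-equation hypotheses on (c,v) over a probability space (Ω,F,P), assume the needed measurability in ω, and assume lim_{s→∞} s^α φ_H(s) = 0 for some α > 0, where H := (c,v). Then there is a convex bounded open set S ⊆ ℝ^d containing 0 such that for almost every ω ∈ Ω the following holds. Let u_0 : ℝ^d → ℝ and, for each ε ∈ (0,1), a function u^ε(0,·,ω) : ℝ^d → ℝ be uniformly continuous; let Λ < ∞, y_ε ∈ B_Λ(0), and ρ(ε) → 0 as ε → 0 satisfy sup_ω ‖u^ε(0, · + y_ε, ω) − u_0‖_{L^∞(ℝ^d)} ≤ ρ(ε); and define u^ε(t,x,ω) := sup{ u^ε(0,y,ω) : x ∈ ε Γ(ε^{-1} t, ω; 0, ε^{-1} y) } for t > 0 (the control representation of the unique uniformly continuous viscosity solution of u^ε_t + v(ε^{-1}t, ε^{-1}x, ω)·∇u^ε = c(ε^{-1}t, ε^{-1}x, ω)|∇u^ε|). Then lim_{ε→0} u^ε(t, x + y_ε, ω) = sup_{y ∈ x − tS} u_0(y), locally uniformly in (t,x) ∈ [0,∞)×ℝ^d. -/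

import Mathlib

open MeasureTheory Filter Metric

noncomputable section

/-- `ℝ^d` with the Euclidean norm. -/
abbrev Euc (d : ℕ) : Type := EuclideanSpace ℝ (Fin d)

/-- `(t₁, x₁)` is reachable from `(t₀, x₀)`: there is an absolutely continuous path
`γ : [t₀,t₁] → ℝ^d` (given by the integral of its a.e. derivative `g`) with `γ(t₀) = x₀`,
`γ(t₁) = x₁`, and `|γ'(t) − v(t,γ(t))| ≤ c(t,γ(t))` for a.e. `t ∈ [t₀,t₁]`. -/
def Reachable {d : ℕ} (c : ℝ → Euc d → ℝ) (v : ℝ → Euc d → Euc d)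
    (t0 : ℝ) (x0 : Euc d) (t1 : ℝ) (x1 : Euc d) : Prop :=
  t0 ≤ t1 ∧ ∃ γ g : ℝ → Euc d,
    IntervalIntegrable g volume t0 t1 ∧
    (∀ t ∈ Set.Icc t0 t1, γ t = x0 + ∫ s in t0..t, g s) ∧
    γ t1 = x1 ∧
    ∀ᵐ s ∂(volume.restrict (Set.Icc t0 t1)), ‖g s - v s (γ s)‖ ≤ c s (γ s)

/-- The reachable set `Γ(t; t₀, x₀)`. -/
def reachSet {d : ℕ} (c : ℝ → Euc d → ℝ) (v : ℝ → Euc d → Euc d)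
    (t t0 : ℝ) (x0 : Euc d) : Set (Euc d) :=
  {x | Reachable c v t0 x0 (t0 + t) x}

/-- The travel time `τ^{t₀}(x₀, x) = inf { t ≥ 0 : x ∈ Γ(t; t₀, x₀) }`. -/
def travelTime {d : ℕ} (c : ℝ → Euc d → ℝ) (v : ℝ → Euc d → Euc d)
    (t0 : ℝ) (x0 x : Euc d) : ℝ :=
  sInf {t | 0 ≤ t ∧ x ∈ reachSet c v t t0 x0}

/-- The σ-algebra `F_t^+(H)` generated by `H(s,x,·) = (c(s,x,·), v(s,x,·))` for `s ≥ t`. -/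
def sigmaPlus {d : ℕ} {Ω : Type*} [MeasurableSpace Ω]
    (c : ℝ → Euc d → Ω → ℝ) (v : ℝ → Euc d → Ω → Euc d) (t : ℝ) : MeasurableSpace Ω :=
  ⨆ (s : ℝ) (_ : t ≤ s) (x : Euc d),
    MeasurableSpace.comap (fun ω => (c s x ω, v s x ω)) inferInstance

/-- The σ-algebra `F_t^-(H)` generated by `H(s,x,·) = (c(s,x,·), v(s,x,·))` for `s ≤ t`. -/
def sigmaMinus {d : ℕ} {Ω : Type*} [MeasurableSpace Ω]
    (c : ℝ → Euc d → Ω → ℝ) (v : ℝ → Euc d → Ω → Euc d) (t : ℝ) : MeasurableSpace Ω :=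
  ⨆ (s : ℝ) (_ : s ≤ t) (x : Euc d),
    MeasurableSpace.comap (fun ω => (c s x ω, v s x ω)) inferInstance

/-- The mixing coefficient `φ_H(s)` of `H = (c,v)`. -/
def phiH {d : ℕ} {Ω : Type*} [MeasurableSpace Ω] (P : Measure Ω)
    (c : ℝ → Euc d → Ω → ℝ) (v : ℝ → Euc d → Ω → Euc d) (s : ℝ) : ℝ :=
  sSup {r | ∃ t : ℝ, ∃ Ev Fv : Set Ω,
    MeasurableSet[sigmaMinus c v t] Ev ∧ MeasurableSet[sigmaPlus c v (t + s)] Fv ∧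
    0 < P Ev ∧ r = |(P (Fv ∩ Ev)).toReal / (P Ev).toReal - (P Fv).toReal|}

structure Reg {d : ℕ} (K : ℝ) (c : ℝ → Euc d → ℝ) (v : ℝ → Euc d → Euc d) : Prop where
  hc : Continuous (fun p : ℝ × Euc d => c p.1 p.2)
  hv : Continuous (fun p : ℝ × Euc d => v p.1 p.2)
  c0 : ∀ t x, 0 ≤ c t x
  cK : ∀ t x, c t x ≤ K
  vK : ∀ t x, ‖v t x‖ ≤ K

def Adm {d : ℕ} (c : ℝ → Euc d → ℝ) (v : ℝ → Euc d → Euc d) (t0 t1 : ℝ) (γ : ℝ → Euc d) : Prop :=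
  Continuous γ ∧ ∀ s t, t0 ≤ s → s ≤ t → t ≤ t1 →
    ‖γ t - γ s - ∫ u in s..t, v u (γ u)‖ ≤ ∫ u in s..t, c u (γ u)

section
variable {d : ℕ} {K : ℝ} {c : ℝ → Euc d → ℝ} {v : ℝ → Euc d → Euc d}

lemma Reg.cc (h : Reg K c v) {γ : ℝ → Euc d} (hγ : Continuous γ) : Continuous fun u => c u (γ u) :=
  h.hc.comp (continuous_id.prodMk hγ)
lemma Reg.vc (h : Reg K c v) {γ : ℝ → Euc d} (hγ : Continuous γ) : Continuous fun u => v u (γ u) :=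
  h.hv.comp (continuous_id.prodMk hγ)
lemma Reg.K0 (h : Reg K c v) : 0 ≤ K := (norm_nonneg _).trans (h.vK 0 0)

lemma lip_ftc {γ : ℝ → ℝ} {C : NNReal} (h : LipschitzWith C γ) (a b : ℝ) :
    IntervalIntegrable (deriv γ) volume a b ∧ ∫ s in a..b, deriv γ s = γ b - γ a := by
  have := (h.lipschitzOnWith (s := Set.uIcc a b)).absolutelyContinuousOnInterval
  exact ⟨this.intervalIntegrable_deriv, this.integral_deriv_eq_sub⟩

lemma lip_ftcE {γ : ℝ → Euc d} {C : NNReal} (h : LipschitzWith C γ) (a b : ℝ) :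
    IntervalIntegrable (deriv γ) volume a b ∧ ∫ s in a..b, deriv γ s = γ b - γ a := by
  have hb : ∀ s, ‖deriv γ s‖ ≤ C := fun s => norm_deriv_le_of_lipschitz h
  have hi : IntervalIntegrable (deriv γ) volume a b := by
    refine (intervalIntegrable_const (c := (C:ℝ)) (μ := volume) (a := a) (b := b)).mono_fun
      (measurable_deriv γ).aestronglyMeasurable ?_
    refine Eventually.of_forall fun s => ?_
    simpa using hb s
  refine ⟨hi, ?_⟩
  ext i
  have hl : LipschitzWith C (fun t => γ t i) := by
    refine LipschitzWith.of_dist_le_mul fun x y => ?_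
    have := h.dist_le_mul x y
    refine le_trans ?_ this
    rw [dist_eq_norm, dist_eq_norm]
    have := PiLp.norm_apply_le (γ x - γ y) i
    simpa using this
  have h1 := (lip_ftc hl a b).2
  have h2 : (∫ s in a..b, deriv γ s) i = ∫ s in a..b, (deriv γ s) i := by
    have := (EuclideanSpace.proj i : Euc d →L[ℝ] ℝ).intervalIntegral_comp_comm hi
    simpa using this.symm
  rw [h2]
  simp only [PiLp.sub_apply]
  rw [← h1]
  refine intervalIntegral.integral_congr_ae ?_
  filter_upwards [h.ae_differentiableAt_real] with s hs _
  have := ((EuclideanSpace.proj i : Euc d →L[ℝ] ℝ).hasFDerivAt (x := γ s)).comp_hasDerivAt s hs.hasDerivAt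
  simpa [Function.comp_def] using this.deriv.symm

lemma Adm.lip (h : Reg K c v) {t0 t1 : ℝ} {γ : ℝ → Euc d} (hγ : Adm c v t0 t1 γ) {s t : ℝ}
    (h1 : t0 ≤ s) (h2 : s ≤ t) (h3 : t ≤ t1) : ‖γ t - γ s‖ ≤ 2 * K * (t - s) := by
  have h4 := hγ.2 s t h1 h2 h3
  have h5 : ‖∫ u in s..t, v u (γ u)‖ ≤ K * |t - s| :=
    intervalIntegral.norm_integral_le_of_norm_le_const fun x _ => h.vK _ _
  have h6 : ‖∫ u in s..t, c u (γ u)‖ ≤ K * |t - s| :=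
    intervalIntegral.norm_integral_le_of_norm_le_const fun x _ => by
      rw [Real.norm_of_nonneg (h.c0 _ _)]; exact h.cK _ _
  rw [abs_of_nonneg (by linarith)] at h5 h6
  have h7 := (le_abs_self _).trans h6
  have : γ t - γ s = (γ t - γ s - ∫ u in s..t, v u (γ u)) + ∫ u in s..t, v u (γ u) := by abel
  rw [this]
  refine (norm_add_le _ _).trans ?_
  linarith

lemma reach_adm (h : Reg K c v) {t0 t1 : ℝ} {x0 x1 : Euc d} (hr : Reachable c v t0 x0 t1 x1) :
    ∃ γ, Adm c v t0 t1 γ ∧ γ t0 = x0 ∧ γ t1 = x1 := by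
  obtain ⟨h01, γ, g, hg, hγ, hx1, hae⟩ := hr
  let γ' : ℝ → Euc d := fun t => x0 + ∫ s in t0..(max t0 (min t t1)), g s
  have hin : ∀ t, t ∈ Set.Icc t0 t1 → γ' t = γ t := by
    intro t ht
    simp only [γ']
    rw [min_eq_left ht.2, max_eq_right ht.1, hγ t ht]
  have hmx : ∀ t, max t0 (min t t1) ∈ Set.Icc t0 t1 := fun t =>
    ⟨le_max_left _ _, max_le h01 (min_le_right _ _)⟩
  have hcont : Continuous γ' := by
    have h1 : ContinuousOn (fun t => ∫ s in t0..t, g s) (Set.uIcc t0 t1) :=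
      intervalIntegral.continuousOn_primitive_interval' hg Set.left_mem_uIcc
    rw [Set.uIcc_of_le h01] at h1
    refine continuous_const.add ?_
    exact h1.comp_continuous (by fun_prop) hmx
  refine ⟨γ', ⟨hcont, ?_⟩, ?_, ?_⟩
  · intro s t hs hst ht
    have hss : s ∈ Set.Icc t0 t1 := ⟨hs, hst.trans ht⟩
    have htt : t ∈ Set.Icc t0 t1 := ⟨hs.trans hst, ht⟩
    have hgs : IntervalIntegrable g volume t0 s := hg.mono_set (by
      rw [Set.uIcc_of_le h01, Set.uIcc_of_le hs]; exact Set.Icc_subset_Icc_right hss.2)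
    have hgt : IntervalIntegrable g volume t0 t := hg.mono_set (by
      rw [Set.uIcc_of_le h01, Set.uIcc_of_le htt.1]; exact Set.Icc_subset_Icc_right htt.2)
    have hgst : IntervalIntegrable g volume s t := hgs.symm.trans hgt
    have e1 : γ' t - γ' s = ∫ u in s..t, g u := by
      rw [hin t htt, hin s hss, hγ t htt, hγ s hss]
      rw [add_sub_add_left_eq_sub]
      exact intervalIntegral.integral_interval_sub_left hgt hgs
    have hv : IntervalIntegrable (fun u => v u (γ' u)) volume s t :=
      (h.vc hcont).intervalIntegrable _ _
    rw [e1, ← intervalIntegral.integral_sub hgst hv]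
    refine intervalIntegral.norm_integral_le_of_norm_le hst ?_ ((h.cc hcont).intervalIntegrable _ _)
    rw [ae_restrict_iff' measurableSet_Icc] at hae
    filter_upwards [hae] with u hu hu2
    have hu3 : u ∈ Set.Icc t0 t1 := ⟨hs.trans hu2.1.le, hu2.2.trans ht⟩
    rw [hin u hu3]
    exact hu hu3
  · rw [hin t0 ⟨le_rfl, h01⟩, hγ t0 ⟨le_rfl, h01⟩]; simp
  · rw [hin t1 ⟨h01, le_rfl⟩, hx1]

lemma adm_reach (h : Reg K c v) {t0 t1 : ℝ} (h01 : t0 ≤ t1) {γ : ℝ → Euc d} (hγ : Adm c v t0 t1 γ) :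
    Reachable c v t0 (γ t0) t1 (γ t1) := by
  let p : ℝ → ℝ := fun t => max t0 (min t t1)
  have hp : ∀ t, p t ∈ Set.Icc t0 t1 := fun t =>
    ⟨le_max_left _ _, max_le h01 (min_le_right _ _)⟩
  have hpl : LipschitzWith 1 p := by
    exact (LipschitzWith.id.min_const t1).const_max t0
  have hpm : Monotone p := fun a b hab => max_le_max le_rfl (min_le_min_right _ hab)
  have hpi : ∀ t ∈ Set.Icc t0 t1, p t = t := fun t ht => by
    simp only [p]; rw [min_eq_left ht.2, max_eq_right ht.1]
  let γ' := fun t => γ (p t)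
  have hl : LipschitzWith ⟨2 * K, by linarith [h.K0]⟩ γ' := by
    have key : ∀ x y, x ≤ y → dist (γ' x) (γ' y) ≤ 2 * K * dist x y := by
      intro x y hxy
      rw [dist_comm, dist_eq_norm]
      refine (Adm.lip h hγ (hp x).1 (hpm hxy) (hp y).2).trans ?_
      have h1 := hpl.dist_le_mul x y
      have h2 := le_abs_self (p y - p x)
      rw [dist_comm, Real.dist_eq] at h1
      simp only [NNReal.coe_one, one_mul] at h1
      exact mul_le_mul_of_nonneg_left (h2.trans h1) (by linarith [h.K0])
    refine LipschitzWith.of_dist_le_mul fun x y => ?_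
    rcases le_total x y with hxy | hxy
    · exact key x y hxy
    · rw [dist_comm, dist_comm x]; exact key y x hxy
  refine ⟨h01, γ', deriv γ', (lip_ftcE hl _ _).1, ?_, ?_, ?_⟩
  · intro t ht
    rw [(lip_ftcE hl _ _).2]
    simp [γ', hpi t0 ⟨le_rfl, h01⟩]
  · simp [γ', hpi t1 ⟨h01, le_rfl⟩]
  · rw [Measure.restrict_congr_set Ioo_ae_eq_Icc.symm, ae_restrict_iff' measurableSet_Ioo]
    filter_upwards [hl.ae_differentiableAt_real] with s hs hs2
    have hpe : ∀ᶠ t in nhds s, γ' t = γ t := by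
      filter_upwards [Ioo_mem_nhds hs2.1 hs2.2] with t ht
      simp only [γ', hpi t ⟨ht.1.le, ht.2.le⟩]
    have hss : γ' s = γ s := hpe.self_of_nhds
    rw [hss]
    have hd : HasDerivAt γ (deriv γ' s) s := hs.hasDerivAt.congr_of_eventuallyEq
      (hpe.mono fun t ht => ht.symm)
    have hdv : HasDerivAt (fun t => ∫ u in s..t, v u (γ u)) (v s (γ s)) s :=
      (h.vc hγ.1).integral_hasStrictDerivAt s s |>.hasDerivAt
    have hdc : HasDerivAt (fun t => ∫ u in s..t, c u (γ u)) (c s (γ s)) s :=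
      (h.cc hγ.1).integral_hasStrictDerivAt s s |>.hasDerivAt
    have h1 := (hd.sub hdv).tendsto_slope.norm
    have h2 := hdc.tendsto_slope
    have hle : nhdsWithin s (Set.Ioi s) ≤ nhdsWithin s {s}ᶜ :=
      nhdsWithin_mono _ (fun x hx => ne_of_gt hx)
    refine le_of_tendsto_of_tendsto (h1.mono_left hle) (h2.mono_left hle) ?_
    filter_upwards [Ioo_mem_nhdsGT hs2.2] with t ht
    have := hγ.2 s t hs2.1.le ht.1.le ht.2.le
    have h0 : 0 < t - s := by linarith [ht.1]
    simp only [slope, vsub_eq_sub, Pi.sub_apply, intervalIntegral.integral_same, sub_zero]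
    rw [norm_smul, norm_inv, Real.norm_of_nonneg h0.le, smul_eq_mul]
    refine mul_le_mul_of_nonneg_left ?_ (by positivity)
    rw [sub_right_comm] at this
    exact this
end

section
variable {d : ℕ} {K : ℝ} {c : ℝ → Euc d → ℝ} {v : ℝ → Euc d → Euc d}

lemma reach_refl (h : Reg K c v) (t : ℝ) (x : Euc d) : Reachable c v t x t x := by
  refine adm_reach (γ := fun _ => x) h le_rfl ⟨continuous_const, ?_⟩
  intro s t' h1 h2 h3
  have : s = t' := by linarith
  subst this
  simp

lemma reach_trans (h : Reg K c v) {t0 t1 t2 : ℝ} {x0 x1 x2 : Euc d}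
    (h1 : Reachable c v t0 x0 t1 x1) (h2 : Reachable c v t1 x1 t2 x2) :
    Reachable c v t0 x0 t2 x2 := by
  have h01 := h1.1
  have h12 := h2.1
  obtain ⟨γ1, a1, b1, c1⟩ := reach_adm h h1
  obtain ⟨γ2, a2, b2, c2⟩ := reach_adm h h2
  let γ : ℝ → Euc d := fun t => if t ≤ t1 then γ1 t else γ2 t
  have hγ : Continuous γ := Continuous.if_le a1.1 a2.1 continuous_id continuous_const
    (fun x hx => by subst hx; rw [c1, b2])
  have e1 : ∀ t ≤ t1, γ t = γ1 t := fun t ht => by simp [γ, ht]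
  have e2 : ∀ t, t1 ≤ t → γ t = γ2 t := fun t ht => by
    rcases eq_or_lt_of_le ht with rfl | ht
    · simp [γ, c1, b2]
    · simp [γ, not_le.2 ht]
  have A1 : ∀ s t, t0 ≤ s → s ≤ t → t ≤ t1 →
    ‖γ t - γ s - ∫ u in s..t, v u (γ u)‖ ≤ ∫ u in s..t, c u (γ u) := by
    intro s t p q r
    have i1 : ∫ u in s..t, v u (γ u) = ∫ u in s..t, v u (γ1 u) :=
      intervalIntegral.integral_congr fun u hu => by
        rw [Set.uIcc_of_le q] at hu
        simp only [e1 u (hu.2.trans r)]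
    have i2 : ∫ u in s..t, c u (γ u) = ∫ u in s..t, c u (γ1 u) :=
      intervalIntegral.integral_congr fun u hu => by
        rw [Set.uIcc_of_le q] at hu
        simp only [e1 u (hu.2.trans r)]
    rw [i1, i2, e1 t r, e1 s (q.trans r)]
    exact a1.2 s t p q r
  have A2 : ∀ s t, t1 ≤ s → s ≤ t → t ≤ t2 →
    ‖γ t - γ s - ∫ u in s..t, v u (γ u)‖ ≤ ∫ u in s..t, c u (γ u) := by
    intro s t p q r
    have i1 : ∫ u in s..t, v u (γ u) = ∫ u in s..t, v u (γ2 u) :=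
      intervalIntegral.integral_congr fun u hu => by
        rw [Set.uIcc_of_le q] at hu
        simp only [e2 u (p.trans hu.1)]
    have i2 : ∫ u in s..t, c u (γ u) = ∫ u in s..t, c u (γ2 u) :=
      intervalIntegral.integral_congr fun u hu => by
        rw [Set.uIcc_of_le q] at hu
        simp only [e2 u (p.trans hu.1)]
    rw [i1, i2, e2 t (p.trans q), e2 s p]
    exact a2.2 s t p q r
  have hadm : Adm c v t0 t2 γ := by
    refine ⟨hγ, fun s t p q r => ?_⟩
    rcases le_total t t1 with ht | ht
    · exact A1 s t p q ht
    rcases le_total t1 s with hs | hs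
    · exact A2 s t hs q r
    have B1 := A1 s t1 p hs le_rfl
    have B2 := A2 t1 t le_rfl ht r
    have hvi : ∀ a b, IntervalIntegrable (fun u => v u (γ u)) volume a b :=
      fun a b => (h.vc hγ).intervalIntegrable _ _
    have hci : ∀ a b, IntervalIntegrable (fun u => c u (γ u)) volume a b :=
      fun a b => (h.cc hγ).intervalIntegrable _ _
    rw [← intervalIntegral.integral_add_adjacent_intervals (hvi s t1) (hvi t1 t),
      ← intervalIntegral.integral_add_adjacent_intervals (hci s t1) (hci t1 t)]
    refine le_trans ?_ ((norm_add_le _ _).trans (add_le_add B1 B2))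
    apply le_of_eq
    congr 1
    abel
  have := adm_reach h (h01.trans h12) hadm
  rwa [e1 t0 h01, e2 t2 h12, b1, c2] at this

lemma Reg.rev (h : Reg K c v) : Reg K (fun t x => c (-t) x) (fun t x => - v (-t) x) where
  hc := h.hc.comp ((continuous_fst.neg).prodMk continuous_snd)
  hv := (h.hv.comp ((continuous_fst.neg).prodMk continuous_snd)).neg
  c0 t x := h.c0 _ _
  cK t x := h.cK _ _
  vK t x := by rw [norm_neg]; exact h.vK _ _

lemma reach_rev (h : Reg K c v) {t0 t1 : ℝ} {x0 x1 : Euc d} (h1 : Reachable c v t0 x0 t1 x1) :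
    Reachable (fun t x => c (-t) x) (fun t x => - v (-t) x) (-t1) x1 (-t0) x0 := by
  have h01 := h1.1
  obtain ⟨γ, a1, b1, c1⟩ := reach_adm h h1
  have := adm_reach (γ := fun t => γ (-t)) (t0 := -t1) (t1 := -t0) h.rev (by linarith)
    ⟨a1.1.comp continuous_neg, ?_⟩
  · simpa [b1, c1] using this
  · intro s t p q r
    have := a1.2 (-t) (-s) (by linarith) (by linarith) (by linarith)
    have e1 : ∫ u in s..t, - v (-u) (γ (-u)) = - ∫ u in (-t)..(-s), v u (γ u) := by
      rw [intervalIntegral.integral_neg]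
      rw [intervalIntegral.integral_comp_neg (fun u => v u (γ u))]
    have e2 : ∫ u in s..t, c (-u) (γ (-u)) = ∫ u in (-t)..(-s), c u (γ u) := by
      rw [intervalIntegral.integral_comp_neg (fun u => c u (γ u))]
    rw [e1, e2]
    refine le_trans (le_of_eq ?_) this
    rw [← norm_neg]
    congr 1
    abel

lemma reach_rev_iff (h : Reg K c v) {t0 t1 : ℝ} {x0 x1 : Euc d} :
    Reachable (fun t x => c (-t) x) (fun t x => - v (-t) x) (-t1) x1 (-t0) x0 ↔
    Reachable c v t0 x0 t1 x1 := by
  refine ⟨fun h1 => ?_, reach_rev h⟩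
  have := reach_rev h.rev h1
  simpa using this

lemma Reg.shift (h : Reg K c v) (s : ℝ) (y : Euc d) :
    Reg K (fun t x => c (t + s) (x + y)) (fun t x => v (t + s) (x + y)) where
  hc := h.hc.comp ((continuous_fst.add continuous_const).prodMk (continuous_snd.add continuous_const))
  hv := h.hv.comp ((continuous_fst.add continuous_const).prodMk (continuous_snd.add continuous_const))
  c0 t x := h.c0 _ _
  cK t x := h.cK _ _
  vK t x := h.vK _ _

lemma reach_shift (h : Reg K c v) (s : ℝ) (y : Euc d) {t0 t1 : ℝ} {x0 x1 : Euc d}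
    (h1 : Reachable c v (t0 + s) (x0 + y) (t1 + s) (x1 + y)) :
    Reachable (fun t x => c (t + s) (x + y)) (fun t x => v (t + s) (x + y)) t0 x0 t1 x1 := by
  have h01 := h1.1
  obtain ⟨γ, a1, b1, c1⟩ := reach_adm h h1
  have := adm_reach (γ := fun t => γ (t + s) - y) (t0 := t0) (t1 := t1) (h.shift s y) (by linarith)
    ⟨(a1.1.comp (continuous_id.add continuous_const)).sub continuous_const, ?_⟩
  · simpa [b1, c1] using this
  · intro p q hp hpq hq
    have := a1.2 (p + s) (q + s) (by linarith) (by linarith) (by linarith)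
    have e1 : ∫ u in p..q, v (u + s) (γ (u + s) - y + y) = ∫ u in (p+s)..(q+s), v u (γ u) := by
      rw [← intervalIntegral.integral_comp_add_right (fun u => v u (γ u))]
      simp
    have e2 : ∫ u in p..q, c (u + s) (γ (u + s) - y + y) = ∫ u in (p+s)..(q+s), c u (γ u) := by
      rw [← intervalIntegral.integral_comp_add_right (fun u => c u (γ u))]
      simp
    rw [e1, e2]
    refine le_trans (le_of_eq ?_) this
    congr 1
    simp only [sub_sub_sub_cancel_right]

lemma reach_shift_iff (h : Reg K c v) (s : ℝ) (y : Euc d) {t0 t1 : ℝ} {x0 x1 : Euc d} :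
    Reachable (fun t x => c (t + s) (x + y)) (fun t x => v (t + s) (x + y)) t0 x0 t1 x1 ↔
    Reachable c v (t0 + s) (x0 + y) (t1 + s) (x1 + y) := by
  refine ⟨fun h1 => ?_, reach_shift h s y⟩
  have := reach_shift (h.shift s y) (-s) (-y) (t0 := t0 + s) (t1 := t1 + s) (x0 := x0 + y)
    (x1 := x1 + y) (by simpa using h1)
  simpa using this

lemma reach_speed (h : Reg K c v) {t0 t1 : ℝ} {x0 x1 : Euc d} (h1 : Reachable c v t0 x0 t1 x1) :
    ‖x1 - x0‖ ≤ 2 * K * (t1 - t0) := by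
  have h01 := h1.1
  obtain ⟨γ, a1, b1, c1⟩ := reach_adm h h1
  rw [← b1, ← c1]
  exact Adm.lip h a1 le_rfl h01 le_rfl

lemma reach_line (h : Reg K c v) {t0 h0 : ℝ} (hh : 0 ≤ h0) (x w : Euc d)
    (hw : ∀ s, 0 ≤ s → s ≤ h0 → ‖w - v (t0 + s) (x + s • w)‖ ≤ c (t0 + s) (x + s • w)) :
    Reachable c v t0 x (t0 + h0) (x + h0 • w) := by
  have hc : Continuous (fun t : ℝ => x + (t - t0) • w) := by fun_prop
  have := adm_reach (γ := fun t => x + (t - t0) • w) (t0 := t0) (t1 := t0 + h0) h (by linarith) ⟨hc, ?_⟩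
  · simpa using this
  · intro s t p q r
    have hw' : (x + (t - t0) • w) - (x + (s - t0) • w) = ∫ u in s..t, w := by
      rw [intervalIntegral.integral_const, add_sub_add_left_eq_sub, ← sub_smul]
      congr 1; ring
    rw [hw', ← intervalIntegral.integral_sub (by simp) ((h.vc hc).intervalIntegrable _ _)]
    refine intervalIntegral.norm_integral_le_of_norm_le q ?_ ((h.cc hc).intervalIntegrable _ _)
    refine Eventually.of_forall fun u hu => ?_
    have := hw (u - t0) (by linarith [hu.1]) (by linarith [hu.2])
    simpa using this
end

section
variable {d : ℕ}

def trC (d : ℕ) : (Euc d →L[ℝ] Euc d) →L[ℝ] ℝ :=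
  LinearMap.toContinuousLinearMap
    ((LinearMap.trace ℝ (Euc d)).comp (ContinuousLinearMap.coeLM ℝ))

lemma trC_apply (A : Euc d →L[ℝ] Euc d) : trC d A = LinearMap.trace ℝ (Euc d) A.toLinearMap := rfl

lemma trC_smulRight (f : Euc d →L[ℝ] ℝ) (x : Euc d) : trC d (f.smulRight x) = f x := by
  rw [trC_apply]
  exact LinearMap.trace_smulRight f.toLinearMap x

/-- a.e. good points along the rays -/
lemma ae_ray {ν : Measure (Euc d)} [IsProbabilityMeasure ν] (hν : ν ≪ volume) {p : Euc d → Prop}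
    (hp : ∀ᵐ x ∂(volume : Measure (Euc d)), p x) (x : Euc d) :
    ∀ᵐ z ∂(ν.prod ((volume : Measure ℝ).restrict (Set.Icc 0 1))), p (x + z.2 • z.1) := by
  set N := toMeasurable volume {x | ¬ p x} with hN
  have N0 : volume N = 0 := by rw [hN, measure_toMeasurable]; exact hp
  have Nm : MeasurableSet N := measurableSet_toMeasurable _ _
  have key : (ν.prod ((volume : Measure ℝ).restrict (Set.Icc 0 1))) {z | x + z.2 • z.1 ∈ N} = 0 := by
    have hm : MeasurableSet {z : Euc d × ℝ | x + z.2 • z.1 ∈ N} := by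
      have : Measurable fun z : Euc d × ℝ => x + z.2 • z.1 := by fun_prop
      exact this Nm
    rw [Measure.prod_apply_symm hm]
    rw [lintegral_eq_zero_iff (measurable_measure_prodMk_right hm)]
    have h0 : ∀ᵐ s ∂((volume : Measure ℝ).restrict (Set.Icc 0 1)), s ≠ 0 :=
      ae_restrict_of_ae (by simp [ae_iff])
    filter_upwards [h0] with s hs
    simp only [Pi.zero_apply]
    apply hν
    have : ((fun y : Euc d => (y, s)) ⁻¹' {z : Euc d × ℝ | x + z.2 • z.1 ∈ N})
        = (fun y => s • y) ⁻¹' ((fun y => x + y) ⁻¹' N) := rfl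
    rw [this, Measure.addHaar_preimage_smul _ hs, measure_preimage_add, N0, mul_zero]
  rw [ae_iff]
  refine measure_mono_null (fun z hz => ?_) key
  exact subset_toMeasurable _ _ hz

def qI (v G : Euc d → Euc d) (x : Euc d) (z : Euc d × ℝ) : Euc d :=
  inner ℝ z.1 (G x) • v (x + z.2 • z.1) - inner ℝ (v (x + z.2 • z.1)) (G x) • z.1

def qF (ν : Measure (Euc d)) (v G : Euc d → Euc d) (x : Euc d) : Euc d :=
  ∫ z, qI v G x z ∂(ν.prod ((volume : Measure ℝ).restrict (Set.Icc 0 1)))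

def bF (ν : Measure (Euc d)) (v : Euc d → Euc d) (x : Euc d) : Euc d := ∫ y, v (x + y) ∂ν

def WF (ν : Measure (Euc d)) (v G : Euc d → Euc d) (x : Euc d) : Euc d :=
  v x - bF ν v x + qF ν v G x

structure Dat (ν : Measure (Euc d)) (v G : Euc d → Euc d) (G' : Euc d → Euc d →L[ℝ] Euc d)
    (K L D g g' : ℝ) : Prop where
  prob : IsProbabilityMeasure ν
  ac : ν ≪ volume
  hD : ∀ᵐ y ∂ν, ‖y‖ ≤ D
  D0 : 0 ≤ D
  L0 : 0 ≤ L
  g0 : 0 ≤ g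
  g'0 : 0 ≤ g'
  vK : ∀ x, ‖v x‖ ≤ K
  vL : ∀ x y, ‖v x - v y‖ ≤ L * ‖x - y‖
  tr : ∀ᵐ x ∂(volume : Measure (Euc d)), trC d (fderiv ℝ v x) = 0
  Gd : ∀ x, HasFDerivAt G (G' x) x
  Gs : ∀ x a b, inner ℝ (G' x a) b = inner ℝ a (G' x b)
  Gg : ∀ x, ‖G x‖ ≤ g
  Gg' : ∀ x, ‖G' x‖ ≤ g'

variable {ν : Measure (Euc d)} {v G : Euc d → Euc d} {G' : Euc d → Euc d →L[ℝ] Euc d}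
    {K L D g g' : ℝ}

lemma Dat.K0 (h : Dat ν v G G' K L D g g') : 0 ≤ K := (norm_nonneg _).trans (h.vK 0)
lemma Dat.lipv (h : Dat ν v G G' K L D g g') : LipschitzWith L.toNNReal v :=
  LipschitzWith.of_dist_le_mul fun x y => by
    rw [dist_eq_norm, dist_eq_norm, Real.coe_toNNReal _ h.L0]; exact h.vL x y
lemma Dat.Glip (h : Dat ν v G G' K L D g g') (x y : Euc d) : ‖G x - G y‖ ≤ g' * ‖x - y‖ :=
  Convex.norm_image_sub_le_of_norm_hasFDerivWithin_le
    (fun z _ => (h.Gd z).hasFDerivWithinAt) (fun z _ => h.Gg' z) convex_univ trivial trivial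
lemma Dat.vdiff (h : Dat ν v G G' K L D g g') :
    ∀ᵐ x ∂(volume : Measure (Euc d)), DifferentiableAt ℝ v x ∧ trC d (fderiv ℝ v x) = 0 :=
  h.lipv.ae_differentiableAt.and h.tr

lemma Dat.qI_meas (h : Dat ν v G G' K L D g g') (x : Euc d) : Continuous (qI v G x) := by
  have := h.lipv.continuous
  unfold qI
  fun_prop

lemma Dat.aeD (h : Dat ν v G G' K L D g g') :
    ∀ᵐ z ∂(ν.prod ((volume : Measure ℝ).restrict (Set.Icc 0 1))), ‖z.1‖ ≤ D := by
  have := h.prob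
  exact Measure.quasiMeasurePreserving_fst.ae h.hD

lemma pI : IsProbabilityMeasure ((volume : Measure ℝ).restrict (Set.Icc 0 1)) :=
  ⟨by simp⟩

lemma Dat.qI_bd (h : Dat ν v G G' K L D g g') (x : Euc d) :
    ∀ᵐ z ∂(ν.prod ((volume : Measure ℝ).restrict (Set.Icc 0 1))), ‖qI v G x z‖ ≤ 2 * K * D * g := by
  filter_upwards [h.aeD] with z hz
  unfold qI
  have h1 := h.vK (x + z.2 • z.1)
  have h2 := h.Gg x
  have h3 := abs_real_inner_le_norm z.1 (G x)
  have h4 := abs_real_inner_le_norm (v (x + z.2 • z.1)) (G x)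
  have hK := h.K0
  have hD := h.D0
  refine (norm_sub_le _ _).trans ?_
  rw [norm_smul, norm_smul, Real.norm_eq_abs, Real.norm_eq_abs]
  have : |inner ℝ z.1 (G x)| * ‖v (x + z.2 • z.1)‖ ≤ (D * g) * K := by
    gcongr
    · exact mul_nonneg hD h.g0
    exact h3.trans (by gcongr)
  have : |inner ℝ (v (x + z.2 • z.1)) (G x)| * ‖z.1‖ ≤ (K * g) * D := by
    gcongr
    · exact mul_nonneg hK h.g0
    exact h4.trans (by gcongr)
  nlinarith

lemma Dat.qI_lip (h : Dat ν v G G' K L D g g') :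
    ∀ᵐ z ∂(ν.prod ((volume : Measure ℝ).restrict (Set.Icc 0 1))), ∀ x x',
      ‖qI v G x z - qI v G x' z‖ ≤ 2 * D * (g * L + K * g') * ‖x - x'‖ := by
  filter_upwards [h.aeD] with z hz x x'
  have hK := h.K0
  have hD := h.D0
  have hL := h.L0
  have hg := h.g0
  have hg' := h.g'0
  set u := v (x + z.2 • z.1) with hu
  set u' := v (x' + z.2 • z.1) with hu'
  have h1 : ‖u‖ ≤ K := h.vK _
  have h1' : ‖u'‖ ≤ K := h.vK _
  have h2 : ‖u - u'‖ ≤ L * ‖x - x'‖ := by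
    have := h.vL (x + z.2 • z.1) (x' + z.2 • z.1)
    rwa [add_sub_add_right_eq_sub] at this
  have h3 := h.Glip x x'
  have h4 := h.Gg x
  have h4' := h.Gg x'
  have e : qI v G x z - qI v G x' z =
      (inner ℝ z.1 (G x) • (u - u') + inner ℝ z.1 (G x - G x') • u') -
      (inner ℝ (u - u') (G x) • z.1 + inner ℝ u' (G x - G x') • z.1) := by
    simp only [qI, ← hu, ← hu', inner_sub_left, inner_sub_right, smul_sub, sub_smul]
    abel
  have aux : ∀ a b c : Euc d, ∀ A B C : ℝ, ‖a‖ ≤ A → ‖b‖ ≤ B → ‖c‖ ≤ C →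
      ‖(inner ℝ a b : ℝ) • c‖ ≤ A * B * C := by
    intro a b c A B C ha hb hc
    have hA := (norm_nonneg _).trans ha
    have hB := (norm_nonneg _).trans hb
    rw [norm_smul]
    have := norm_inner_le_norm (𝕜 := ℝ) a b
    gcongr
    exact this.trans (by gcongr)
  have b1 := aux _ _ _ _ _ _ hz h4 h2
  have b2 := aux _ _ _ _ _ _ hz h3 h1'
  have b3 := aux _ _ _ _ _ _ h2 h4 hz
  have b4 := aux _ _ _ _ _ _ h1' h3 hz
  rw [e]
  refine (norm_sub_le _ _).trans ((add_le_add ((norm_add_le _ _).trans (add_le_add b1 b2))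
    ((norm_add_le _ _).trans (add_le_add b3 b4))).trans (le_of_eq ?_))
  ring

lemma Dat.qI_int (h : Dat ν v G G' K L D g g') (x : Euc d) :
    Integrable (qI v G x) (ν.prod ((volume : Measure ℝ).restrict (Set.Icc 0 1))) := by
  have := h.prob
  have := pI
  exact Integrable.of_bound (h.qI_meas x).aestronglyMeasurable _ (h.qI_bd x)

lemma Dat.q_bd (h : Dat ν v G G' K L D g g') (x : Euc d) : ‖qF ν v G x‖ ≤ 2 * K * D * g := by
  have := h.prob
  have := pI
  have := norm_integral_le_of_norm_le_const (h.qI_bd x)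
  simpa [qF] using this

lemma Dat.q_lip (h : Dat ν v G G' K L D g g') (x x' : Euc d) :
    ‖qF ν v G x - qF ν v G x'‖ ≤ 2 * D * (g * L + K * g') * ‖x - x'‖ := by
  have := h.prob
  have := pI
  unfold qF
  rw [← integral_sub (h.qI_int x) (h.qI_int x')]
  have := norm_integral_le_of_norm_le_const (h.qI_lip.mono fun z hz => hz x x')
  simpa using this

lemma Dat.b_int (h : Dat ν v G G' K L D g g') (x : Euc d) : Integrable (fun y => v (x + y)) ν := by
  have := h.prob
  have hc := h.lipv.continuous
  exact Integrable.of_bound (by fun_prop : Continuous fun y => v (x + y)).aestronglyMeasurable K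
    (Eventually.of_forall fun y => h.vK _)

lemma Dat.b_lip (h : Dat ν v G G' K L D g g') (x x' : Euc d) :
    ‖bF ν v x - bF ν v x'‖ ≤ L * ‖x - x'‖ := by
  have := h.prob
  unfold bF
  rw [← integral_sub (h.b_int x) (h.b_int x')]
  have := norm_integral_le_of_norm_le_const (μ := ν) (f := fun y => v (x + y) - v (x' + y))
    (C := L * ‖x - x'‖) (Eventually.of_forall fun y => by
      have := h.vL (x + y) (x' + y)
      rwa [add_sub_add_right_eq_sub] at this)
  simpa using this

lemma Dat.W_lip (h : Dat ν v G G' K L D g g') (x x' : Euc d) :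
    ‖WF ν v G x - WF ν v G x'‖ ≤ (2 * L + 2 * D * (g * L + K * g')) * ‖x - x'‖ := by
  have h1 := h.vL x x'
  have h2 := h.b_lip x x'
  have h3 := h.q_lip x x'
  have : WF ν v G x - WF ν v G x' = (v x - v x') - (bF ν v x - bF ν v x') + (qF ν v G x - qF ν v G x') := by
    unfold WF; abel
  rw [this]
  refine (norm_add_le _ _).trans ((add_le_add (norm_sub_le _ _) le_rfl).trans ?_)
  linarith

lemma Dat.b_diff (h : Dat ν v G G' K L D g g') (x : Euc d) :
    ∃ A, HasFDerivAt (bF ν v) A x ∧ trC d A = 0 := by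
  have := h.prob
  have hc := h.lipv.continuous
  have hgood : ∀ᵐ y ∂ν, DifferentiableAt ℝ v (x + y) ∧ trC d (fderiv ℝ v (x + y)) = 0 := by
    apply h.ac.ae_le
    have := (measurePreserving_add_left (volume : Measure (Euc d)) x).quasiMeasurePreserving.ae h.vdiff
    exact this
  have := hasFDerivAt_integral_of_dominated_loc_of_lip' (𝕜 := ℝ) (μ := ν) (F := fun x y => v (x + y))
    (F' := fun y => fderiv ℝ v (x + y)) (x₀ := x) (s := Set.univ) (bound := fun _ => L) univ_mem
    (fun z _ => (h.b_int z).aestronglyMeasurable) (h.b_int x)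
    ((measurable_fderiv ℝ v).comp (measurable_const_add x)).aestronglyMeasurable
    (Eventually.of_forall fun y z _ => by
      have := h.vL (z + y) (x + y)
      rwa [add_sub_add_right_eq_sub] at this) (integrable_const _)
    (hgood.mono fun y hy => by
      have := hy.1.hasFDerivAt
      have := this.comp x ((hasFDerivAt_id x).add_const y)
      rwa [ContinuousLinearMap.comp_id] at this)
  refine ⟨_, this.2, ?_⟩
  rw [← (trC d).integral_comp_comm this.1]
  exact integral_eq_zero_of_ae (hgood.mono fun y hy => hy.2)
end

section
variable {d : ℕ}
variable {ν : Measure (Euc d)} {v G : Euc d → Euc d} {G' : Euc d → Euc d →L[ℝ] Euc d}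
    {K L D g g' : ℝ}

def qD (v G : Euc d → Euc d) (G' : Euc d → Euc d →L[ℝ] Euc d) (x : Euc d) (z : Euc d × ℝ) :
    Euc d →L[ℝ] Euc d :=
  ((innerSL ℝ z.1).comp (G' x)).smulRight (v (x + z.2 • z.1)) +
   (inner ℝ z.1 (G x) : ℝ) • fderiv ℝ v (x + z.2 • z.1) -
  ((innerSL ℝ (G x)).comp (fderiv ℝ v (x + z.2 • z.1)) +
    (innerSL ℝ (v (x + z.2 • z.1))).comp (G' x)).smulRight z.1

lemma Dat.qI_diff (h : Dat ν v G G' K L D g g') (x : Euc d) (z : Euc d × ℝ)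
    (hz : DifferentiableAt ℝ v (x + z.2 • z.1)) : HasFDerivAt (fun x => qI v G x z) (qD v G G' x z) x := by
  have h1 : HasFDerivAt (fun x => v (x + z.2 • z.1)) (fderiv ℝ v (x + z.2 • z.1)) x := by
    have := hz.hasFDerivAt.comp x ((hasFDerivAt_id x).add_const (z.2 • z.1))
    rwa [ContinuousLinearMap.comp_id] at this
  have h2 := h.Gd x
  have h3 : HasFDerivAt (fun x => (inner ℝ z.1 (G x) : ℝ)) ((innerSL ℝ z.1).comp (G' x)) x :=
    (innerSL ℝ z.1).hasFDerivAt.comp x h2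
  have h4 := h1.inner ℝ h2
  have h5 := (h3.smul h1).sub (h4.smul_const z.1)
  refine h5.congr_fderiv ?_
  ext e i
  simp [qD]
  rw [real_inner_comm (fderiv ℝ v (x + z.2 • z.1) e) (G x)]
  ring

lemma Dat.qD_tr (h : Dat ν v G G' K L D g g') (x : Euc d) (z : Euc d × ℝ)
    (hz : trC d (fderiv ℝ v (x + z.2 • z.1)) = 0) :
    trC d (qD v G G' x z) = - inner ℝ (G x) (fderiv ℝ v (x + z.2 • z.1) z.1) := by
  simp only [qD, map_sub, map_add, map_smul, trC_smulRight, hz]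
  simp
  rw [← h.Gs, real_inner_comm (G' x z.1)]
  ring

lemma Dat.qD_meas (h : Dat ν v G G' K L D g g') (x : Euc d) (m : Measure (Euc d × ℝ)) :
    AEStronglyMeasurable (qD v G G' x) m := by
  have hc := h.lipv.continuous
  have m1 : AEStronglyMeasurable (fun z : Euc d × ℝ => v (x + z.2 • z.1)) m :=
    (by fun_prop : Continuous fun z : Euc d × ℝ => v (x + z.2 • z.1)).aestronglyMeasurable
  have m2 : AEStronglyMeasurable (fun z : Euc d × ℝ => fderiv ℝ v (x + z.2 • z.1)) m := by
    refine ((measurable_fderiv ℝ v).comp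
      (by fun_prop : Measurable fun z : Euc d × ℝ => x + z.2 • z.1)).aestronglyMeasurable
  have m3 : AEStronglyMeasurable (fun z : Euc d × ℝ => z.1) m := continuous_fst.aestronglyMeasurable
  have i3 : AEStronglyMeasurable (fun z : Euc d × ℝ => innerSL ℝ z.1) m :=
    ((innerSL ℝ (E := Euc d)).continuous.comp continuous_fst).aestronglyMeasurable
  have i1 : AEStronglyMeasurable (fun z : Euc d × ℝ => innerSL ℝ (v (x + z.2 • z.1))) m :=
    ((innerSL ℝ (E := Euc d)).continuous.comp_aestronglyMeasurable m1)
  have L1 := ContinuousLinearMap.compL ℝ (Euc d) (Euc d) ℝ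
  have S1 := ContinuousLinearMap.smulRightL ℝ (Euc d) (Euc d)
  have a1 := (ContinuousLinearMap.compL ℝ (Euc d) (Euc d) ℝ).aestronglyMeasurable_comp₂ i3
    (aestronglyMeasurable_const (b := G' x))
  have a2 := (ContinuousLinearMap.compL ℝ (Euc d) (Euc d) ℝ).aestronglyMeasurable_comp₂
    (aestronglyMeasurable_const (b := innerSL ℝ (G x))) m2
  have a3 := (ContinuousLinearMap.compL ℝ (Euc d) (Euc d) ℝ).aestronglyMeasurable_comp₂ i1
    (aestronglyMeasurable_const (b := G' x))
  have b1 := (ContinuousLinearMap.smulRightL ℝ (Euc d) (Euc d)).aestronglyMeasurable_comp₂ a1 m1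
  have b2 := (ContinuousLinearMap.smulRightL ℝ (Euc d) (Euc d)).aestronglyMeasurable_comp₂ (a2.add a3) m3
  have b3 : AEStronglyMeasurable (fun z : Euc d × ℝ => (inner ℝ z.1 (G x) : ℝ)) m :=
    (by fun_prop : Continuous fun z : Euc d × ℝ => (inner ℝ z.1 (G x) : ℝ)).aestronglyMeasurable
  exact (b1.add (b3.smul m2)).sub b2

lemma Dat.q_diff (h : Dat ν v G G' K L D g g') (x : Euc d) :
    ∃ A, HasFDerivAt (qF ν v G) A x ∧ trC d A = inner ℝ (G x) (v x - bF ν v x) := by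
  have := h.prob
  have := pI
  have hgood := ae_ray h.ac h.vdiff x
  have key := hasFDerivAt_integral_of_dominated_loc_of_lip' (𝕜 := ℝ)
    (μ := (ν.prod ((volume : Measure ℝ).restrict (Set.Icc 0 1)))) (F := fun x z => qI v G x z)
    (F' := qD v G G' x) (x₀ := x) (s := Set.univ) (bound := fun _ => 2 * D * (g * L + K * g')) univ_mem
    (fun z _ => (h.qI_int z).aestronglyMeasurable) (h.qI_int x)
    (h.qD_meas x _)
    (h.qI_lip.mono fun z hz y _ => hz y x) (integrable_const _)
    (hgood.mono fun z hz => h.qI_diff x z hz.1)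
  refine ⟨_, key.2, ?_⟩
  rw [← (trC d).integral_comp_comm key.1]
  have e1 : ∀ᵐ z ∂(ν.prod ((volume : Measure ℝ).restrict (Set.Icc 0 1))),
      trC d (qD v G G' x z) = - inner ℝ (G x) (fderiv ℝ v (x + z.2 • z.1) z.1) :=
    hgood.mono fun z hz => h.qD_tr x z hz.2
  have hint : Integrable (fun z : Euc d × ℝ => (- inner ℝ (G x) (fderiv ℝ v (x + z.2 • z.1) z.1) : ℝ))
     (ν.prod ((volume : Measure ℝ).restrict (Set.Icc 0 1))) :=
    ((trC d).integrable_comp key.1).congr e1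
  rw [integral_congr_ae e1, integral_prod _ hint]
  have e2 : ∀ᵐ y ∂ν, ∫ s in Set.Icc (0:ℝ) 1, (- inner ℝ (G x) (fderiv ℝ v (x + s • y) y) : ℝ) =
      - inner ℝ (G x) (v (x + y) - v x) := by
    have := Measure.ae_ae_of_ae_prod hgood
    filter_upwards [this, h.hD] with y hy hyD
    have hl : LipschitzWith (L.toNNReal * ‖y‖₊) (fun s : ℝ => v (x + s • y)) := by
      refine h.lipv.comp ?_
      refine LipschitzWith.of_dist_le_mul fun s t => ?_
      simp [dist_eq_norm, ← sub_smul, norm_smul, mul_comm]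
    have f := lip_ftcE hl 0 1
    have g1 : ∀ᵐ s ∂((volume : Measure ℝ).restrict (Set.Icc 0 1)),
       (- inner ℝ (G x) (fderiv ℝ v (x + s • y) y) : ℝ) =
        (innerSL ℝ (- G x)) (deriv (fun s : ℝ => v (x + s • y)) s) := by
      filter_upwards [hy] with s hs
      have hh : HasDerivAt (fun s : ℝ => x + s • y) y s := by
        simpa using ((hasDerivAt_id s).smul_const y).const_add x
      have := hs.1.hasFDerivAt.comp_hasDerivAt s hh
      have e := this.deriv
      simp only [Function.comp_def] at e
      rw [e]
      simp
    rw [integral_congr_ae g1]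
    rw [intervalIntegrable_iff_integrableOn_Icc_of_le zero_le_one] at f
    rw [ContinuousLinearMap.integral_comp_comm _ f.1]
    rw [integral_Icc_eq_integral_Ioc, ← intervalIntegral.integral_of_le zero_le_one, f.2]
    simp
  rw [integral_congr_ae e2]
  have : ∀ y, (- inner ℝ (G x) (v (x + y) - v x) : ℝ) = (innerSL ℝ (- G x)) (v (x + y) - v x) := by
    intro y; simp
  simp_rw [this]
  have hi : Integrable (fun y => v (x + y) - v x) ν := (h.b_int x).sub (integrable_const _)
  rw [ContinuousLinearMap.integral_comp_comm _ hi,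
    integral_sub (h.b_int x) (integrable_const _)]
  simp [bF, ← inner_neg_right]

lemma Dat.q_orth (h : Dat ν v G G' K L D g g') (x : Euc d) : inner ℝ (G x) (qF ν v G x) = (0:ℝ) := by
  have : inner ℝ (G x) (qF ν v G x) = (innerSL ℝ (G x)) (qF ν v G x) := rfl
  rw [this, qF, ← ContinuousLinearMap.integral_comp_comm _ (h.qI_int x)]
  apply integral_eq_zero_of_ae
  refine Eventually.of_forall fun z => ?_
  simp [qI, inner_sub_right, inner_smul_right]
  rw [real_inner_comm (G x), real_inner_comm (G x)]
  ring

lemma Dat.W_diff (h : Dat ν v G G' K L D g g') :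
    ∀ᵐ x ∂(volume : Measure (Euc d)), ∃ A, HasFDerivAt (WF ν v G) A x ∧
      trC d A = inner ℝ (G x) (WF ν v G x) := by
  filter_upwards [h.vdiff] with x hx
  obtain ⟨A1, a1, b1⟩ := h.b_diff x
  obtain ⟨A2, a2, b2⟩ := h.q_diff x
  refine ⟨_, (hx.1.hasFDerivAt.sub a1).add a2, ?_⟩
  have := h.q_orth x
  simp [b1, b2, hx.2, WF, inner_add_right, this]

lemma det_est (d : ℕ) (ε : ℝ) (hε : 0 < ε) : ∃ δ > 0, ∀ N : Euc d →L[ℝ] Euc d, ‖N‖ ≤ δ →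
    |(ContinuousLinearMap.id ℝ (Euc d) + N).det - 1 - trC d N| ≤ ε * ‖N‖ := by
  let b := (EuclideanSpace.basisFun (Fin d) ℝ).toBasis
  let M : (Euc d →L[ℝ] Euc d) →ₗ[ℝ] Matrix (Fin d) (Fin d) ℝ :=
    (LinearMap.toMatrix b b).toLinearMap.comp (ContinuousLinearMap.coeLM ℝ)
  have Mdet : ∀ N : Euc d →L[ℝ] Euc d, N.det = (M N).det := fun N => by
    simp [M, ContinuousLinearMap.det]
  have Mid : M (ContinuousLinearMap.id ℝ (Euc d)) = 1 := by
    simp [M]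
  have Mtr : ∀ N, (M N).trace = trC d N := fun N => by
    rw [trC_apply, LinearMap.trace_eq_matrix_trace ℝ b]; rfl
  let F : (Euc d →L[ℝ] Euc d) → ℝ := fun N => (ContinuousLinearMap.id ℝ (Euc d) + N).det
  have hF : DifferentiableAt ℝ F 0 := by
    have : F = fun N => ∑ σ : Equiv.Perm (Fin d), (Equiv.Perm.sign σ : ℝ) *
        ∏ i, (M (ContinuousLinearMap.id ℝ (Euc d) + N)) (σ i) i := by
      funext N
      simp only [F]
      rw [Mdet, Matrix.det_apply']
    rw [this]
    have hent : ∀ i j, Differentiable ℝ fun N => (M (ContinuousLinearMap.id ℝ (Euc d) + N)) i j := by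
      intro i j
      let l : (Euc d →L[ℝ] Euc d) →L[ℝ] ℝ :=
        LinearMap.toContinuousLinearMap ((Matrix.entryLinearMap ℝ ℝ i j).comp M)
      have : (fun N => (M (ContinuousLinearMap.id ℝ (Euc d) + N)) i j) = fun N =>
        l (ContinuousLinearMap.id ℝ (Euc d) + N) := rfl
      rw [this]
      exact l.differentiable.comp ((differentiable_const _).add differentiable_id)
    exact DifferentiableAt.fun_sum fun σ _ =>
      (HasFDerivAt.finsetProd (fun i _ => ((hent (σ i) i) 0).hasFDerivAt)).differentiableAt.const_mul _
  have hder : ∀ N, fderiv ℝ F 0 N = trC d N := by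
    intro N
    have h1 : HasDerivAt (fun t : ℝ => F (t • N)) (fderiv ℝ F 0 N) 0 := by
      have hl : HasDerivAt (fun t : ℝ => t • N) N 0 := by
        simpa using (hasDerivAt_id (0:ℝ)).smul_const N
      have h0 : HasFDerivAt F (fderiv ℝ F 0) ((0:ℝ) • N) := by
        have e : (0:ℝ) • N = 0 := zero_smul ℝ N
        simp only [e]; exact hF.hasFDerivAt
      exact h0.comp_hasDerivAt 0 hl
    have h2 : HasDerivAt (fun t : ℝ => F (t • N)) (trC d N) 0 := by
      have e : (fun t : ℝ => F (t • N)) = fun t => 1 + (M N).trace * t +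
        ((Matrix.det (1 + (Polynomial.X : Polynomial ℝ) • (M N).map Polynomial.C)).divX.divX).eval t * t ^ 2 := by
        funext t
        simp only [F]
        rw [Mdet, map_add, Mid, map_smul, Matrix.det_one_add_smul]
      rw [e]
      set p := (Matrix.det (1 + (Polynomial.X : Polynomial ℝ) • (M N).map Polynomial.C)).divX.divX
      have := (((hasDerivAt_id (0:ℝ)).const_mul (M N).trace).const_add 1).add
        ((p.hasDerivAt 0).mul ((hasDerivAt_id (0:ℝ)).pow 2))
      rw [← Mtr]
      convert! this using 1
      simp
    exact h1.unique h2
  have := hF.hasFDerivAt.isLittleO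
  have := (Asymptotics.isLittleO_iff.1 this) hε
  rw [Metric.eventually_nhds_iff] at this
  obtain ⟨δ, hδ, H⟩ := this
  refine ⟨δ / 2, by positivity, fun N hN => ?_⟩
  have := H (y := N) (by rw [dist_zero_right]; linarith)
  rw [sub_zero, hder N] at this
  simpa [F, Mdet, Mid] using this
end

section
variable {d : ℕ} {lam : ℝ}

def wA (lam : ℝ) (x : Euc d) : ℝ := 1 + lam ^ 2 * ‖x‖ ^ 2
def wr (d : ℕ) : ℝ := (d : ℝ) + 1
def wpsi (lam : ℝ) (x : Euc d) : ℝ := wr d / 2 * Real.log (wA lam x)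
def wphi (lam : ℝ) (x : Euc d) : ℝ := Real.exp (- wpsi lam x)
def wG (lam : ℝ) (x : Euc d) : Euc d := (wr d * lam ^ 2 / wA lam x) • x
def wG' (lam : ℝ) (x : Euc d) : Euc d →L[ℝ] Euc d :=
  (wr d * lam ^ 2 / wA lam x) • ContinuousLinearMap.id ℝ (Euc d) -
   (2 * wr d * lam ^ 4 / wA lam x ^ 2) • (innerSL ℝ x).smulRight x

lemma wr_pos (d : ℕ) : 0 < wr d := by unfold wr; positivity
lemma wA_pos (x : Euc d) : 1 ≤ wA lam x := by unfold wA; nlinarith [sq_nonneg (lam * ‖x‖)]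
lemma wA_cont : Continuous (wA (d := d) lam) := by unfold wA; fun_prop
lemma wphi_pos (x : Euc d) : 0 < wphi lam x := Real.exp_pos _
lemma wphi_cont : Continuous (wphi (d := d) lam) := by
  have := wA_cont (d := d) (lam := lam)
  unfold wphi wpsi
  have h : ∀ x : Euc d, wA lam x ≠ 0 := fun x => by linarith [wA_pos (lam := lam) x]
  fun_prop (disch := assumption)

lemma wphi_int (hl : 0 < lam) : Integrable (wphi (d := d) lam) := by
  have := integrable_rpow_neg_one_add_norm_sq (E := Euc d) (μ := volume) (r := wr d) (by simp [wr])
  have := this.comp_smul hl.ne'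
  refine this.congr (Eventually.of_forall fun x => ?_)
  simp only [wphi, wpsi, norm_smul]
  rw [Real.rpow_def_of_pos (by positivity), wA]
  congr 1
  rw [Real.norm_eq_abs, mul_pow, sq_abs]
  ring

lemma wpsi_add (x p : Euc d) :
    wpsi lam (x + p) - wpsi lam x ≤ inner ℝ (wG lam x) p + wr d / 2 * lam ^ 2 * ‖p‖ ^ 2 := by
  have h1 := wA_pos (lam := lam) x
  have h2 := wA_pos (lam := lam) (x + p)
  have hr := wr_pos d
  have h3 : Real.log (wA lam (x + p)) - Real.log (wA lam x) ≤ wA lam (x + p) / wA lam x - 1 := by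
    rw [← Real.log_div (by linarith) (by linarith)]
    exact Real.log_le_sub_one_of_pos (by positivity)
  have h4 : wA lam (x + p) / wA lam x - 1 ≤ 2 * lam ^ 2 / wA lam x * inner ℝ x p + lam ^ 2 * ‖p‖ ^ 2 := by
    have : wA lam (x + p) = wA lam x + 2 * lam ^ 2 * inner ℝ x p + lam ^ 2 * ‖p‖ ^ 2 := by
      unfold wA; rw [norm_add_sq_real]; ring
    rw [this]
    have e : (wA lam x + 2 * lam ^ 2 * inner ℝ x p + lam ^ 2 * ‖p‖ ^ 2) / wA lam x - 1
      = 2 * lam ^ 2 / wA lam x * inner ℝ x p + lam ^ 2 * ‖p‖ ^ 2 / wA lam x := by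
      field_simp; ring
    rw [e]
    gcongr
    exact div_le_self (by positivity) h1
  unfold wpsi wG
  rw [inner_smul_left]
  have : wr d / 2 * (Real.log (wA lam (x + p)) - Real.log (wA lam x)) ≤ wr d / 2 *
    (2 * lam ^ 2 / wA lam x * inner ℝ x p + lam ^ 2 * ‖p‖ ^ 2) := by gcongr; linarith
  refine le_trans (by linarith) (this.trans (le_of_eq ?_))
  simp
  ring

lemma wG_norm (hl : 0 < lam) (x : Euc d) : ‖wG lam x‖ ≤ wr d * lam := by
  have h1 := wA_pos (lam := lam) x
  have hr := wr_pos d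
  unfold wG
  rw [norm_smul, Real.norm_of_nonneg (by positivity), div_mul_eq_mul_div, div_le_iff₀ (by linarith)]
  have : lam * ‖x‖ ≤ wA lam x := by unfold wA; nlinarith [sq_nonneg (lam * ‖x‖ - 1)]
  calc wr d * lam ^ 2 * ‖x‖ = wr d * lam * (lam * ‖x‖) := by ring
    _ ≤ _ := by gcongr

lemma wG'_norm (hl : 0 < lam) (x : Euc d) : ‖wG' lam x‖ ≤ 3 * wr d * lam ^ 2 := by
  have h1 := wA_pos (lam := lam) x
  have hr := wr_pos d
  unfold wG'
  refine (norm_sub_le _ _).trans ?_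
  rw [norm_smul, norm_smul, Real.norm_of_nonneg (by positivity), Real.norm_of_nonneg (by positivity)]
  have a1 : wr d * lam ^ 2 / wA lam x * ‖ContinuousLinearMap.id ℝ (Euc d)‖ ≤ wr d * lam ^ 2 * 1 := by
    gcongr
    · exact div_le_self (by positivity) h1
    · exact ContinuousLinearMap.norm_id_le
  have a2 : ‖(innerSL ℝ x).smulRight x‖ ≤ ‖x‖ * ‖x‖ := by
    rw [ContinuousLinearMap.norm_smulRight_apply, innerSL_apply_norm]
  have a3 : 2 * wr d * lam ^ 4 / wA lam x ^ 2 * ‖(innerSL ℝ x).smulRight x‖ ≤ 2 * wr d * lam ^ 2 := by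
    calc _ ≤ 2 * wr d * lam ^ 4 / wA lam x ^ 2 * (‖x‖ * ‖x‖) := by gcongr
      _ = 2 * wr d * lam ^ 2 * (lam ^ 2 * ‖x‖ ^ 2) / wA lam x ^ 2 := by ring
      _ ≤ _ := by
        rw [div_le_iff₀ (by positivity)]
        gcongr
        unfold wA at *
        nlinarith [sq_nonneg (lam * ‖x‖)]
  linarith

lemma wG_sym (x a b : Euc d) : inner ℝ (wG' lam x a) b = (inner ℝ a (wG' lam x b) : ℝ) := by
  simp [wG', inner_sub_left, inner_sub_right, inner_smul_left, inner_smul_right]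
  rw [real_inner_comm a x]
  left; ring

lemma wG_deriv (x : Euc d) : HasFDerivAt (wG lam) (wG' lam x) x := by
  have h1 := wA_pos (lam := lam) x
  have hA : HasFDerivAt (wA (d := d) lam) ((2 * lam ^ 2) • innerSL ℝ x) x := by
    have := ((hasStrictFDerivAt_norm_sq x).hasFDerivAt.const_mul (lam ^ 2)).const_add 1
    refine this.congr_fderiv ?_
    ext e
    simp; ring
  have hi : HasFDerivAt (fun x : Euc d => wr d * lam ^ 2 / wA lam x)
     ((-(wr d * lam ^ 2) / wA lam x ^ 2) • ((2 * lam ^ 2) • innerSL ℝ x)) x := by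
    have e := ((hasDerivAt_inv (by linarith : wA lam x ≠ 0)).const_mul (wr d * lam ^ 2))
    have := e.comp_hasFDerivAt x hA
    refine this.congr_fderiv ?_
    ext e
    simp; ring
  have := hi.smul (hasFDerivAt_id x)
  refine this.congr_fderiv ?_
  ext e i
  simp [wG']
  ring

def wmu (d : ℕ) (lam : ℝ) : Measure (Euc d) :=
  volume.withDensity fun x => ENNReal.ofReal (wphi lam x)

lemma jac_real {B C1 g1 e1 ε h g0 D P CW : ℝ} (hh : 0 < h) (hg0 : |g0| ≤ g1) (hC1 : 0 ≤ C1)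
   (he1 : 0 ≤ e1) (hε : 0 < ε) (hCW : 0 ≤ CW)
   (b1 : h * g1 ≤ 1 / 4) (b2 : C1 * h ^ 2 ≤ 1 / 4) (b3 : h * (g1 ^ 2 + 2 * C1) ≤ ε / 2)
   (b4 : e1 * CW * 2 ≤ ε / 2) (b5 : h * (e1 * CW) ≤ 1 / 4)
   (hD : 1 + h * g0 - e1 * (h * CW) ≤ D) (hP : 1 - (h * g0 + C1 * h ^ 2) ≤ P) : 1 - ε * h ≤ D * P := by
  obtain ⟨p, q⟩ := abs_le.1 hg0
  have hg1 : 0 ≤ g1 := (abs_nonneg _).trans hg0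
  have u1 : h * g0 ≤ 1 / 4 := by nlinarith
  have u2 : - (1 / 4) ≤ h * g0 := by nlinarith
  have : (1 + h * g0 - e1 * (h * CW)) * (1 - (h * g0 + C1 * h ^ 2)) ≤ D * P := by
    apply mul_le_mul hD hP
    · linarith
    · nlinarith
  refine le_trans ?_ this
  have w1 : (h * g0) ^ 2 ≤ h ^ 2 * g1 ^ 2 := by
    rw [mul_pow]; exact mul_le_mul_of_nonneg_left (sq_le_sq' p q) (sq_nonneg h)
  set k := e1 * (h * CW) with hk
  have k0 : 0 ≤ k := by positivity
  set m := C1 * h ^ 2 with hm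
  have m0 : 0 ≤ m := by positivity
  set t := h * g0
  have w2 : k * 2 ≤ ε / 2 * h := by rw [hk]; nlinarith
  have w3 : h ^ 2 * g1 ^ 2 + 2 * m ≤ ε / 2 * h := by rw [hm]; nlinarith
  nlinarith [mul_nonneg k0 m0, mul_nonneg k0 (by linarith : 0 ≤ 1/4 - t), mul_nonneg m0 (by linarith : 0 ≤ 1/4 - t),mul_nonneg k0 (by linarith : 0 ≤ 1/4 + t), mul_nonneg m0 (by linarith : 0 ≤ 1/4 + t)]

lemma jac (d : ℕ) (lam : ℝ) (hl : 0 < lam) (B CW : ℝ) (hB : 0 ≤ B) (hCW : 0 ≤ CW) (ε : ℝ) (hε : 0 < ε) :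
    ∃ h1 > 0, ∀ W : Euc d → Euc d, (∀ x, ‖W x‖ ≤ B) → (∀ x y, ‖W x - W y‖ ≤ CW * ‖x - y‖) →
     (∀ᵐ x ∂(volume : Measure (Euc d)), ∃ A, HasFDerivAt W A x ∧
      trC d A = inner ℝ (wG lam x) (W x)) →
      ∀ h, 0 < h → h ≤ h1 → ∀ E, MeasurableSet E →
       MeasurableSet ((fun x => x + h • W x) '' E) ∧
       ENNReal.ofReal (1 - ε * h) * wmu d lam E ≤ wmu d lam ((fun x => x + h • W x) '' E) := by
  set g1 := wr d * lam * B with hg1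
  set C1 := wr d / 2 * lam ^ 2 * B ^ 2 with hC1
  have hr := wr_pos d
  set e1 := ε / (4 * (CW + 1)) with he1
  have e1p : 0 < e1 := by positivity
  have e1b : e1 * CW * 2 ≤ ε / 2 := by
    rw [he1, div_mul_eq_mul_div, div_mul_eq_mul_div, div_le_iff₀ (by positivity)]; nlinarith
  obtain ⟨δ, hδ, Hdet⟩ := det_est d e1 e1p
  obtain ⟨h1, h1p, p1, p2, p3, p4, p5, p6⟩ : ∃ h1 > 0, h1 * g1 ≤ 1 / 4 ∧ C1 * h1 ^ 2 ≤ 1 / 4 ∧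
      h1 * (g1 ^ 2 + 2 * C1) ≤ ε / 2 ∧ h1 * (e1 * CW) ≤ 1 / 4 ∧ h1 * CW ≤ δ ∧ h1 * CW ≤ 1 / 2 := by
    have ev : ∀ (f : ℝ → ℝ) (b : ℝ), Continuous f → f 0 = 0 → 0 < b → ∀ᶠ h in nhdsWithin 0 (Set.Ioi 0), f h ≤ b := by
      intro f b hf h0 hb
      have : Tendsto f (nhdsWithin 0 (Set.Ioi 0)) (nhds 0) := by
        have := (hf.tendsto 0).mono_left (nhdsWithin_le_nhds (s := Set.Ioi 0))
        rwa [h0] at this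
      exact (this.eventually (gt_mem_nhds hb)).mono fun _ h => h.le
    have := (ev (fun h => h * g1) (1/4) (by fun_prop) (by simp) (by norm_num)).and <|
      (ev (fun h => C1 * h ^ 2) (1/4) (by fun_prop) (by simp) (by norm_num)).and <|
      (ev (fun h => h * (g1 ^ 2 + 2 * C1)) (ε / 2) (by fun_prop) (by simp) (by positivity)).and <|
      (ev (fun h => h * (e1 * CW)) (1/4) (by fun_prop) (by simp) (by positivity)).and <|
      (ev (fun h => h * CW) δ (by fun_prop) (by simp) (by positivity)).and <|
      (ev (fun h => h * CW) (1/2) (by fun_prop) (by simp) (by positivity))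
    obtain ⟨h, a, b⟩ := (this.and self_mem_nhdsWithin).exists
    exact ⟨h, b, a⟩
  refine ⟨h1, h1p, fun W hWB hWL hWd h hh hh1 E hE => ?_⟩
  set f : Euc d → Euc d := fun x => x + h • W x with hf
  have hCWh : h * CW ≤ 1 / 2 := le_trans (by gcongr) p6
  have finj : Function.Injective f := by
    intro x y hxy
    simp only [hf] at hxy
    have e : x - y = - (h • (W x - W y)) := by
      rw [smul_sub]
      rw [← sub_eq_zero] at hxy ⊢
      rw [← hxy]; abel
    have e2 : ‖x - y‖ ≤ h * (CW * ‖x - y‖) := by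
      conv_lhs => rw [e]
      rw [norm_neg, norm_smul, Real.norm_of_nonneg hh.le]
      gcongr
      exact hWL x y
    have : ‖x - y‖ ≤ 1 / 2 * ‖x - y‖ := e2.trans (by nlinarith [norm_nonneg (x - y)])
    have : ‖x - y‖ = 0 := by linarith [norm_nonneg (x - y)]
    exact sub_eq_zero.1 (norm_eq_zero.1 this)
  have lipW : LipschitzWith CW.toNNReal W := LipschitzWith.of_dist_le_mul fun x y => by
    rw [dist_eq_norm, dist_eq_norm, Real.coe_toNNReal _ hCW]; exact hWL x y
  have fcont : Continuous f := by
    have := lipW.continuous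
    fun_prop
  have fm : ∀ E, MeasurableSet E → MeasurableSet (f '' E) := fun E hE =>
    hE.image_of_continuousOn_injOn fcont.continuousOn finj.injOn
  refine ⟨fm E hE, ?_⟩
  obtain ⟨N, hN1, hN2, hN3⟩ := exists_measurable_superset_of_null (ae_iff.1 hWd)
  have hgood : ∀ x ∈ E \ N, ∃ A, HasFDerivAt W A x ∧ trC d A = inner ℝ (wG lam x) (W x) := by
    intro x hx
    by_contra hcon
    exact hx.2 (hN1 hcon)
  have hE0 : MeasurableSet (E \ N) := hE.diff hN2
  have hder : ∀ x ∈ E \ N, HasFDerivWithinAt f (ContinuousLinearMap.id ℝ (Euc d) + h • fderiv ℝ W x) (E \ N) x := by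
    intro x hx
    obtain ⟨A, hA, -⟩ := hgood x hx
    exact ((hasFDerivAt_id x).add (hA.differentiableAt.hasFDerivAt.const_smul h)).hasFDerivWithinAt
  have key := lintegral_image_eq_lintegral_abs_det_fderiv_mul volume hE0 hder finj.injOn
    (fun x => ENNReal.ofReal (wphi lam x))
  have mu0 : wmu d lam E = wmu d lam (E \ N) := by
    refine (measure_diff_null ?_).symm
    exact withDensity_absolutelyContinuous _ _ hN3
  calc ENNReal.ofReal (1 - ε * h) * wmu d lam E
      = ENNReal.ofReal (1 - ε * h) * ∫⁻ x in E \ N, ENNReal.ofReal (wphi lam x) := by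
        rw [mu0, wmu, withDensity_apply _ hE0]
    _ = ∫⁻ x in E \ N, ENNReal.ofReal (1 - ε * h) * ENNReal.ofReal (wphi lam x) := by
        rw [lintegral_const_mul' _ _ ENNReal.ofReal_ne_top]
    _ ≤ ∫⁻ x in E \ N, ENNReal.ofReal |(ContinuousLinearMap.id ℝ (Euc d) + h • fderiv ℝ W x).det| *
          ENNReal.ofReal (wphi lam (f x)) := by
        refine setLIntegral_mono' hE0 fun x hx => ?_
        obtain ⟨A, hA, hA2⟩ := hgood x hx
        rw [← ENNReal.ofReal_mul (abs_nonneg _), ← ENNReal.ofReal_mul' (wphi_pos _).le]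
        apply ENNReal.ofReal_le_ofReal
        rw [hA.fderiv]
        have hAn : ‖A‖ ≤ CW := by
          have := hA.le_of_lipschitz lipW
          rwa [Real.coe_toNNReal _ hCW] at this
        have hAn' : ‖h • A‖ ≤ h * CW := by
          rw [norm_smul, Real.norm_of_nonneg hh.le]; gcongr
        have q1 := Hdet (h • A) (hAn'.trans (le_trans (by gcongr) p5))
        rw [map_smul, hA2, smul_eq_mul] at q1
        set g0 : ℝ := inner ℝ (wG lam x) (W x) with hg0
        have hg0' : |g0| ≤ g1 := by
          refine (abs_real_inner_le_norm _ _).trans ?_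
          rw [hg1]
          gcongr
          · exact wG_norm hl x
          · exact hWB x
        have hD : 1 + h * g0 - e1 * (h * CW) ≤ |(ContinuousLinearMap.id ℝ (Euc d) + h • A).det| := by
          have := (abs_le.1 q1).1
          have u : e1 * ‖h • A‖ ≤ e1 * (h * CW) := by gcongr
          linarith [le_abs_self (ContinuousLinearMap.id ℝ (Euc d) + h • A).det]
        have hP : 1 - (h * g0 + C1 * h ^ 2) ≤ Real.exp (wpsi lam x - wpsi lam (f x)) := by
          have := wpsi_add (lam := lam) x (h • W x)
          rw [inner_smul_right, norm_smul, Real.norm_of_nonneg hh.le] at this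
          have e := Real.add_one_le_exp (wpsi lam x - wpsi lam (f x))
          have w : wr d / 2 * lam ^ 2 * (h * ‖W x‖) ^ 2 ≤ C1 * h ^ 2 := by
            rw [hC1]
            calc _ ≤ wr d / 2 * lam ^ 2 * (h * B) ^ 2 := by gcongr; exact hWB x
              _ = _ := by ring
          simp only [hf] at *
          linarith
        have := jac_real (B := B) hh hg0' (by positivity) e1p.le hε hCW (le_trans (by gcongr) p1)
          (le_trans (by gcongr) p2) (le_trans (by gcongr) p3) e1b (le_trans (by gcongr) p4) hD hP
        have e3 : wphi lam (f x) = Real.exp (wpsi lam x - wpsi lam (f x)) * wphi lam x := by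
          unfold wphi; rw [← Real.exp_add]; congr 1; ring
        rw [e3, ← mul_assoc]
        have := wphi_pos (lam := lam) x
        gcongr
    _ = ∫⁻ x in f '' (E \ N), ENNReal.ofReal (wphi lam x) := key.symm
    _ = wmu d lam (f '' (E \ N)) := by rw [wmu, withDensity_apply _ (fm _ hE0)]
    _ ≤ _ := measure_mono (Set.image_mono Set.diff_subset)
end

section
variable {d : ℕ} {lam : ℝ}

lemma wmu_fin (hl : 0 < lam) : IsFiniteMeasure (wmu d lam) := by
  unfold wmu
  exact isFiniteMeasure_withDensity_ofReal (wphi_int hl).2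

lemma wphi_le_one (x : Euc d) : wphi lam x ≤ 1 := by
  unfold wphi wpsi
  rw [Real.exp_le_one_iff]
  have := Real.log_nonneg (wA_pos (lam := lam) x)
  have := wr_pos d
  have : 0 ≤ wr d / 2 * Real.log (wA lam x) := by positivity
  linarith

lemma wphi_ge (x : Euc d) {ρ : ℝ} (hx : ‖x‖ ≤ ρ) :
    Real.exp (-(wr d / 2 * Real.log (1 + lam ^ 2 * ρ ^ 2))) ≤ wphi lam x := by
  unfold wphi wpsi
  have := wr_pos d
  gcongr
  · linarith [wA_pos (lam := lam) x]
  · unfold wA; gcongr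

lemma wmu_le_vol {E : Set (Euc d)} (hE : MeasurableSet E) : wmu d lam E ≤ volume E := by
  rw [wmu, withDensity_apply _ hE]
  calc _ ≤ ∫⁻ x in E, 1 := lintegral_mono fun x => by
        rw [← ENNReal.ofReal_one]; exact ENNReal.ofReal_le_ofReal (wphi_le_one x)
    _ = _ := by simp

lemma wmu_ge_vol {E : Set (Euc d)} (hE : MeasurableSet E) {ρ : ℝ} (hB : ∀ x ∈ E, ‖x‖ ≤ ρ) :
    ENNReal.ofReal (Real.exp (-(wr d / 2 * Real.log (1 + lam ^ 2 * ρ ^ 2)))) * volume E ≤ wmu d lam E := by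
  rw [wmu, withDensity_apply _ hE, ← setLIntegral_const]
  exact setLIntegral_mono' hE fun x hx => ENNReal.ofReal_le_ofReal (wphi_ge x (hB x hx))

lemma iso_core {ρ r : ℝ} (hρ : 0 < ρ) (hr : 0 < r) (n : ℕ) (hn : 2 * ρ / r < n) {F : Set (Euc d)}
    (hF : MeasurableSet F) :
    volume (F ∩ ball 0 ρ) * volume (Fᶜ ∩ ball 0 ρ) ≤
      n * volume ((thickening r F \ F) ∩ ball 0 ρ) * volume (ball (0 : Euc d) (2 * ρ)) := by
  have hn0 : (0:ℝ) < n := lt_of_le_of_lt (by positivity) hn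
  set D1 := (thickening r F \ F) ∩ ball (0 : Euc d) ρ with hD1
  have hD1m : MeasurableSet D1 := (isOpen_thickening.measurableSet.diff hF).inter measurableSet_ball
  set T : Set (Euc d × Euc d) := {p | p.1 ∈ F ∩ ball 0 ρ ∧ p.1 + p.2 ∈ Fᶜ ∩ ball 0 ρ} with hT
  have h1 : MeasurableSet (F ∩ ball (0 : Euc d) ρ) := hF.inter measurableSet_ball
  have h2 : MeasurableSet (Fᶜ ∩ ball (0 : Euc d) ρ) := hF.compl.inter measurableSet_ball
  have hTm : MeasurableSet T :=
    (measurable_fst h1).inter ((measurable_fst.add measurable_snd) h2)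
  have A : (volume.prod volume) T = volume (F ∩ ball (0 : Euc d) ρ) * volume (Fᶜ ∩ ball (0 : Euc d) ρ) := by
    rw [Measure.prod_apply hTm]
    have : ∀ x : Euc d, volume (Prod.mk x ⁻¹' T) =
        (F ∩ ball (0 : Euc d) ρ).indicator (fun _ => volume (Fᶜ ∩ ball (0 : Euc d) ρ)) x := by
      intro x
      by_cases hx : x ∈ F ∩ ball (0 : Euc d) ρ
      · rw [Set.indicator_of_mem hx]
        have : Prod.mk x ⁻¹' T = (fun z => x + z) ⁻¹' (Fᶜ ∩ ball (0 : Euc d) ρ) := by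
          ext z; simp only [hT, Set.mem_preimage, Set.mem_setOf_eq, hx, true_and]
        rw [this, measure_preimage_add]
      · rw [Set.indicator_of_notMem hx]
        have : Prod.mk x ⁻¹' T = ∅ := by
          ext z; simp only [hT, Set.mem_preimage, Set.mem_setOf_eq, hx, false_and, Set.mem_empty_iff_false]
        rw [this, measure_empty]
    simp_rw [this]
    rw [lintegral_indicator h1, setLIntegral_const, mul_comm]
  rw [← A, Measure.prod_apply_symm hTm]
  have hz : ∀ z : Euc d, volume ((fun x => (x, z)) ⁻¹' T) ≤
      (ball (0 : Euc d) (2 * ρ)).indicator (fun _ => n * volume D1) z := by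
    intro z
    by_cases hz : z ∈ ball (0 : Euc d) (2 * ρ)
    · rw [Set.indicator_of_mem hz]
      have hzn : ‖z‖ < 2 * ρ := by simpa using hz
      have sub : ((fun x => (x, z)) ⁻¹' T) ⊆ ⋃ i ∈ Finset.range n, (fun x => x + (((i:ℝ) + 1) / n) • z) ⁻¹' D1 := by
        rintro x ⟨⟨hx1, hx2⟩, hx3, hx4⟩
        simp only at hx1 hx2 hx3 hx4
        have hex : ∃ i : ℕ, x + ((i : ℝ) / n) • z ∉ F := ⟨n, by rw [div_self hn0.ne', one_smul]; exact hx3⟩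
        classical
        obtain ⟨j, hj⟩ : ∃ j, Nat.find hex = j + 1 := by
          apply Nat.exists_eq_succ_of_ne_zero
          intro h0
          have := Nat.find_spec hex
          rw [h0] at this
          simp [hx1] at this
        have hjn : j + 1 ≤ n := by
          rw [← hj]; apply Nat.find_min'
          rw [div_self hn0.ne', one_smul]; exact hx3
        have s1 : x + (((j:ℝ) + 1) / n) • z ∉ F := by
          have := Nat.find_spec hex; rw [hj] at this; exact_mod_cast this
        have s2 : x + ((j:ℝ) / n) • z ∈ F := by
          have := Nat.find_min hex (m := j) (by omega); simpa using this
        simp only [Set.mem_iUnion, Finset.mem_range, Set.mem_preimage]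
        refine ⟨j, by omega, ⟨?_, s1⟩, ?_⟩
        · rw [mem_thickening_iff]
          refine ⟨_, s2, ?_⟩
          rw [dist_eq_norm]
          have : x + (((j:ℝ) + 1) / n) • z - (x + ((j:ℝ) / n) • z) = (1 / (n:ℝ)) • z := by
            rw [add_sub_add_left_eq_sub, ← sub_smul]; congr 1; ring
          rw [this, norm_smul, Real.norm_of_nonneg (by positivity)]
          rw [div_lt_iff₀ hr] at hn
          rw [one_div_mul_eq_div, div_lt_iff₀ hn0]
          linarith
        · have hc := convex_ball (0 : Euc d) ρ
          have := hc.add_smul_sub_mem hx2 hx4 (t := ((j:ℝ) + 1) / n) ⟨by positivity, by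
            rw [div_le_one hn0]; exact_mod_cast hjn⟩
          simpa using this
      calc volume ((fun x => (x, z)) ⁻¹' T) ≤ _ := measure_mono sub
        _ ≤ ∑ i ∈ Finset.range n, volume ((fun x => x + (((i:ℝ) + 1) / n) • z) ⁻¹' D1) :=
            measure_biUnion_finset_le _ _
        _ = ∑ i ∈ Finset.range n, volume D1 := by
            refine Finset.sum_congr rfl fun i _ => ?_
            rw [measure_preimage_add_right]
        _ = _ := by simp
    · rw [Set.indicator_of_notMem hz]
      have : (fun x => (x, z)) ⁻¹' T = ∅ := by
        rw [Set.eq_empty_iff_forall_notMem]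
        rintro x ⟨⟨hx1, hx2⟩, hx3, hx4⟩
        apply hz
        simp only [mem_ball, dist_zero_right] at hx2 hx4 ⊢
        have : z = (x + z) - x := by abel
        rw [this]
        exact (norm_sub_le _ _).trans_lt (by linarith)
      rw [this, measure_empty]
  calc _ ≤ _ := lintegral_mono hz
    _ = _ := by rw [lintegral_indicator measurableSet_ball, setLIntegral_const]

lemma iso (d : ℕ) (lam : ℝ) (hl : 0 < lam) (m0 : ℝ) (hm0 : 0 < m0) :
    ∃ η > 0, ∀ r, 0 < r → r ≤ 1 → ∀ F : Set (Euc d), MeasurableSet F → m0 ≤ (wmu d lam).real F →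
      m0 ≤ (wmu d lam).real Fᶜ → (wmu d lam).real F + η * r ≤ (wmu d lam).real (thickening r F) := by
  have := wmu_fin (d := d) hl
  set μ := wmu d lam with hμ
  obtain ⟨ρ, hρ, hρm⟩ : ∃ ρ : ℝ, 1 ≤ ρ ∧ μ.real (ball 0 ρ)ᶜ ≤ m0 / 2 := by
    have h1 : Tendsto (fun n : ℕ => μ (ball (0 : Euc d) n)ᶜ) atTop (nhds (μ (⋂ n : ℕ, (ball (0 : Euc d) n)ᶜ))) := by
      apply tendsto_measure_iInter_atTop
      · intro n; exact measurableSet_ball.compl.nullMeasurableSet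
      · intro a b hab
        simp only [Set.le_eq_subset, Set.compl_subset_compl]
        exact ball_subset_ball (by exact_mod_cast hab)
      · exact ⟨0, measure_ne_top _ _⟩
    have h2 : (⋂ n : ℕ, (ball (0 : Euc d) n)ᶜ) = ∅ := by
      rw [← Set.compl_iUnion, iUnion_ball_nat, Set.compl_univ]
    rw [h2, measure_empty] at h1
    have h3 := h1.eventually (gt_mem_nhds (ENNReal.ofReal_pos.2 (half_pos hm0)))
    obtain ⟨n, hn, hn1⟩ := (h3.and (eventually_ge_atTop 1)).exists
    refine ⟨n, by exact_mod_cast hn1, ?_⟩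
    rw [Measure.real]
    exact ENNReal.toReal_le_of_le_ofReal (by positivity) hn.le
  set V := (volume (ball (0 : Euc d) (2 * ρ))).toReal with hV
  have hVt : volume (ball (0 : Euc d) (2 * ρ)) ≠ ⊤ := measure_ball_lt_top.ne
  have hV0 : 0 < V := ENNReal.toReal_pos (measure_ball_pos _ _ (by linarith)).ne' hVt
  set p := Real.exp (-(wr d / 2 * Real.log (1 + lam ^ 2 * ρ ^ 2))) with hp
  have p0 : 0 < p := Real.exp_pos _
  refine ⟨p * (m0 / 2 * (m0 / 2)) / ((2 * ρ + 1) * V), by positivity, ?_⟩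
  intro r hr hr1 F hF hF1 hF2
  have big : ∀ A : Set (Euc d), MeasurableSet A → m0 ≤ μ.real A → m0 / 2 ≤ volume.real (A ∩ ball 0 ρ) := by
    intro A hA hm
    have e1 : μ.real A ≤ μ.real (A ∩ ball 0 ρ) + μ.real (ball 0 ρ)ᶜ := by
      rw [← measureReal_inter_add_diff (s := A) (measurableSet_ball (x := (0 : Euc d)) (ε := ρ))]
      gcongr
      · exact measure_ne_top _ _
      · intro x hx; exact hx.2
    have e2 : μ.real (A ∩ ball 0 ρ) ≤ volume.real (A ∩ ball 0 ρ) := by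
      unfold Measure.real
      apply ENNReal.toReal_mono
      · exact (measure_mono Set.inter_subset_right).trans_lt measure_ball_lt_top |>.ne
      · exact wmu_le_vol (hA.inter measurableSet_ball)
    linarith
  have b1 := big F hF hF1
  have b2 := big _ hF.compl hF2
  set n := ⌊2 * ρ / r⌋₊ + 1 with hn
  have n1 : 2 * ρ / r < n := by rw [hn]; push_cast; exact Nat.lt_floor_add_one _
  have n2 : (n : ℝ) ≤ (2 * ρ + 1) / r := by
    rw [hn]; push_cast
    have : (⌊2 * ρ / r⌋₊ : ℝ) ≤ 2 * ρ / r := Nat.floor_le (by positivity)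
    have e : (1:ℝ) ≤ 1 / r := by rw [le_div_iff₀ hr]; linarith
    rw [add_div]; linarith
  have core := iso_core (ρ := ρ) (by linarith) hr n n1 hF
  set D1 := (thickening r F \ F) ∩ ball (0 : Euc d) ρ with hD1
  have hD1m : MeasurableSet D1 := (isOpen_thickening.measurableSet.diff hF).inter measurableSet_ball
  have hD1t : volume D1 ≠ ⊤ := (measure_mono Set.inter_subset_right).trans_lt measure_ball_lt_top |>.ne
  have core2 : volume.real (F ∩ ball 0 ρ) * volume.real (Fᶜ ∩ ball 0 ρ) ≤ n * volume.real D1 * V := by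
    have := ENNReal.toReal_mono (ENNReal.mul_ne_top (ENNReal.mul_ne_top (by simp) hD1t) hVt) core
    simpa [ENNReal.toReal_mul, Measure.real] using this
  have d1 : p * volume.real D1 ≤ μ.real D1 := by
    have := ENNReal.toReal_mono (measure_ne_top _ _) (wmu_ge_vol (lam := lam) hD1m (ρ := ρ)
      (fun x hx => by have := hx.2; simp at this; exact this.le))
    rwa [ENNReal.toReal_mul, ENNReal.toReal_ofReal p0.le] at this
  have d2 : μ.real F + μ.real D1 ≤ μ.real (thickening r F) := by
    rw [← measureReal_union (by
      rw [Set.disjoint_left]; intro x hx hx2; exact hx2.1.2 hx) hD1m]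
    apply measureReal_mono
    · apply Set.union_subset (self_subset_thickening hr F)
      intro x hx; exact hx.1.1
    · exact measure_ne_top _ _
  have d3 : m0 / 2 * (m0 / 2) ≤ (2 * ρ + 1) / r * volume.real D1 * V := by
    calc m0 / 2 * (m0 / 2) ≤ volume.real (F ∩ ball 0 ρ) * volume.real (Fᶜ ∩ ball 0 ρ) := by gcongr
      _ ≤ _ := core2
      _ ≤ _ := by gcongr
  have d4 : (m0 / 2 * (m0 / 2)) / ((2 * ρ + 1) * V) * r ≤ volume.real D1 := by
    rw [div_mul_eq_mul_div, div_le_iff₀ (by positivity)]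
    calc m0 / 2 * (m0 / 2) * r ≤ ((2 * ρ + 1) / r * volume.real D1 * V) * r := by gcongr
      _ = _ := by field_simp
  calc _ = μ.real F + p * ((m0 / 2 * (m0 / 2)) / ((2 * ρ + 1) * V) * r) := by ring
    _ ≤ μ.real F + p * volume.real D1 := by gcongr
    _ ≤ _ := by linarith
end

section
variable {d : ℕ}

def boxS (d : ℕ) (L : ℝ) : Set (Euc d) := {y : Euc d | ∀ i, y i ∈ Set.Icc (0:ℝ) L}

def boxN (d : ℕ) (L : ℝ) : Measure (Euc d) := (ENNReal.ofReal (L ^ d))⁻¹ • volume.restrict (boxS d L)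

lemma boxS_vol {L : ℝ} (hL : 0 < L) : volume (boxS d L) = ENNReal.ofReal (L ^ d) := by
  have e : boxS d L = WithLp.ofLp ⁻¹' (Set.univ.pi fun _ : Fin d => Set.Icc (0:ℝ) L) := by
    ext y; simp only [boxS, Set.mem_setOf_eq, Set.mem_preimage, Set.mem_univ_pi]
  rw [e, (PiLp.volume_preserving_ofLp (Fin d)).measure_preimage
    (MeasurableSet.univ_pi fun _ => measurableSet_Icc).nullMeasurableSet, volume_pi_pi]
  simp [ENNReal.ofReal_pow hL.le]

lemma boxS_meas {L : ℝ} : MeasurableSet (boxS d L) := by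
  have : boxS d L = ⋂ i, (fun y : Euc d => y i) ⁻¹' (Set.Icc (0:ℝ) L) := by ext; simp [boxS]
  rw [this]
  refine MeasurableSet.iInter fun i => ?_
  exact (by fun_prop : Measurable fun y : Euc d => y i) measurableSet_Icc

lemma boxN_prob {L : ℝ} (hL : 0 < L) : IsProbabilityMeasure (boxN d L) := ⟨by
  have h : (0:ℝ) < L ^ d := by positivity
  simp only [boxN, Measure.smul_apply, Measure.restrict_apply_univ, boxS_vol hL, smul_eq_mul]
  exact ENNReal.inv_mul_cancel (ENNReal.ofReal_pos.2 h).ne' ENNReal.ofReal_ne_top⟩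

lemma boxN_ac {L : ℝ} : boxN d L ≪ volume :=
  (Measure.smul_absolutelyContinuous).trans Measure.restrict_le_self.absolutelyContinuous

lemma boxN_D {L : ℝ} (hL : 0 < L) : ∀ᵐ y ∂(boxN d L), ‖y‖ ≤ Real.sqrt (d * L ^ 2) := by
  have : ∀ᵐ y ∂(volume.restrict (boxS d L)), ‖y‖ ≤ Real.sqrt (d * L ^ 2) := by
    filter_upwards [ae_restrict_mem boxS_meas] with y hy
    rw [EuclideanSpace.norm_eq]
    apply Real.sqrt_le_sqrt
    calc ∑ i, ‖y i‖ ^ 2 ≤ ∑ i : Fin d, L ^ 2 := by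
          gcongr with i
          rw [Real.norm_of_nonneg (hy i).1]; exact (hy i).2
      _ = _ := by simp
  exact Measure.smul_absolutelyContinuous.ae_le this

lemma boxN_int {L : ℝ} (hL : 0 < L) (f : Euc d → Euc d) :
    ∫ y, f y ∂(boxN d L) = (L ^ d)⁻¹ • ∫ y in boxS d L, f y := by
  have h : (0:ℝ) < L ^ d := by positivity
  rw [boxN, integral_smul_measure, ENNReal.toReal_inv, ENNReal.toReal_ofReal h.le]

structure Good (K Lp L a b κ δ : ℝ) (c : ℝ → Euc d → ℝ) (v : ℝ → Euc d → Euc d) : Prop where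
  reg : Reg K c v
  cb : ∀ t x, b ≤ c t x
  vt : ∀ t t', |t - t'| ≤ δ → ∀ x, ‖v t x - v t' x‖ ≤ κ
  vL : ∀ t x x', ‖v t x - v t x'‖ ≤ Lp * ‖x - x'‖
  tr : ∀ t, ∀ᵐ x ∂(volume : Measure (Euc d)), trC d (fderiv ℝ (v t) x) = 0
  av : ∀ t x, ‖∫ y, v t (x + y) ∂(boxN d L)‖ ≤ a

structure Par (K Lp L a b κ δ : ℝ) : Prop where
  K0 : 0 ≤ K
  Lp0 : 0 ≤ Lp
  L0 : 0 < L
  ab : a + 6 * κ ≤ b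
  κ0 : 0 < κ
  δ0 : 0 < δ
  a0 : 0 ≤ a

variable {K Lp L a b κ δ : ℝ} {c : ℝ → Euc d → ℝ} {v : ℝ → Euc d → Euc d}

lemma Good.rev (h : Good K Lp L a b κ δ c v) :
    Good K Lp L a b κ δ (fun t x => c (-t) x) (fun t x => - v (-t) x) where
  reg := h.reg.rev
  cb t x := h.cb _ _
  vt t t' ht x := by
    have := h.vt (-t') (-t) (by rw [neg_sub_neg]; exact ht) x
    rwa [neg_sub_neg]
  vL t x x' := by
    have := h.vL (-t) x' x
    rw [neg_sub_neg]
    rwa [norm_sub_rev x]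
  tr t := by
    filter_upwards [h.tr (-t)] with x hx
    have : fderiv ℝ (fun y => - v (-t) y) x = - fderiv ℝ (v (-t)) x := fderiv_fun_neg
    rw [this, map_neg, hx, neg_zero]
  av t x := by
    rw [integral_neg, norm_neg]; exact h.av _ _

lemma Good.shift (h : Good K Lp L a b κ δ c v) (s : ℝ) (y : Euc d) :
    Good K Lp L a b κ δ (fun t x => c (t + s) (x + y)) (fun t x => v (t + s) (x + y)) where
  reg := h.reg.shift s y
  cb t x := h.cb _ _
  vt t t' ht x := h.vt _ _ (by rwa [add_sub_add_right_eq_sub]) _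
  vL t x x' := by
    have := h.vL (t + s) (x + y) (x' + y)
    rwa [add_sub_add_right_eq_sub] at this
  tr t := by
    have := (measurePreserving_add_right (volume : Measure (Euc d)) y).quasiMeasurePreserving.ae (h.tr (t + s))
    filter_upwards [this] with x hx
    have e : fderiv ℝ (fun x => v (t + s) (x + y)) x = fderiv ℝ (v (t + s)) (x + y) :=
      fderiv_comp_add_right y
    rw [e]; exact hx
  av t x := by
    have := h.av (t + s) (x + y)
    simp_rw [add_right_comm x _ y]
    exact this

def sg (K Lp b κ δ : ℝ) : ℝ := min δ (κ / (Lp * (K + b) + 1))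

lemma Par.b0 (p : Par K Lp L a b κ δ) : 0 < b := by linarith [p.ab, p.κ0, p.a0]

lemma Par.sg0 (p : Par K Lp L a b κ δ) : 0 < sg K Lp b κ δ := by
  have := p.b0
  have := p.K0
  have := p.Lp0
  have := p.κ0
  exact lt_min p.δ0 (by positivity)

lemma Good.euler (p : Par K Lp L a b κ δ) (h : Good K Lp L a b κ δ c v) {h0 : ℝ} (h00 : 0 ≤ h0)
    (h01 : h0 ≤ sg K Lp b κ δ) (t : ℝ) (x z : Euc d) (hz : ‖z‖ ≤ b - 2 * κ) :
    Reachable c v t x (t + h0) (x + h0 • (v t x + z)) := by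
  have b0 := p.b0
  have K0 := p.K0
  have Lp0 := p.Lp0
  have κ0 := p.κ0
  refine reach_line h.reg h00 x _ fun s hs1 hs2 => ?_
  have hs : 0 ≤ s ∧ s ≤ h0 := ⟨hs1, hs2⟩
  refine le_trans ?_ (h.cb _ _)
  have s1 : s ≤ δ := hs.2.trans (h01.trans (min_le_left _ _))
  have s2 : s * (Lp * (K + b)) ≤ κ := by
    have h3 : s ≤ κ / (Lp * (K + b) + 1) := hs.2.trans (h01.trans (min_le_right _ _))
    rw [le_div_iff₀ (by positivity)] at h3
    nlinarith [hs.1]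
  set w := v t x + z with hw
  have hwn : ‖w‖ ≤ K + b := by
    refine (norm_add_le _ _).trans (add_le_add (h.reg.vK t x) (by linarith))
  have e : w - v (t + s) (x + s • w) = z + (v t x - v (t + s) x) + (v (t + s) x - v (t + s) (x + s • w)) := by
    rw [hw]; abel
  rw [e]
  have q1 := h.vt t (t + s) (by rw [sub_add_cancel_left, abs_neg, abs_of_nonneg hs.1]; exact s1) x
  have q2 := h.vL (t + s) x (x + s • w)
  rw [sub_add_cancel_left, norm_neg, norm_smul, Real.norm_of_nonneg hs.1] at q2
  have q3 : Lp * (s * ‖w‖) ≤ κ := by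
    refine le_trans ?_ s2
    calc Lp * (s * ‖w‖) ≤ Lp * (s * (K + b)) := by gcongr
      _ = _ := by ring
  refine (norm_add_le _ _).trans ((add_le_add (norm_add_le _ _) le_rfl).trans ?_)
  linarith

lemma Good.fwd (p : Par K Lp L a b κ δ) (h : Good K Lp L a b κ δ c v) (t : ℝ) {T : ℝ} (hT : 0 ≤ T)
    (x : Euc d) : ∃ y, Reachable c v t x (t + T) y := by
  have hs := p.sg0
  obtain ⟨n, hn⟩ := exists_nat_gt (T / sg K Lp b κ δ)
  have hn0 : (0:ℝ) < n := lt_of_le_of_lt (by positivity) hn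
  have key : ∀ k : ℕ, ∃ y, Reachable c v t x (t + k * (T / n)) y := by
    intro k
    induction k with
    | zero => exact ⟨x, by simpa using reach_refl h.reg t x⟩
    | succ k ih =>
      obtain ⟨y, hy⟩ := ih
      have := h.euler p (h0 := T / n) (by positivity) (by
        rw [div_lt_iff₀ hs] at hn
        rw [div_le_iff₀ hn0]; linarith) (t + k * (T / n)) y 0 (by
          rw [norm_zero]; linarith [p.ab, p.a0, p.κ0])
      refine ⟨y + (T / n) • (v (t + k * (T / n)) y + 0), reach_trans h.reg hy ?_⟩
      convert this using 1; push_cast; ring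
  obtain ⟨y, hy⟩ := key n
  refine ⟨y, ?_⟩
  rwa [mul_div_cancel₀ _ hn0.ne'] at hy

lemma Good.dat (p : Par K Lp L a b κ δ) (h : Good K Lp L a b κ δ c v) {lam : ℝ} (hl : 0 < lam) (t : ℝ) :
    Dat (boxN d L) (v t) (wG lam) (wG' lam) K Lp (Real.sqrt (d * L ^ 2)) (wr d * lam)
      (3 * wr d * lam ^ 2) where
  prob := boxN_prob p.L0
  ac := boxN_ac
  hD := boxN_D p.L0
  D0 := Real.sqrt_nonneg _
  L0 := p.Lp0
  g0 := by have := wr_pos d; positivity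
  g'0 := by have := wr_pos d; positivity
  vK := h.reg.vK t
  vL := h.vL t
  tr := h.tr t
  Gd := wG_deriv
  Gs := wG_sym
  Gg := wG_norm hl
  Gg' := wG'_norm hl

lemma mass (d : ℕ) (p : Par K Lp L a b κ δ) : ∃ lam > 0, ∃ T1 > 0, ∀ (c : ℝ → Euc d → ℝ) (v : ℝ → Euc d → Euc d),
    Good K Lp L a b κ δ c v → ∀ t0 x, ‖x‖ ≤ 1 → ∃ E, MeasurableSet E ∧
      (∀ y ∈ E, Reachable c v t0 x (t0 + T1) y) ∧
      (wmu d lam).real Set.univ / 2 < (wmu d lam).real E := by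
  have b0 := p.b0
  have K0 := p.K0
  have Lp0 := p.Lp0
  have κ0 := p.κ0
  have hr := wr_pos d
  have hab := p.ab
  have ha0 := p.a0
  set D := Real.sqrt (d * L ^ 2) with hD
  have D0 : 0 ≤ D := Real.sqrt_nonneg _
  set lam := κ / (2 * K * D * wr d + 1) with hlam
  have hl : 0 < lam := by positivity
  have hq : 2 * K * D * (wr d * lam) ≤ κ := by
    have : 2 * K * D * (wr d * lam) = (2 * K * D * wr d) * κ / (2 * K * D * wr d + 1) := by
      rw [hlam]; ring
    rw [this, div_le_iff₀ (by positivity)]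
    nlinarith
  have := wmu_fin (d := d) hl
  set μ := wmu d lam with hμ
  set M := μ.real Set.univ with hM
  set σ := sg K Lp b κ δ with hσ
  have σ0 : 0 < σ := p.sg0
  set R0 := 1 + σ * K + σ * κ with hR0
  set pp := Real.exp (-(wr d / 2 * Real.log (1 + lam ^ 2 * R0 ^ 2))) with hpp
  have pp0 : 0 < pp := Real.exp_pos _
  set V := volume.real (ball (0 : Euc d) (σ * κ)) with hV
  have V0 : 0 < V := ENNReal.toReal_pos (measure_ball_pos _ _ (by positivity)).ne' measure_ball_lt_top.ne
  have init : ∀ y : Euc d, ‖y‖ ≤ 1 + σ * K → pp * V ≤ μ.real (ball y (σ * κ)) := by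
    intro y hy
    have := ENNReal.toReal_mono (measure_ne_top _ _) (wmu_ge_vol (lam := lam) (measurableSet_ball (x := y) (ε := σ * κ)) (ρ := R0)
      (fun z hz => by
        rw [mem_ball, dist_eq_norm] at hz
        have : z = (z - y) + y := by abel
        rw [this]
        exact (norm_add_le _ _).trans (by linarith)))
    rw [ENNReal.toReal_mul, ENNReal.toReal_ofReal pp0.le, Measure.addHaar_ball_center] at this
    exact this
  have hM0 : 0 < M := by
    have h1 := init 0 (by rw [norm_zero]; positivity)
    have h2 : μ.real (ball (0 : Euc d) (σ * κ)) ≤ M := measureReal_mono (Set.subset_univ _) (measure_ne_top _ _)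
    have : 0 < pp * V := by positivity
    linarith
  set m0 := min (pp * V) (M / 4) with hm0
  have m00 : 0 < m0 := lt_min (by positivity) (by positivity)
  obtain ⟨η, η0, Hiso⟩ := iso d lam hl (m0 / 2) (by positivity)
  set B := 2 * K + κ with hB
  set CW := 2 * Lp + 2 * D * (wr d * lam * Lp + K * (3 * wr d * lam ^ 2)) with hCW
  set ε := η * κ / (2 * M) with hε
  have ε0 : 0 < ε := by positivity
  obtain ⟨h1, h10, Hjac⟩ := jac d lam hl B CW (by positivity) (by positivity) ε ε0
  set h := min (min h1 σ) (min (1 / κ) (1 / (2 * ε))) with hh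
  have h0 : 0 < h := by simp only [hh, lt_min_iff]; exact ⟨⟨h10, σ0⟩, by positivity, by positivity⟩
  have hh1 : h ≤ h1 := (min_le_left _ _).trans (min_le_left _ _)
  have hhσ : h ≤ σ := (min_le_left _ _).trans (min_le_right _ _)
  have hhκ : κ * h ≤ 1 := by
    have : h ≤ 1 / κ := (min_le_right _ _).trans (min_le_left _ _)
    rw [le_div_iff₀ κ0] at this; linarith
  have hhε : ε * h ≤ 1 / 2 := by
    have : h ≤ 1 / (2 * ε) := (min_le_right _ _).trans (min_le_right _ _)
    rw [le_div_iff₀ (by positivity)] at this; linarith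
  set s := η * κ * h / 2 with hs
  have s0 : 0 < s := by positivity
  obtain ⟨n, hn⟩ := exists_nat_gt (M / s)
  rw [div_lt_iff₀ s0] at hn
  refine ⟨lam, hl, σ + n * h, by positivity, ?_⟩
  intro c v hg t0 x hx
  have key : ∀ k : ℕ, ∃ E, MeasurableSet E ∧ (∀ y ∈ E, Reachable c v t0 x (t0 + (σ + k * h)) y) ∧
      min (3 * M / 4) (m0 + k * s) ≤ μ.real E := by
    intro k
    induction k with
    | zero =>
      refine ⟨ball (x + σ • v t0 x) (σ * κ), measurableSet_ball, ?_, ?_⟩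
      · intro y hy
        rw [mem_ball, dist_eq_norm] at hy
        have := hg.euler p σ0.le le_rfl t0 x (σ⁻¹ • (y - (x + σ • v t0 x))) (by
          rw [norm_smul, norm_inv, Real.norm_of_nonneg σ0.le, inv_mul_le_iff₀ σ0]
          refine hy.le.trans ?_
          gcongr; linarith)
        have e : x + σ • (v t0 x + σ⁻¹ • (y - (x + σ • v t0 x))) = y := by
          rw [smul_add, smul_inv_smul₀ σ0.ne']; abel
        rw [e] at this
        simpa using this
      · refine (min_le_right _ _).trans ?_
        simp only [Nat.cast_zero, zero_mul, add_zero]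
        refine (min_le_left _ _).trans (init _ ?_)
        refine (norm_add_le _ _).trans (add_le_add hx ?_)
        rw [norm_smul, Real.norm_of_nonneg σ0.le]
        gcongr
        exact hg.reg.vK _ _
    | succ k ih =>
      obtain ⟨E, hE, hEr, hEm⟩ := ih
      set t := t0 + (σ + k * h) with ht
      have hd := hg.dat p hl t
      set W := WF (boxN d L) (v t) (wG lam) with hW
      have qb : ∀ x, ‖qF (boxN d L) (v t) (wG lam) x‖ ≤ κ := fun x => (hd.q_bd x).trans hq
      have bb : ∀ x, ‖bF (boxN d L) (v t) x‖ ≤ a := fun x => hg.av t x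
      have bK : ∀ x, ‖bF (boxN d L) (v t) x‖ ≤ K := fun x => by
        have := hd.prob
        have := norm_integral_le_of_norm_le_const (μ := boxN d L) (f := fun y => v t (x + y)) (C := K)
          (Eventually.of_forall fun y => hg.reg.vK _ _)
        simpa [bF] using this
      have WB : ∀ x, ‖W x‖ ≤ B := fun x => by
        rw [hW, WF]
        refine (norm_add_le _ _).trans ((add_le_add (norm_sub_le _ _) le_rfl).trans ?_)
        linarith [qb x, bK x, hg.reg.vK t x]
      obtain ⟨fm, fμ⟩ := Hjac W WB hd.W_lip hd.W_diff h h0 hh1 E hE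
      set F := (fun x => x + h • W x) '' E with hF
      have fμ' : (1 - ε * h) * μ.real E ≤ μ.real F := by
        have := ENNReal.toReal_mono (measure_ne_top _ _) fμ
        rwa [ENNReal.toReal_mul, ENNReal.toReal_ofReal (by linarith)] at this
      have hEM : μ.real E ≤ M := measureReal_mono (Set.subset_univ _) (measure_ne_top _ _)
      have hE0 : m0 ≤ μ.real E := by
        refine le_trans (le_min ?_ ?_) hEm
        · linarith [min_le_right (pp * V) (M / 4)]
        · have : 0 ≤ (k:ℝ) * s := by positivity
          linarith
      have hFm0 : m0 / 2 ≤ μ.real F := by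
        refine le_trans ?_ fμ'
        nlinarith
      refine ⟨thickening (κ * h) F, isOpen_thickening.measurableSet, ?_, ?_⟩
      · intro y hy
        rw [mem_thickening_iff] at hy
        obtain ⟨z, ⟨x', hx', rfl⟩, hyz⟩ := hy
        rw [dist_eq_norm] at hyz
        have r1 := hEr x' hx'
        set z' := h⁻¹ • (y - (x' + h • W x')) with hz'
        have hz'n : ‖z'‖ ≤ κ := by
          rw [hz', norm_smul, norm_inv, Real.norm_of_nonneg h0.le, inv_mul_le_iff₀ h0]
          simp only at hyz
          linarith
        have r2 := hg.euler p h0.le hhσ t x' (z' - bF (boxN d L) (v t) x' + qF (boxN d L) (v t) (wG lam) x') (by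
          refine (norm_add_le _ _).trans ((add_le_add (norm_sub_le _ _) le_rfl).trans ?_)
          linarith [qb x', bb x'])
        have e : x' + h • (v t x' + (z' - bF (boxN d L) (v t) x' + qF (boxN d L) (v t) (wG lam) x')) = y := by
          have : v t x' + (z' - bF (boxN d L) (v t) x' + qF (boxN d L) (v t) (wG lam) x') = z' + W x' := by
            rw [hW, WF]; abel
          rw [this, smul_add, hz', smul_inv_smul₀ h0.ne']
          abel
        rw [e] at r2
        have := reach_trans hg.reg r1 r2
        convert this using 1
        rw [ht]; push_cast; ring
      · have hth : μ.real F ≤ μ.real (thickening (κ * h) F) :=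
          measureReal_mono (self_subset_thickening (by positivity) F) (measure_ne_top _ _)
        by_cases hcase : 3 * M / 4 < μ.real F
        · exact (min_le_left _ _).trans (hcase.le.trans hth)
        · push Not at hcase
          have hc2 : m0 / 2 ≤ μ.real Fᶜ := by
            rw [measureReal_compl fm]
            have := min_le_right (pp * V) (M / 4)
            linarith
          have i1 := Hiso (κ * h) (by positivity) hhκ F fm hFm0 hc2
          have i2 : μ.real E - s ≤ μ.real F := by
            refine le_trans ?_ fμ'
            have : ε * h * μ.real E ≤ ε * h * M := by gcongr
            have e : ε * h * M = s := by rw [hε, hs]; field_simp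
            linarith
          have i3 : μ.real E + s ≤ μ.real (thickening (κ * h) F) := by
            have : η * (κ * h) = 2 * s := by rw [hs]; ring
            linarith
          push_cast
          rcases min_le_iff.1 hEm with h5 | h5
          · exact (min_le_left _ _).trans (by linarith)
          · exact (min_le_right _ _).trans (by linarith)
  obtain ⟨E, e1, e2, e3⟩ := key n
  refine ⟨E, e1, e2, lt_of_lt_of_le ?_ e3⟩
  apply lt_min <;> linarith
end

section
variable {d : ℕ} {K Lp L a b κ δ : ℝ} {c : ℝ → Euc d → ℝ} {v : ℝ → Euc d → Euc d}

lemma ctrl1 (d : ℕ) (p : Par K Lp L a b κ δ) : ∃ T1 > 0, ∀ (c : ℝ → Euc d → ℝ) (v : ℝ → Euc d → Euc d),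
    Good K Lp L a b κ δ c v → ∀ t0 x y, ‖x - y‖ ≤ 1 → Reachable c v t0 x (t0 + 2 * T1) y := by
  obtain ⟨lam, hl, T1, hT, H⟩ := mass d p
  refine ⟨T1, hT, ?_⟩
  have main : ∀ (c : ℝ → Euc d → ℝ) (v : ℝ → Euc d → Euc d),
    Good K Lp L a b κ δ c v → ∀ t0 y, ‖y‖ ≤ 1 → Reachable c v t0 0 (t0 + 2 * T1) y := by
    intro c v hg t0 y hy
    obtain ⟨E1, m1, r1, q1⟩ := H c v hg t0 0 (by simp)
    obtain ⟨E2, m2, r2, q2⟩ := H _ _ hg.rev (-(t0 + 2 * T1)) y hy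
    have := wmu_fin (d := d) hl
    have : (E1 ∩ E2).Nonempty := by
      by_contra hne
      rw [Set.not_nonempty_iff_eq_empty] at hne
      have h1 := measureReal_union (μ := wmu d lam) (Set.disjoint_iff_inter_eq_empty.2 hne) m2
      have h2 : (wmu d lam).real (E1 ∪ E2) ≤ (wmu d lam).real Set.univ :=
        measureReal_mono (Set.subset_univ _) (measure_ne_top _ _)
      linarith
    obtain ⟨z, z1, z2⟩ := this
    have a1 := r1 z z1
    have a2 := r2 z z2
    have e : -(t0 + 2 * T1) + T1 = -(t0 + T1) := by ring
    rw [e, reach_rev_iff hg.reg] at a2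
    exact reach_trans hg.reg a1 a2
  intro c v hg t0 x y hxy
  have := main _ _ (hg.shift 0 x) t0 (y - x) (by rwa [norm_sub_rev])
  rw [reach_shift_iff hg.reg] at this
  simpa using this

lemma ctrlN (d : ℕ) (p : Par K Lp L a b κ δ) : ∃ T2 > 0, ∀ (c : ℝ → Euc d → ℝ) (v : ℝ → Euc d → Euc d),
    Good K Lp L a b κ δ c v → ∀ (n : ℕ) t0 x y, 0 < n → ‖x - y‖ ≤ n → Reachable c v t0 x (t0 + n * T2) y := by
  obtain ⟨T1, hT, H⟩ := ctrl1 d p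
  refine ⟨2 * T1, by positivity, ?_⟩
  intro c v hg n t0 x y hn hxy
  have hn' : (0:ℝ) < n := by exact_mod_cast hn
  have key : ∀ k : ℕ, Reachable c v t0 x (t0 + k * (2 * T1)) (x + ((k : ℝ) / n) • (y - x)) := by
    intro k
    induction k with
    | zero => simpa using reach_refl hg.reg t0 x
    | succ k ih =>
      have := H c v hg (t0 + k * (2 * T1)) (x + ((k : ℝ) / n) • (y - x)) (x + (((k + 1 : ℕ) : ℝ) / n) • (y - x)) (by
        rw [add_sub_add_left_eq_sub, ← sub_smul, norm_smul, ← sub_div, norm_sub_rev]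
        push_cast
        rw [sub_add_cancel_left, norm_div, norm_neg, norm_one, Real.norm_of_nonneg hn'.le, one_div,
          inv_mul_le_iff₀ hn', mul_one]
        exact hxy)
      have := reach_trans hg.reg ih this
      convert this using 1
      push_cast; ring
  have := key n
  rw [div_self hn'.ne', one_smul] at this
  simpa using this

lemma ctrl (d : ℕ) (p : Par K Lp L a b κ δ) : ∃ C0 > 0, ∀ (c : ℝ → Euc d → ℝ) (v : ℝ → Euc d → Euc d),
    Good K Lp L a b κ δ c v → ∀ t0 x y T, C0 * (1 + ‖x - y‖) ≤ T → Reachable c v t0 x (t0 + T) y := by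
  obtain ⟨T2, hT, H⟩ := ctrlN d p
  have K0 := p.K0
  refine ⟨T2 * (2 * K * T2 + 2), by positivity, ?_⟩
  intro c v hg t0 x y T hTT
  have T0 : 0 ≤ T := le_trans (by positivity) hTT
  set j := ⌊T / T2⌋₊ with hj
  have j1 : (j : ℝ) * T2 ≤ T := by
    have := Nat.floor_le (div_nonneg T0 hT.le)
    rwa [le_div_iff₀ hT] at this
  have j2 : T < (j + 1) * T2 := by
    have := Nat.lt_floor_add_one (T / T2)
    rwa [div_lt_iff₀ hT] at this
  obtain ⟨x', hx'⟩ := hg.fwd p t0 (T := T - j * T2) (by linarith) x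
  have sp := reach_speed hg.reg hx'
  have sp' : ‖x' - x‖ ≤ 2 * K * T2 := sp.trans (by gcongr; linarith)
  have hj3 : 2 * K * T2 + 1 + ‖x - y‖ ≤ j := by
    have : (2 * K * T2 + 2) * (1 + ‖x - y‖) < j + 1 := by
      refine lt_of_mul_lt_mul_right ?_ hT.le
      linarith
    have : 0 ≤ (2 * K * T2 + 1) * ‖x - y‖ := by positivity
    linarith
  have hj0 : 0 < j := by
    have : (0:ℝ) < j := lt_of_lt_of_le (by positivity) hj3
    exact_mod_cast this
  have := H c v hg j (t0 + (T - j * T2)) x' y hj0 (by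
    have : x' - y = (x' - x) + (x - y) := by abel
    rw [this]
    refine (norm_add_le _ _).trans (by linarith))
  have := reach_trans hg.reg hx' this
  convert this using 1
  ring

lemma Good.bwd (p : Par K Lp L a b κ δ) (h : Good K Lp L a b κ δ c v) (t : ℝ) {T : ℝ} (hT : 0 ≤ T)
    (y : Euc d) : ∃ x, Reachable c v t x (t + T) y := by
  obtain ⟨x, hx⟩ := h.rev.fwd p (-(t + T)) hT y
  refine ⟨x, (reach_rev_iff h.reg).1 ?_⟩
  convert hx using 1; ring
end

section
open scoped BoundedContinuousFunction

lemma meas_exists {X Ω : Type*} [MetricSpace X] [CompactSpace X] [MeasurableSpace Ω]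
    (f : ℕ → X → Ω → ℝ) (hc : ∀ n ω, Continuous fun x => f n x ω) (hm : ∀ n x, Measurable (f n x)) :
    MeasurableSet {ω | ∃ x, ∀ n, f n x ω ≤ 0} := by
  obtain ⟨D, hD, hDd⟩ := TopologicalSpace.exists_countable_dense X
  have e : {ω | ∃ x, ∀ n, f n x ω ≤ 0} =
      ⋂ n : ℕ, ⋃ x ∈ D, ⋂ k ∈ Finset.range (n + 1), {ω | f k x ω < 1 / ((n : ℝ) + 1)} := by
    ext ω
    simp only [Set.mem_setOf_eq, Set.mem_iInter, Set.mem_iUnion, Finset.mem_range]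
    constructor
    · rintro ⟨x, hx⟩ n
      have ho : IsOpen (⋂ k ∈ Finset.range (n + 1), {x | f k x ω < 1 / ((n : ℝ) + 1)}) :=
        isOpen_biInter_finset fun k _ => isOpen_lt (hc k ω) continuous_const
      obtain ⟨y, hyD, hy⟩ := hDd.exists_mem_open ho ⟨x, by
        simp only [Set.mem_iInter]
        intro k _
        exact lt_of_le_of_lt (hx k) (by positivity)⟩
      exact ⟨y, hyD, fun k hk => by
        simp only [Set.mem_iInter, Finset.mem_range] at hy
        exact hy k hk⟩
    · intro h
      choose y hy hy' using h
      obtain ⟨x, φ, hφ, hx⟩ := CompactSpace.tendsto_subseq y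
      refine ⟨x, fun k => ?_⟩
      have h1 : Tendsto (fun n => f k (y (φ n)) ω) atTop (nhds (f k x ω)) :=
        ((hc k ω).tendsto x).comp hx
      have h2 : Tendsto (fun n : ℕ => 1 / ((φ n : ℝ) + 1)) atTop (nhds 0) :=
        tendsto_one_div_add_atTop_nhds_zero_nat.comp hφ.tendsto_atTop
      refine le_of_tendsto_of_tendsto h1 h2 ?_
      filter_upwards [eventually_ge_atTop k] with n hn
      exact (hy' (φ n) k (by have := hφ.le_apply (x := n); omega)).le
  rw [e]
  refine MeasurableSet.iInter fun n => MeasurableSet.biUnion hD fun x _ => ?_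
  refine Finset.measurableSet_biInter _ fun k _ => ?_
  exact measurableSet_lt (hm k x) measurable_const

variable {d : ℕ}

def PathX {t0 t1 : ℝ} (h01 : t0 ≤ t1) (C : ℝ) (x0 : Euc d) : Set (Set.Icc t0 t1 →ᵇ Euc d) :=
  {γ : Set.Icc t0 t1 →ᵇ Euc d | (∀ s t, dist (γ s) (γ t) ≤ C * dist s t) ∧
      γ ⟨t0, le_rfl, h01⟩ = x0}

lemma path_compact {t0 t1 : ℝ} (h01 : t0 ≤ t1) (C : ℝ) (hC : 0 ≤ C) (x0 : Euc d) :
    IsCompact (PathX h01 C x0) := by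
  refine BoundedContinuousFunction.arzela_ascoli₂ (closedBall x0 (C * (t1 - t0)))
    (isCompact_closedBall _ _) _ ?_ ?_ ?_
  · refine IsClosed.inter ?_ ?_
    · have : {γ : Set.Icc t0 t1 →ᵇ Euc d | ∀ s t, dist (γ s) (γ t) ≤ C * dist s t} =
        ⋂ s, ⋂ t, {γ | dist (γ s) (γ t) ≤ C * dist s t} := by
        ext; simp only [Set.mem_iInter, Set.mem_setOf_eq]
      show IsClosed {γ : Set.Icc t0 t1 →ᵇ Euc d | ∀ s t, dist (γ s) (γ t) ≤ C * dist s t}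
      rw [this]
      refine isClosed_iInter fun s => isClosed_iInter fun t => isClosed_le ?_ continuous_const
      exact (continuous_eval_const s).dist (continuous_eval_const t)
    · exact isClosed_eq (continuous_eval_const _) continuous_const
  · rintro γ s ⟨h1, h2⟩
    rw [mem_closedBall, ← h2]
    refine (h1 _ _).trans ?_
    gcongr
    rw [Subtype.dist_eq, Real.dist_eq, abs_of_nonneg] <;> simp only <;> linarith [s.2.1, s.2.2]
  · intro s
    rw [Metric.equicontinuousAt_iff]
    intro ε hε
    refine ⟨ε / (C + 1), by positivity, fun t ht γ => ?_⟩
    refine lt_of_le_of_lt (γ.2.1 s t) ?_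
    rw [dist_comm] at ht
    rw [lt_div_iff₀ (by positivity)] at ht
    have : 0 ≤ dist s t := dist_nonneg
    nlinarith

lemma int_meas {Ω E : Type*} [MeasurableSpace Ω] [NormedAddCommGroup E] [NormedSpace ℝ E]
    [MeasurableSpace E] [BorelSpace E] [SecondCountableTopology E] (f : ℝ → Ω → E)
    (hc : ∀ ω, Continuous fun u => f u ω) (hm : ∀ u, Measurable (f u)) (s t : ℝ) :
    Measurable fun ω => ∫ u in s..t, f u ω := by
  have h1 : Measurable (Function.uncurry f) := measurable_uncurry_of_continuous_of_measurable hc hm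
  have h2 : StronglyMeasurable (Function.uncurry fun ω u => f u ω) :=
    (h1.comp measurable_swap).stronglyMeasurable
  simp only [intervalIntegral]
  exact (h2.integral_prod_right (ν := volume.restrict _)).measurable.sub
    (h2.integral_prod_right (ν := volume.restrict _)).measurable

lemma path_int {t0 t1 : ℝ} (h01 : t0 ≤ t1) {E : Type} [NormedAddCommGroup E] [NormedSpace ℝ E] (w : ℝ → Euc d → E)
    (hw : Continuous (fun p : ℝ × Euc d => w p.1 p.2)) :
    Continuous fun z : (Set.Icc t0 t1 →ᵇ Euc d) × (Set.Icc t0 t1 × Set.Icc t0 t1) =>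
      ∫ u in (z.2.1 : ℝ)..z.2.2, w (Set.projIcc t0 t1 h01 u) (z.1 (Set.projIcc t0 t1 h01 u)) := by
  have hpr : Continuous (Set.projIcc t0 t1 h01) := continuous_projIcc
  have hev : Continuous fun z : ((Set.Icc t0 t1 →ᵇ Euc d) × (Set.Icc t0 t1 × Set.Icc t0 t1)) × ℝ =>
      z.1.1 (Set.projIcc t0 t1 h01 z.2) :=
    (continuous_fst.comp continuous_fst).eval (hpr.comp continuous_snd)
  have hj : Continuous (Function.uncurry fun (z : (Set.Icc t0 t1 →ᵇ Euc d) × (Set.Icc t0 t1 × Set.Icc t0 t1)) (u : ℝ) =>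
      w (Set.projIcc t0 t1 h01 u) (z.1 (Set.projIcc t0 t1 h01 u))) := by
    exact hw.comp (((continuous_subtype_val.comp hpr).comp continuous_snd).prodMk hev)
  have h1 := intervalIntegral.continuous_parametric_intervalIntegral_of_continuous (μ := volume) (a₀ := 0) hj
    (s := fun z => (z.2.1 : ℝ)) (by fun_prop)
  have h2 := intervalIntegral.continuous_parametric_intervalIntegral_of_continuous (μ := volume) (a₀ := 0) hj
    (s := fun z => (z.2.2 : ℝ)) (by fun_prop)
  refine (h2.sub h1).congr fun z => ?_
  have hz : Continuous fun u => w (Set.projIcc t0 t1 h01 u) (z.1 (Set.projIcc t0 t1 h01 u)) :=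
    hj.comp (continuous_const.prodMk continuous_id)
  exact intervalIntegral.integral_interval_sub_left (hz.intervalIntegrable _ _) (hz.intervalIntegrable _ _)

def pf {t0 t1 : ℝ} (h01 : t0 ≤ t1) (c : ℝ → Euc d → ℝ) (v : ℝ → Euc d → Euc d)
    (γ : Set.Icc t0 t1 →ᵇ Euc d) (p : Set.Icc t0 t1 × Set.Icc t0 t1) : ℝ :=
  ‖γ p.2 - γ p.1 - ∫ u in (p.1 : ℝ)..p.2, v (Set.projIcc t0 t1 h01 u) (γ (Set.projIcc t0 t1 h01 u))‖ -
      |∫ u in (p.1 : ℝ)..p.2, c (Set.projIcc t0 t1 h01 u) (γ (Set.projIcc t0 t1 h01 u))|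

lemma path_fc {t0 t1 : ℝ} (h01 : t0 ≤ t1) (c : ℝ → Euc d → ℝ) (v : ℝ → Euc d → Euc d)
    (hc : Continuous (fun p : ℝ × Euc d => c p.1 p.2)) (hv : Continuous (fun p : ℝ × Euc d => v p.1 p.2)) :
    Continuous fun z : (Set.Icc t0 t1 →ᵇ Euc d) × (Set.Icc t0 t1 × Set.Icc t0 t1) =>
      pf h01 c v z.1 z.2 := by
  have e1 : Continuous fun z : (Set.Icc t0 t1 →ᵇ Euc d) × (Set.Icc t0 t1 × Set.Icc t0 t1) => z.1 z.2.1 :=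
    continuous_fst.eval (by fun_prop)
  have e2 : Continuous fun z : (Set.Icc t0 t1 →ᵇ Euc d) × (Set.Icc t0 t1 × Set.Icc t0 t1) => z.1 z.2.2 :=
    continuous_fst.eval (by fun_prop)
  exact ((e2.sub e1).sub (path_int h01 _ hv)).norm.sub (path_int h01 _ hc).abs

lemma pf_meas {Ω : Type*} [MeasurableSpace Ω] {K : ℝ} (c : ℝ → Euc d → Ω → ℝ)
    (v : ℝ → Euc d → Ω → Euc d) (hR : ∀ ω, Reg K (fun t x => c t x ω) (fun t x => v t x ω))
    {t0 t1 : ℝ} (h01 : t0 ≤ t1)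
    (hcm : ∀ s, t0 ≤ s → s ≤ t1 → ∀ x, Measurable (c s x))
    (hvm : ∀ s, t0 ≤ s → s ≤ t1 → ∀ x, Measurable (v s x)) (γ : Set.Icc t0 t1 →ᵇ Euc d)
    (p : Set.Icc t0 t1 × Set.Icc t0 t1) :
    Measurable fun ω => pf h01 (fun t x => c t x ω) (fun t x => v t x ω) γ p := by
  have hpr : Continuous (Set.projIcc t0 t1 h01) := continuous_projIcc
  have hγ : Continuous fun u => γ (Set.projIcc t0 t1 h01 u) := γ.continuous.comp hpr
  have hu : Continuous fun u => ((Set.projIcc t0 t1 h01 u : ℝ)) := continuous_subtype_val.comp hpr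
  have m1 := int_meas (fun u ω => v (Set.projIcc t0 t1 h01 u) (γ (Set.projIcc t0 t1 h01 u)) ω)
    (fun ω => (hR ω).hv.comp (hu.prodMk hγ)) (fun u => hvm _ (Set.projIcc t0 t1 h01 u).2.1 (Set.projIcc t0 t1 h01 u).2.2 _) p.1 p.2
  have m2 := int_meas (fun u ω => c (Set.projIcc t0 t1 h01 u) (γ (Set.projIcc t0 t1 h01 u)) ω)
    (fun ω => (hR ω).hc.comp (hu.prodMk hγ)) (fun u => hcm _ (Set.projIcc t0 t1 h01 u).2.1 (Set.projIcc t0 t1 h01 u).2.2 _) p.1 p.2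
  exact (m1.const_sub _).norm.sub (measurable_norm.comp m2)

lemma pf_proj {t0 t1 : ℝ} (h01 : t0 ≤ t1) {E : Type*} [NormedAddCommGroup E] [NormedSpace ℝ E]
    (w : ℝ → ℝ → E) {s t : ℝ} (hs : t0 ≤ s) (hst : s ≤ t) (ht : t ≤ t1) :
    ∫ u in s..t, w (Set.projIcc t0 t1 h01 u) (Set.projIcc t0 t1 h01 u) = ∫ u in s..t, w u u := by
  refine intervalIntegral.integral_congr fun u hu => ?_
  rw [Set.uIcc_of_le hst] at hu
  have : (Set.projIcc t0 t1 h01 u : ℝ) = u :=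
    congrArg Subtype.val (Set.projIcc_of_mem h01 ⟨hs.trans hu.1, hu.2.trans ht⟩)
  simp only [this]

lemma pf_iff {K : ℝ} (c : ℝ → Euc d → ℝ) (v : ℝ → Euc d → Euc d) (hR : Reg K c v)
    {t0 t1 : ℝ} (h01 : t0 ≤ t1) (x0 x1 : Euc d) :
    (∃ r ∈ Set.Icc t0 t1, Reachable c v t0 x0 r x1) ↔
      ∃ z : PathX h01 (2 * K) x0 × Set.Icc t0 t1, ‖z.1.1 z.2 - x1‖ ≤ 0 ∧
        ∀ p : Set.Icc t0 t1 × Set.Icc t0 t1, pf h01 c v z.1.1 (min p.1 z.2, min p.2 z.2) ≤ 0 := by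
  have K0 := hR.K0
  constructor
  · rintro ⟨r, hr0, hr⟩
    obtain ⟨γ, a1, b1, c1⟩ := reach_adm hR hr
    have hl : ∀ s t : Set.Icc t0 t1, dist (γ (min s r)) (γ (min t r)) ≤ 2 * K * dist s t := by
      have : ∀ s t : Set.Icc t0 t1, (s : ℝ) ≤ t → ‖γ (min t r) - γ (min s r)‖ ≤ 2 * K * (t - s) := by
        intro s t hst
        refine (a1.lip hR (le_min s.2.1 hr0.1) (min_le_min_right _ hst) (min_le_right _ _)).trans ?_
        refine mul_le_mul_of_nonneg_left ?_ (by positivity)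
        rcases le_total (t:ℝ) r with h | h
        · rw [min_eq_left h, min_eq_left (hst.trans h)]
        · rw [min_eq_right h]
          rcases le_total (s:ℝ) r with h' | h'
          · rw [min_eq_left h']; linarith
          · rw [min_eq_right h']; linarith
      intro s t
      rw [dist_eq_norm, Subtype.dist_eq, Real.dist_eq]
      rcases le_total (s : ℝ) t with h | h
      · rw [norm_sub_rev, abs_sub_comm, abs_of_nonneg (by linarith)]
        exact this s t h
      · rw [abs_of_nonneg (by linarith)]
        exact this t s h
    let g : Set.Icc t0 t1 →ᵇ Euc d := BoundedContinuousFunction.mkOfCompact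
      ⟨fun s => γ (min s r), a1.1.comp (continuous_subtype_val.min continuous_const)⟩
    refine ⟨(⟨g, hl, ?_⟩, ⟨r, hr0⟩), ?_, fun p => ?_⟩
    · show γ (min t0 r) = x0
      rw [min_eq_left hr0.1, b1]
    · show ‖γ (min r r) - x1‖ ≤ 0
      rw [min_self, c1]; simp
    have main : ∀ s t : Set.Icc t0 t1, (s:ℝ) ≤ t → (t:ℝ) ≤ r →
        ‖g t - g s - ∫ u in (s : ℝ)..t, v (Set.projIcc t0 t1 h01 u) (g (Set.projIcc t0 t1 h01 u))‖ ≤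
        ∫ u in (s : ℝ)..t, c (Set.projIcc t0 t1 h01 u) (g (Set.projIcc t0 t1 h01 u)) := by
      intro s t hst htr
      have i1 : ∫ u in (s:ℝ)..t, v (Set.projIcc t0 t1 h01 u) (g (Set.projIcc t0 t1 h01 u)) =
          ∫ u in (s:ℝ)..t, v u (γ u) := by
        refine (pf_proj h01 (fun a b => v a (γ (min b r))) s.2.1 hst t.2.2).trans ?_
        refine intervalIntegral.integral_congr fun u hu => ?_
        rw [Set.uIcc_of_le hst] at hu
        simp only [min_eq_left (hu.2.trans htr)]
      have i2 : ∫ u in (s:ℝ)..t, c (Set.projIcc t0 t1 h01 u) (g (Set.projIcc t0 t1 h01 u)) =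
          ∫ u in (s:ℝ)..t, c u (γ u) := by
        refine (pf_proj h01 (fun a b => c a (γ (min b r))) s.2.1 hst t.2.2).trans ?_
        refine intervalIntegral.integral_congr fun u hu => ?_
        rw [Set.uIcc_of_le hst] at hu
        simp only [min_eq_left (hu.2.trans htr)]
      rw [i1, i2]
      show ‖γ (min t r) - γ (min s r) - _‖ ≤ _
      rw [min_eq_left htr, min_eq_left (hst.trans htr)]
      exact a1.2 _ _ s.2.1 hst htr
    set r' : Set.Icc t0 t1 := ⟨r, hr0⟩ with hr'
    have hle : ∀ q : Set.Icc t0 t1, ((min q r' : Set.Icc t0 t1) : ℝ) ≤ r := fun q => (min_le_right q r')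
    have fin : ∀ p1 p2 : Set.Icc t0 t1, (p1 : ℝ) ≤ r → (p2 : ℝ) ≤ r → pf h01 c v g (p1, p2) ≤ 0 := by
      intro p1 p2 h1 h2
      simp only [pf]
      rw [sub_nonpos]
      rcases le_total (p1 : ℝ) p2 with h | h
      · exact (main _ _ h h2).trans (le_abs_self _)
      · have := main _ _ h h1
        rw [intervalIntegral.integral_symm (↑p2) , intervalIntegral.integral_symm (↑p2), abs_neg]
        refine le_trans ?_ (this.trans (le_abs_self _))
        rw [← norm_neg]
        apply le_of_eq
        congr 1
        abel
    exact fin _ _ (hle _) (hle _)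
  · rintro ⟨⟨γ, r⟩, hx1, hall⟩
    have hcont : Continuous fun u => γ.1 (Set.projIcc t0 t1 h01 u) := γ.1.continuous.comp continuous_projIcc
    have hx1' : γ.1 r = x1 := sub_eq_zero.1 (norm_le_zero_iff.1 hx1)
    refine ⟨r, r.2, ?_⟩
    have := adm_reach hR (t0 := t0) (t1 := r) r.2.1 (γ := fun u => γ.1 (Set.projIcc t0 t1 h01 u)) ⟨hcont, ?_⟩
    · have e0 : Set.projIcc t0 t1 h01 t0 = ⟨t0, le_rfl, h01⟩ := Set.projIcc_left h01
      rw [e0, Set.projIcc_val, γ.2.2, hx1'] at this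
      exact this
    · intro s t p1 p2 p3
      have hs : s ∈ Set.Icc t0 t1 := ⟨p1, p2.trans (p3.trans r.2.2)⟩
      have ht : t ∈ Set.Icc t0 t1 := ⟨p1.trans p2, p3.trans r.2.2⟩
      have := hall (⟨s, hs⟩, ⟨t, ht⟩)
      have m1 : min (⟨s, hs⟩ : Set.Icc t0 t1) r = ⟨s, hs⟩ := min_eq_left (p2.trans p3)
      have m2 : min (⟨t, ht⟩ : Set.Icc t0 t1) r = ⟨t, ht⟩ := min_eq_left p3
      simp only [m1, m2] at this
      simp only [pf, sub_nonpos] at this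
      have i1 : ∫ u in s..t, v (Set.projIcc t0 t1 h01 u) (γ.1 (Set.projIcc t0 t1 h01 u)) =
          ∫ u in s..t, v u (γ.1 (Set.projIcc t0 t1 h01 u)) := by
        have := pf_proj h01 (fun a b => v a (γ.1 (Set.projIcc t0 t1 h01 b))) p1 p2 ht.2
        simpa only [Set.projIcc_val] using this
      have i2 : ∫ u in s..t, c (Set.projIcc t0 t1 h01 u) (γ.1 (Set.projIcc t0 t1 h01 u)) =
          ∫ u in s..t, c u (γ.1 (Set.projIcc t0 t1 h01 u)) := by
        have := pf_proj h01 (fun a b => c a (γ.1 (Set.projIcc t0 t1 h01 b))) p1 p2 ht.2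
        simpa only [Set.projIcc_val] using this
      rw [i1, i2, abs_of_nonneg (intervalIntegral.integral_nonneg p2 fun u _ => hR.c0 _ _)] at this
      have es : Set.projIcc t0 t1 h01 s = ⟨s, hs⟩ := Set.projIcc_of_mem h01 hs
      have et : Set.projIcc t0 t1 h01 t = ⟨t, ht⟩ := Set.projIcc_of_mem h01 ht
      simp only [es, et]
      exact this

lemma path_fc1 {t0 t1 : ℝ} (h01 : t0 ≤ t1) (c : ℝ → Euc d → ℝ) (v : ℝ → Euc d → Euc d)
    (hc : Continuous (fun p : ℝ × Euc d => c p.1 p.2)) (hv : Continuous (fun p : ℝ × Euc d => v p.1 p.2))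
    {X : Type*} [TopologicalSpace X] {g : X → (Set.Icc t0 t1 →ᵇ Euc d)}
    (hg : Continuous g) {p : X → Set.Icc t0 t1 × Set.Icc t0 t1} (hp : Continuous p) :
    Continuous fun x => pf h01 c v (g x) (p x) :=
by
  have h1 := path_fc h01 c v hc hv
  have h2 : Continuous fun x => (g x, p x) := hg.prodMk hp
  have h3 := h1.comp h2
  simpa only [Function.comp_def] using h3

lemma reach_meas {Ω : Type*} [MeasurableSpace Ω] {K : ℝ} (c : ℝ → Euc d → Ω → ℝ)
    (v : ℝ → Euc d → Ω → Euc d) (hR : ∀ ω, Reg K (fun t x => c t x ω) (fun t x => v t x ω))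
    {t0 t1 : ℝ} (h01 : t0 ≤ t1)
    (hcm : ∀ s, t0 ≤ s → s ≤ t1 → ∀ x, Measurable (c s x))
    (hvm : ∀ s, t0 ≤ s → s ≤ t1 → ∀ x, Measurable (v s x)) (x0 x1 : Euc d) :
    MeasurableSet {ω | ∃ r ∈ Set.Icc t0 t1, Reachable (fun t x => c t x ω) (fun t x => v t x ω) t0 x0 r x1} := by
  rcases isEmpty_or_nonempty Ω with hΩ | ⟨⟨ω0⟩⟩
  · rw [Set.eq_empty_of_isEmpty {ω | _}]; exact MeasurableSet.empty
  have K0 := (hR ω0).K0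
  have : CompactSpace (PathX h01 (2 * K) x0) :=
    isCompact_iff_compactSpace.1 (path_compact h01 _ (by positivity) x0)
  have : Nonempty (Set.Icc t0 t1 × Set.Icc t0 t1) := ⟨⟨⟨t0, le_rfl, h01⟩, ⟨t0, le_rfl, h01⟩⟩⟩
  obtain ⟨q, hq⟩ := TopologicalSpace.exists_dense_seq (Set.Icc t0 t1 × Set.Icc t0 t1)
  let f : ℕ → (PathX h01 (2 * K) x0 × Set.Icc t0 t1) → Ω → ℝ := fun n z ω =>
    match n with
    | 0 => ‖z.1.1 z.2 - x1‖
    | n + 1 => pf h01 (fun t x => c t x ω) (fun t x => v t x ω) z.1.1 (min (q n).1 z.2, min (q n).2 z.2)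
  have h1 : ∀ (n : ℕ) ω, Continuous (fun z => f n z ω) := by
    intro n ω
    cases n with
    | zero =>
      have : Continuous fun z : PathX h01 (2 * K) x0 × Set.Icc t0 t1 => z.1.1 z.2 :=
        (continuous_subtype_val.comp continuous_fst).eval continuous_snd
      exact (this.sub continuous_const).norm
    | succ n =>
      exact path_fc1 h01 _ _ (hR ω).hc (hR ω).hv (continuous_subtype_val.comp continuous_fst)
        (p := fun z => (min (q n).1 z.2, min (q n).2 z.2))
        ((continuous_const.min continuous_snd).prodMk (continuous_const.min continuous_snd))
  have h2 : ∀ n z, Measurable (f n z) := by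
    intro n z
    cases n with
    | zero => exact measurable_const
    | succ n => exact pf_meas c v hR h01 hcm hvm z.1.1 _
  have key := meas_exists f h1 h2
  convert key using 1
  ext ω
  simp only [Set.mem_setOf_eq]
  rw [pf_iff _ _ (hR ω) h01]
  refine exists_congr fun z => ⟨fun h n => ?_, fun h => ⟨h 0, fun p => ?_⟩⟩
  · cases n with
    | zero => exact h.1
    | succ n => exact h.2 _
  have hcl : IsClosed {p : Set.Icc t0 t1 × Set.Icc t0 t1 |
      pf h01 (fun t x => c t x ω) (fun t x => v t x ω) z.1.1 (min p.1 z.2, min p.2 z.2) ≤ 0} :=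
    isClosed_le (path_fc1 h01 _ _ (hR ω).hc (hR ω).hv continuous_const
      ((continuous_fst.min continuous_const).prodMk (continuous_snd.min continuous_const))) continuous_const
  exact hq.induction_on (p := fun p => pf h01 (fun t x => c t x ω) (fun t x => v t x ω) z.1.1
    (min p.1 z.2, min p.2 z.2) ≤ 0) p hcl fun n => h (n + 1)
end

section
variable {d : ℕ}

structure Ctl (K C0 : ℝ) (c : ℝ → Euc d → ℝ) (v : ℝ → Euc d → Euc d) : Prop where
  reg : Reg K c v
  C1 : 1 ≤ C0
  ctl : ∀ t0 x y T, C0 * (1 + ‖x - y‖) ≤ T → Reachable c v t0 x (t0 + T) y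
  bwd : ∀ t T y, 0 ≤ T → ∃ x, Reachable c v t x (t + T) y

section
variable {K C0 : ℝ} {c : ℝ → Euc d → ℝ} {v : ℝ → Euc d → Euc d} (h : Ctl K C0 c v)
include h

lemma Ctl.nonempty (t : ℝ) (x y : Euc d) : {r | 0 ≤ r ∧ y ∈ reachSet c v r t x}.Nonempty := by
  have := h.C1
  exact ⟨C0 * (1 + ‖x - y‖), by positivity, h.ctl _ _ _ _ le_rfl⟩

lemma Ctl.nonneg (t : ℝ) (x y : Euc d) : 0 ≤ travelTime c v t x y :=
  le_csInf (h.nonempty t x y) fun r hr => hr.1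

lemma Ctl.lt {t : ℝ} {x y : Euc d} {s : ℝ} (hs : travelTime c v t x y < s) :
    ∃ r, 0 ≤ r ∧ r < s ∧ Reachable c v t x (t + r) y := by
  obtain ⟨r, hr, hr'⟩ := exists_lt_of_csInf_lt (h.nonempty t x y) hs
  exact ⟨r, hr.1, hr', hr.2⟩

lemma Ctl.le {t : ℝ} {x y : Euc d} {r : ℝ} (hr : 0 ≤ r) (hh : Reachable c v t x (t + r) y) :
    travelTime c v t x y ≤ r :=
  csInf_le ⟨0, fun _ h => h.1⟩ ⟨hr, hh⟩

lemma Ctl.ub (t : ℝ) (x y : Euc d) : travelTime c v t x y ≤ C0 * (1 + ‖x - y‖) := by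
  have := h.C1
  exact h.le (by positivity) (h.ctl _ _ _ _ le_rfl)

lemma Ctl.lb (t : ℝ) (x y : Euc d) : ‖y - x‖ ≤ 2 * K * travelTime c v t x y := by
  have K0 := h.reg.K0
  refine le_of_forall_pos_le_add fun ε hε => ?_
  obtain ⟨r, h0, h1, h2⟩ := h.lt (lt_add_of_pos_right (travelTime c v t x y) (show 0 < ε / (2 * K + 1) by positivity))
  have := reach_speed h.reg h2
  have h3 : 2 * K * (t + r - t) ≤ 2 * K * (travelTime c v t x y + ε / (2 * K + 1)) := by
    gcongr; linarith
  have h4 : 2 * K * (ε / (2 * K + 1)) ≤ ε := by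
    rw [← mul_div_assoc, div_le_iff₀ (by positivity)]; nlinarith
  linarith

lemma Ctl.after {t : ℝ} {x y y' : Euc d} {s T : ℝ} (hs : travelTime c v t x y < s)
    (hT : s + C0 * (1 + ‖y - y'‖) ≤ T) : Reachable c v t x (t + T) y' := by
  obtain ⟨r, h0, h1, h2⟩ := h.lt hs
  have := h.ctl (t + r) y y' (T - r) (by linarith)
  have := reach_trans h.reg h2 this
  convert this using 1
  ring

lemma Ctl.le_of_reach {t s : ℝ} {x y z : Euc d} (hr : Reachable c v t x s y) :
    travelTime c v t x z ≤ (s - t) + travelTime c v s y z := by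
  refine le_of_forall_pos_le_add fun ε hε => ?_
  obtain ⟨r, h0, h1, h2⟩ := h.lt (lt_add_of_pos_right (travelTime c v s y z) hε)
  have := reach_trans h.reg hr h2
  have := h.le (t := t) (x := x) (y := z) (r := (s - t) + r) (by linarith [hr.1]) (by
    convert this using 1; ring)
  linarith

lemma Ctl.ext (t : ℝ) (x y y' : Euc d) :
    travelTime c v t x y' ≤ travelTime c v t x y + C0 * (1 + ‖y - y'‖) := by
  have := h.C1
  refine le_of_forall_pos_le_add fun ε hε => ?_
  have := h.after (lt_add_of_pos_right (travelTime c v t x y) hε) (y' := y') le_rfl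
  have n := h.nonneg t x y
  have := h.le (by positivity) this
  linarith

lemma Ctl.mono {t s : ℝ} {x x' : Euc d} (y y' : Euc d) (hst : C0 * (1 + ‖x - x'‖) ≤ s - t) :
    travelTime c v t x y' ≤ (s - t) + travelTime c v s x' y + C0 * (1 + ‖y - y'‖) := by
  have h1 := h.ctl t x x' (s - t) hst
  rw [add_sub_cancel] at h1
  have h2 := h.le_of_reach h1 (z := y)
  have h3 := h.ext t x y y'
  linarith
end

variable {Ω : Type*}

def tau (c : ℝ → Euc d → Ω → ℝ) (v : ℝ → Euc d → Ω → Euc d) (t : ℝ) (x y : Euc d) (ω : Ω) : ℝ :=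
  travelTime (fun a b => c a b ω) (fun a b => v a b ω) t x y

lemma tau_meas_lt [m : MeasurableSpace Ω] {K C0 : ℝ} {c : ℝ → Euc d → Ω → ℝ}
    {v : ℝ → Euc d → Ω → Euc d} (hC : ∀ ω, Ctl K C0 (fun a b => c a b ω) (fun a b => v a b ω)) (t s : ℝ) (x y : Euc d)
    (hm : ∀ r, t ≤ r → r < t + s → ∀ z, Measurable[m] fun ω => (c r z ω, v r z ω)) :
    MeasurableSet[m] {ω | tau c v t x y ω < s} := by
  have e : {ω | tau c v t x y ω < s} = ⋃ q : {q : ℚ // (0:ℝ) ≤ q ∧ (q:ℝ) < s},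
      {ω | ∃ r ∈ Set.Icc t (t + (q.1 : ℝ)), Reachable (fun a b => c a b ω) (fun a b => v a b ω) t x r y} := by
    ext ω
    simp only [Set.mem_setOf_eq, Set.mem_iUnion]
    constructor
    · intro hs
      obtain ⟨r, h0, h1, h2⟩ := (hC ω).lt hs
      obtain ⟨q, q1, q2⟩ := exists_rat_btwn h1
      exact ⟨⟨q, by linarith, q2⟩, t + r, ⟨by linarith, by simp only; linarith⟩, h2⟩
    · rintro ⟨⟨q, q1, q2⟩, r, hr, h2⟩
      refine lt_of_le_of_lt ((hC ω).le (r := r - t) (by linarith [hr.1]) (by simpa using h2)) ?_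
      have := hr.2
      simp only at this
      linarith
  rw [e]
  refine MeasurableSet.iUnion fun q => ?_
  have q1 := q.2.1
  have q2 := q.2.2
  exact @reach_meas d Ω m K c v (fun ω => (hC ω).reg) t (t + (q.1 : ℝ)) (by linarith)
    (fun r h1 h2 z => measurable_fst.comp (hm r h1 (by linarith) z))
    (fun r h1 h2 z => measurable_snd.comp (hm r h1 (by linarith) z)) x y

structure Env [MeasurableSpace Ω] (P : Measure Ω) (K C0 : ℝ) (c : ℝ → Euc d → Ω → ℝ)
    (v : ℝ → Euc d → Ω → Euc d) : Prop where
  C : ∀ ω, Ctl K C0 (fun a b => c a b ω) (fun a b => v a b ω)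
  st : ∃ Υ : ℝ × Euc d → Ω → Ω, (∀ p, MeasurePreserving (Υ p) P P) ∧
    ∀ t s : ℝ, ∀ x y : Euc d, ∀ ω,
      c t x (Υ (s, y) ω) = c (t + s) (x + y) ω ∧ v t x (Υ (s, y) ω) = v (t + s) (x + y) ω
  tm : ∀ t x y, Measurable (tau c v t x y)

section
variable [MeasurableSpace Ω] {P : Measure Ω} {K C0 : ℝ} {c : ℝ → Euc d → Ω → ℝ}
    {v : ℝ → Euc d → Ω → Euc d} (h : Env P K C0 c v)
include h

lemma Env.law (t : ℝ) (x y : Euc d) : ∃ θ : Ω → Ω, MeasurePreserving θ P P ∧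
    ∀ ω, tau c v t x y ω = tau c v 0 0 (y - x) (θ ω) := by
  obtain ⟨Υ, h1, h2⟩ := h.st
  refine ⟨Υ (t, x), h1 _, fun ω => ?_⟩
  have e1 : (fun a b => c a b (Υ (t, x) ω)) = fun a b => c (a + t) (b + x) ω := by
    funext a b; exact (h2 a t b x ω).1
  have e2 : (fun a b => v a b (Υ (t, x) ω)) = fun a b => v (a + t) (b + x) ω := by
    funext a b; exact (h2 a t b x ω).2
  simp only [tau, e1, e2, travelTime, reachSet, Set.mem_setOf_eq]
  congr 1
  ext r
  have e := reach_shift_iff (h.C ω).reg t x (t0 := 0) (x0 := 0) (t1 := 0 + r) (x1 := y - x)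
  simp only [Set.mem_setOf_eq]
  rw [e]
  simp [add_comm]

lemma Env.meas_minus (t s : ℝ) (x y : Euc d) :
    MeasurableSet[sigmaMinus c v (t + s)] {ω | tau c v t x y ω < s} := by
  refine tau_meas_lt (m := _) h.C t s x y fun r _ h2 z => ?_
  refine (comap_measurable _).mono ?_ le_rfl
  exact le_iSup_of_le r (le_iSup_of_le h2.le (le_iSup_of_le z le_rfl))

lemma Env.meas_plus (t : ℝ) (x y : Euc d) : Measurable[sigmaPlus c v t] (tau c v t x y) := by
  refine @measurable_of_Iio ℝ Ω _ _ _ (sigmaPlus c v t) _ _ _ _ fun s => ?_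
  refine tau_meas_lt (m := _) h.C t s x y fun r h1 _ z => ?_
  refine (comap_measurable _).mono ?_ le_rfl
  exact le_iSup_of_le r (le_iSup_of_le h1 (le_iSup_of_le z le_rfl))

lemma Env.nonneg (t : ℝ) (x y : Euc d) (ω : Ω) : 0 ≤ tau c v t x y ω := (h.C ω).nonneg t x y
lemma Env.ub (t : ℝ) (x y : Euc d) (ω : Ω) : tau c v t x y ω ≤ C0 * (1 + ‖x - y‖) := (h.C ω).ub t x y
end
end

section
variable {d : ℕ} {Ω : Type*} [MeasurableSpace Ω] {P : Measure Ω} [IsProbabilityMeasure P]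
  {c : ℝ → Euc d → Ω → ℝ} {v : ℝ → Euc d → Ω → Euc d}

lemma phi_elem {t s r : ℝ} {E F : Set Ω}
    (hr : r = |(P (F ∩ E)).toReal / (P E).toReal - (P F).toReal|) : r ≤ 1 := by
  have h1 : (P (F ∩ E)).toReal ≤ (P E).toReal :=
    ENNReal.toReal_mono (measure_ne_top _ _) (measure_mono Set.inter_subset_right)
  have h2 : (P F).toReal ≤ 1 := measureReal_le_one
  have h3 : (P (F ∩ E)).toReal / (P E).toReal ≤ 1 := div_le_one_of_le₀ h1 ENNReal.toReal_nonneg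
  have h4 : 0 ≤ (P (F ∩ E)).toReal / (P E).toReal := by positivity
  have h5 : 0 ≤ (P F).toReal := ENNReal.toReal_nonneg
  rw [hr, abs_le]; constructor <;> linarith

lemma phi_le_one (s : ℝ) : phiH P c v s ≤ 1 := by
  refine Real.sSup_le ?_ zero_le_one
  rintro r ⟨t, E, F, -, -, -, h⟩
  exact phi_elem (t := t) (s := s) h

lemma phi_nonneg (s : ℝ) : 0 ≤ phiH P c v s := by
  refine Real.sSup_nonneg ?_
  rintro r ⟨t, E, F, -, -, -, h⟩
  rw [h]; positivity

lemma phi_bound {t s : ℝ} {E F : Set Ω} (hE : MeasurableSet[sigmaMinus c v t] E)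
    (hF : MeasurableSet[sigmaPlus c v (t + s)] F) :
    P.real (F ∩ E) ≤ P.real E * (P.real F + phiH P c v s) := by
  by_cases h0 : P E = 0
  · have : P (F ∩ E) = 0 := measure_mono_null Set.inter_subset_right h0
    simp [Measure.real, h0, this]
  have hp : 0 < P E := pos_iff_ne_zero.2 h0
  have h1 : |(P (F ∩ E)).toReal / (P E).toReal - (P F).toReal| ≤ phiH P c v s := by
    refine le_csSup ⟨1, ?_⟩ ⟨t, E, F, hE, hF, hp, rfl⟩
    rintro r ⟨t, E, F, -, -, -, h⟩
    exact phi_elem (t := t) (s := s) h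
  have h2 := (abs_le.1 h1).2
  have h3 : 0 < (P E).toReal := ENNReal.toReal_pos h0 (measure_ne_top _ _)
  have h4 : (P (F ∩ E)).toReal / (P E).toReal ≤ (P F).toReal + phiH P c v s := by linarith
  rw [div_le_iff₀ h3] at h4
  simp only [Measure.real]
  linarith

lemma bdd_int {f : Ω → ℝ} (hf : Measurable f) {M : ℝ} (h0 : ∀ ω, 0 ≤ f ω) (hM : ∀ ω, f ω ≤ M)
    (μ : Measure Ω) [IsFiniteMeasure μ] : Integrable f μ :=
  Integrable.of_bound hf.aestronglyMeasurable M (ae_of_all _ fun ω => by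
    rw [Real.norm_of_nonneg (h0 ω)]; exact hM ω)

lemma mix_int {t s : ℝ} {E : Set Ω} (hE : MeasurableSet[sigmaMinus c v t] E) (hE' : MeasurableSet E)
    {f : Ω → ℝ} (hf : Measurable f) (hf' : Measurable[sigmaPlus c v (t + s)] f) {M : ℝ}
    (h0 : ∀ ω, 0 ≤ f ω) (hM : ∀ ω, f ω ≤ M) :
    ∫ ω in E, f ω ∂P ≤ P.real E * (∫ ω, f ω ∂P + M * phiH P c v s) := by
  have M0 : 0 ≤ M := by
    obtain ⟨ω⟩ := P.nonempty_of_neZero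
    exact (h0 ω).trans (hM ω)
  have key : ∀ μ : Measure Ω, IsFiniteMeasure μ → ∫ ω, f ω ∂μ = ∫ r in Set.Ioc 0 M, μ.real {a | r ≤ f a} := by
    intro μ hμ
    exact (bdd_int hf h0 hM μ).integral_eq_integral_Ioc_meas_le (ae_of_all _ h0) (ae_of_all _ hM)
  have ii : ∀ μ : Measure Ω, IsFiniteMeasure μ → IntegrableOn (fun r => μ.real {a | r ≤ f a}) (Set.Ioc 0 M) := by
    intro μ hμ
    have : Antitone (fun r => μ.real {a | r ≤ f a}) := fun r r' hr =>
      measureReal_mono fun a (ha : r' ≤ f a) => hr.trans ha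
    exact (this.antitoneOn _).integrableOn_isCompact (isCompact_Icc (a := 0) (b := M)) |>.mono_set
      Set.Ioc_subset_Icc_self
  rw [key (P.restrict E) inferInstance, key P inferInstance]
  have e : P.real E * (∫ r in Set.Ioc 0 M, P.real {a | r ≤ f a}) + P.real E * (M * phiH P c v s)
      = ∫ r in Set.Ioc 0 M, P.real E * (P.real {a | r ≤ f a} + phiH P c v s) := by
    rw [integral_const_mul, integral_add (ii P inferInstance) (by simp)]
    simp [M0, mul_add]
  rw [mul_add, e]
  refine setIntegral_mono (ii _ inferInstance) (((ii P inferInstance).add (by simp)).const_mul _) fun r => ?_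
  have hm : MeasurableSet {a | r ≤ f a} := measurableSet_le measurable_const hf
  simp only
  rw [measureReal_restrict_apply hm]
  exact phi_bound hE (hf' measurableSet_Ici)

lemma split_le {A : Ω → ℝ} (hA : Measurable A) {s M : ℝ} (hs : 0 < s) (A0 : ∀ ω, 0 ≤ A ω)
    (AM : ∀ ω, A ω ≤ M) {B D : Ω → ℝ} (hB : Integrable B P) (hD : Integrable D P)
    (h : ∀ j : ℕ, ∫ ω in {ω | j * s ≤ A ω ∧ A ω < (j + 1) * s}, B ω ∂P ≤
      ∫ ω in {ω | j * s ≤ A ω ∧ A ω < (j + 1) * s}, D ω ∂P) : ∫ ω, B ω ∂P ≤ ∫ ω, D ω ∂P := by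
  set E : ℕ → Set Ω := fun j => {ω | j * s ≤ A ω ∧ A ω < (j + 1) * s} with hEdef
  have hE : ∀ j, MeasurableSet (E j) := fun j =>
    (measurableSet_le measurable_const hA).inter (measurableSet_lt hA measurable_const)
  have hd : Pairwise (Function.onFun Disjoint E) := by
    intro i j hij
    refine Set.disjoint_left.2 fun ω h1 h2 => hij ?_
    have a1 : (i:ℝ) < j + 1 := lt_of_mul_lt_mul_right (h1.1.trans_lt h2.2) hs.le
    have a2 : (j:ℝ) < i + 1 := lt_of_mul_lt_mul_right (h2.1.trans_lt h1.2) hs.le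
    have b1 : i < j + 1 := by exact_mod_cast a1
    have b2 : j < i + 1 := by exact_mod_cast a2
    omega
  obtain ⟨n, hn⟩ := exists_nat_gt (M / s)
  have hU : (⋃ j ∈ Finset.range n, E j) = Set.univ := by
    refine Set.eq_univ_of_forall fun ω => ?_
    simp only [Set.mem_iUnion]
    have h1 : 0 ≤ A ω / s := div_nonneg (A0 ω) hs.le
    refine ⟨⌊A ω / s⌋₊, ?_, ?_, ?_⟩
    · rw [Finset.mem_range, Nat.floor_lt h1]
      exact lt_of_le_of_lt (by gcongr; exact AM ω) hn
    · rw [← le_div_iff₀ hs]; exact Nat.floor_le h1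
    · rw [← div_lt_iff₀ hs]; exact Nat.lt_floor_add_one _
  have key : ∀ F : Ω → ℝ, Integrable F P → ∫ ω, F ω ∂P = ∑ j ∈ Finset.range n, ∫ ω in E j, F ω ∂P := by
    intro F hF
    rw [← setIntegral_univ, ← hU]
    exact integral_biUnion_finset _ (fun j _ => hE j) (fun i _ j _ hij => hd hij) fun j _ => hF.integrableOn
  rw [key B hB, key D hD]
  exact Finset.sum_le_sum fun j _ => h j

lemma mix_step {A B : Ω → ℝ} (hA : Measurable A) {s M M' g g2 : ℝ} (hs : 0 < s) (A0 : ∀ ω, 0 ≤ A ω)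
    (AM : ∀ ω, A ω ≤ M') (hA' : ∀ r, MeasurableSet[sigmaMinus c v r] {ω | A ω < r})
    {Y : ℕ → Ω → ℝ} (hY : ∀ j, Measurable (Y j))
    (hY' : ∀ j : ℕ, Measurable[sigmaPlus c v ((j + 1) * s + s)] (Y j)) (Y0 : ∀ j ω, 0 ≤ Y j ω)
    (YM : ∀ j ω, Y j ω ≤ M) (Yg : ∀ j, ∫ ω, Y j ω ∂P = g) (Yg2 : ∀ j, ∫ ω, Y j ω ^ 2 ∂P = g2)
    (hB : Measurable B) (B0 : ∀ ω, 0 ≤ B ω)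
    (hBY : ∀ (j : ℕ) ω, A ω < (j + 1) * s → B ω ≤ ((j + 1) * s + s) + Y j ω) :
    ∫ ω, B ω ∂P ≤ ∫ ω, (A ω + (2 * s + (g + M * phiH P c v s))) ∂P ∧
    ∫ ω, B ω ^ 2 ∂P ≤ ∫ ω, ((A ω + 2 * s) ^ 2 + (2 * (A ω + 2 * s) * (g + M * phiH P c v s)
      + (g2 + M ^ 2 * phiH P c v s))) ∂P := by
  have M0 : 0 ≤ M := by
    obtain ⟨ω⟩ := P.nonempty_of_neZero
    exact (Y0 0 ω).trans (YM 0 ω)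
  have φ0 := phi_nonneg (P := P) (c := c) (v := v) s
  have g0 : 0 ≤ g := by rw [← Yg 0]; exact integral_nonneg (Y0 0)
  set φ := phiH P c v s with hφ
  set G := g + M * φ with hG
  set G2 := g2 + M ^ 2 * φ with hG2
  have G0 : 0 ≤ G := by positivity
  have hBM : ∀ ω, B ω ≤ M' + 2 * s + M := by
    intro ω
    have h1 : 0 ≤ A ω / s := div_nonneg (A0 ω) hs.le
    have := hBY ⌊A ω / s⌋₊ ω (by rw [← div_lt_iff₀ hs]; exact Nat.lt_floor_add_one _)
    have h2 : (⌊A ω / s⌋₊ : ℝ) * s ≤ A ω := by rw [← le_div_iff₀ hs]; exact Nat.floor_le h1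
    have := YM ⌊A ω / s⌋₊ ω
    have := AM ω
    linarith
  have iA := fun (μ : Measure Ω) [IsFiniteMeasure μ] => bdd_int hA A0 AM μ
  have iA2 := fun (μ : Measure Ω) [IsFiniteMeasure μ] => bdd_int (hA.add_const (2 * s) |>.pow_const 2)
    (fun ω => sq_nonneg _) (fun ω => pow_le_pow_left₀ (by have := A0 ω; positivity)
      (add_le_add_left (AM ω) (2 * s)) 2) μ
  have iB := fun (μ : Measure Ω) [IsFiniteMeasure μ] => bdd_int hB B0 hBM μ
  have iB2 := fun (μ : Measure Ω) [IsFiniteMeasure μ] => bdd_int (hB.pow_const 2)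
    (fun ω => sq_nonneg _) (fun ω => pow_le_pow_left₀ (B0 ω) (hBM ω) 2) μ
  have iY := fun j (μ : Measure Ω) [IsFiniteMeasure μ] => bdd_int (hY j) (Y0 j) (YM j) μ
  have iY2 := fun j (μ : Measure Ω) [IsFiniteMeasure μ] => bdd_int ((hY j).pow_const 2)
    (fun ω => sq_nonneg _) (fun ω => pow_le_pow_left₀ (Y0 j ω) (YM j ω) 2) μ
  have hEm : ∀ j : ℕ, MeasurableSet {ω | j * s ≤ A ω ∧ A ω < (j + 1) * s} := fun j =>
    (measurableSet_le measurable_const hA).inter (measurableSet_lt hA measurable_const)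
  have hEs : ∀ j : ℕ, MeasurableSet[sigmaMinus c v ((j + 1) * s)] {ω | j * s ≤ A ω ∧ A ω < (j + 1) * s} := by
    intro j
    have e : {ω | j * s ≤ A ω ∧ A ω < (j + 1) * s} = {ω | A ω < (j + 1) * s} \ {ω | A ω < j * s} := by
      ext ω; simp [and_comm]
    rw [e]
    refine MeasurableSet.diff (hA' _) ?_
    refine (show sigmaMinus c v (j * s) ≤ sigmaMinus c v ((j + 1) * s) from ?_) _ (hA' _)
    refine iSup_le fun r => iSup_le fun hr => iSup_le fun z => ?_
    exact le_iSup_of_le r (le_iSup_of_le (hr.trans (by gcongr; linarith)) (le_iSup_of_le z le_rfl))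
  have m1 : ∀ j : ℕ, ∫ ω in {ω | j * s ≤ A ω ∧ A ω < (j + 1) * s}, Y j ω ∂P ≤
      P.real {ω | j * s ≤ A ω ∧ A ω < (j + 1) * s} * G := by
    intro j
    have := mix_int (P := P) (hEs j) (hEm j) (hY j) (hY' j) (Y0 j) (YM j)
    rwa [Yg j] at this
  have m2 : ∀ j : ℕ, ∫ ω in {ω | j * s ≤ A ω ∧ A ω < (j + 1) * s}, Y j ω ^ 2 ∂P ≤
      P.real {ω | j * s ≤ A ω ∧ A ω < (j + 1) * s} * G2 := by
    intro j
    have := mix_int (P := P) (hEs j) (hEm j) ((hY j).pow_const 2) ((hY' j).pow_const 2) (fun ω => sq_nonneg _)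
      (fun ω => pow_le_pow_left₀ (Y0 j ω) (YM j ω) 2)
    rwa [Yg2 j] at this
  have i1 : ∀ (μ : Measure Ω) [IsFiniteMeasure μ], Integrable (fun ω => A ω + (2 * s + G)) μ :=
    fun μ _ => (iA μ).add (integrable_const _)
  have i2 : ∀ (μ : Measure Ω) [IsFiniteMeasure μ], Integrable
      (fun ω => (A ω + 2 * s) ^ 2 + (2 * (A ω + 2 * s) * G + G2)) μ := fun μ _ =>
    (iA2 μ).add (((((iA μ).add (integrable_const _)).const_mul _).mul_const _).add (integrable_const _))
  have i3 : ∀ (T : ℝ) j (μ : Measure Ω) [IsFiniteMeasure μ], Integrable (fun ω => 2 * T * Y j ω + Y j ω ^ 2) μ :=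
    fun T j μ _ => ((iY j _).const_mul _).add (iY2 j _)
  have i4 : ∀ (T : ℝ) j (μ : Measure Ω) [IsFiniteMeasure μ], Integrable
      (fun ω => T ^ 2 + (2 * T * Y j ω + Y j ω ^ 2)) μ :=
    fun T j μ _ => (integrable_const _).add (i3 T j μ)
  constructor
  · refine split_le hA hs A0 AM (iB P) (i1 P) fun j => ?_
    have m := m1 j
    have hE := hEm j
    set E := {ω | j * s ≤ A ω ∧ A ω < (j + 1) * s} with hEd
    calc ∫ ω in E, B ω ∂P ≤ ∫ ω in E, (((j + 1) * s + s) + Y j ω) ∂P :=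
          setIntegral_mono_on (iB _) ((integrable_const _).add (iY j _)) hE fun ω hω => hBY j ω hω.2
      _ = P.real E * ((j + 1) * s + s) + ∫ ω in E, Y j ω ∂P := by
          rw [integral_add (integrable_const _) (iY j _)]; simp
      _ ≤ P.real E * (((j + 1) * s + s) + G) := by rw [mul_add]; linarith
      _ = ∫ ω in E, (((j + 1) * s + s) + G) ∂P := by simp
      _ ≤ _ := setIntegral_mono_on (integrable_const _) (i1 _) hE fun ω hω => by
          have := hω.1
          linarith
  · refine split_le hA hs A0 AM (iB2 P) (i2 P) fun j => ?_
    have m := m1 j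
    have mm := m2 j
    have hE := hEm j
    set E := {ω | j * s ≤ A ω ∧ A ω < (j + 1) * s} with hEd
    set T : ℝ := (j + 1) * s + s with hT
    have T0 : 0 ≤ T := by positivity
    calc ∫ ω in E, B ω ^ 2 ∂P ≤ ∫ ω in E, (T ^ 2 + (2 * T * Y j ω + Y j ω ^ 2)) ∂P :=
          setIntegral_mono_on (iB2 _) (i4 T j _) hE fun ω hω => by
            have := pow_le_pow_left₀ (B0 ω) (hBY j ω hω.2) 2
            calc _ ≤ _ := this
              _ = _ := by ring
      _ = P.real E * T ^ 2 + (2 * T * ∫ ω in E, Y j ω ∂P + ∫ ω in E, Y j ω ^ 2 ∂P) := by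
          rw [integral_add (integrable_const _) (i3 T j _),
            integral_add ((iY j _).const_mul _) (iY2 j _), integral_const_mul]
          simp
      _ ≤ P.real E * T ^ 2 + (2 * T * (P.real E * G) + P.real E * G2) := by gcongr
      _ = ∫ ω in E, (T ^ 2 + (2 * T * G + G2)) ∂P := by simp; ring
      _ ≤ _ := setIntegral_mono_on (integrable_const _) (i2 _) hE fun ω hω => by
          have h1 : T ≤ A ω + 2 * s := by have := hω.1; linarith
          gcongr
end

section

lemma sum_var {m V err : ℕ → ℝ} (m0 : ∀ k, 0 ≤ m k) (V0 : ∀ k, 0 ≤ V k) (e0 : ∀ k, 0 ≤ err k)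
    (he : Summable err) (h : ∀ k, m (k + 1) + V k / 2 ≤ m k + err k) : Summable V := by
  have key : ∀ n, m n + ∑ k ∈ Finset.range n, V k / 2 ≤ m 0 + ∑ k ∈ Finset.range n, err k := by
    intro n
    induction n with
    | zero => simp
    | succ n ih => rw [Finset.sum_range_succ, Finset.sum_range_succ]; linarith [h n]
  refine summable_of_sum_range_le V0 (c := 2 * (m 0 + ∑' k, err k)) fun n => ?_
  have h1 := key n
  have h2 := he.sum_le_tsum (Finset.range n) fun k _ => e0 k
  rw [← Finset.sum_div] at h1
  linarith [m0 n]

lemma almost_anti {e b : ℕ → ℝ} (e0 : ∀ k, 0 ≤ e k) (b0 : ∀ k, 0 ≤ b k) (hb : Summable b)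
    (h : ∀ k, e (k + 1) ≤ e k + b k) : ∃ l, Tendsto e atTop (nhds l) := by
  set w : ℕ → ℝ := fun n => e n - ∑ k ∈ Finset.range n, b k with hw
  have ha : Antitone w := antitone_nat_of_succ_le fun n => by
    simp only [hw, Finset.sum_range_succ]; linarith [h n]
  have hbd : BddBelow (Set.range w) := by
    refine ⟨-∑' k, b k, ?_⟩
    rintro _ ⟨n, rfl⟩
    have := hb.sum_le_tsum (Finset.range n) fun k _ => b0 k
    simp only [hw]; linarith [e0 n]
  have h1 := tendsto_atTop_ciInf ha hbd
  have h2 := h1.add hb.hasSum.tendsto_sum_nat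
  refine ⟨_, h2.congr fun n => ?_⟩
  simp [hw]

lemma ae_zero {Ω : Type*} [MeasurableSpace Ω] {P : Measure Ω} {Z : ℕ → Ω → ℝ}
    (hm : ∀ k, Integrable (Z k) P) (h0 : ∀ k ω, 0 ≤ Z k ω) (hs : Summable fun k => ∫ ω, Z k ω ∂P) :
    ∀ᵐ ω ∂P, Tendsto (fun k => Z k ω) atTop (nhds 0) := by
  have h1 : ∫⁻ ω, ∑' k, ENNReal.ofReal (Z k ω) ∂P ≠ ⊤ := by
    rw [lintegral_tsum fun k => (hm k).aemeasurable.ennreal_ofReal]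
    have : ∀ k, ∫⁻ ω, ENNReal.ofReal (Z k ω) ∂P = ENNReal.ofReal (∫ ω, Z k ω ∂P) := fun k =>
      (ofReal_integral_eq_lintegral_ofReal (hm k) (ae_of_all _ (h0 k))).symm
    simp_rw [this]
    exact hs.tsum_ofReal_ne_top
  have h2 := ae_lt_top' (AEMeasurable.tsum fun k => (hm k).aemeasurable.ennreal_ofReal) h1
  filter_upwards [h2] with ω hω
  have h3 := ENNReal.tendsto_atTop_zero_of_tsum_ne_top hω.ne
  have h4 := (ENNReal.tendsto_toReal ENNReal.zero_ne_top).comp h3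
  simp only [Function.comp_def, ENNReal.toReal_zero] at h4
  refine h4.congr fun k => ENNReal.toReal_ofReal (h0 k ω)

variable {d : ℕ} {Ω : Type*} [MeasurableSpace Ω] {P : Measure Ω} [IsProbabilityMeasure P] {K C0 : ℝ}
  {c : ℝ → Euc d → Ω → ℝ} {v : ℝ → Euc d → Ω → Euc d}

def fE (P : Measure Ω) (c : ℝ → Euc d → Ω → ℝ) (v : ℝ → Euc d → Ω → Euc d) (x : Euc d) : ℝ :=
  ∫ ω, tau c v 0 0 x ω ∂P
def fS (P : Measure Ω) (c : ℝ → Euc d → Ω → ℝ) (v : ℝ → Euc d → Ω → Euc d) (x : Euc d) : ℝ :=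
  ∫ ω, tau c v 0 0 x ω ^ 2 ∂P

lemma Env.law_int (h : Env P K C0 c v) {g : ℝ → ℝ} (hg : Measurable g) (t : ℝ) (x y : Euc d) :
    ∫ ω, g (tau c v t x y ω) ∂P = ∫ ω, g (tau c v 0 0 (y - x) ω) ∂P := by
  obtain ⟨θ, h1, h2⟩ := h.law t x y
  simp_rw [h2]
  have hm : Measurable fun ω => g (tau c v 0 0 (y - x) ω) := hg.comp (h.tm _ _ _)
  conv_rhs => rw [← h1.map_eq]
  rw [integral_map h1.measurable.aemeasurable hm.aestronglyMeasurable]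

lemma Env.int (h : Env P K C0 c v) (t : ℝ) (x y : Euc d) : Integrable (tau c v t x y) P :=
  bdd_int (h.tm t x y) (h.nonneg t x y) (h.ub t x y) P

lemma Env.int2 (h : Env P K C0 c v) (t : ℝ) (x y : Euc d) : Integrable (fun ω => tau c v t x y ω ^ 2) P :=
  bdd_int ((h.tm t x y).pow_const 2) (fun _ => sq_nonneg _)
    (fun ω => pow_le_pow_left₀ (h.nonneg t x y ω) (h.ub t x y ω) 2) P

lemma Env.step (h : Env P K C0 c v) {s : ℝ} (hs : C0 ≤ s) (x y : Euc d) :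
    fE P c v (x + y) ≤ fE P c v x + (2 * s + (fE P c v y + C0 * (1 + ‖y‖) * phiH P c v s)) ∧
    fS P c v (x + y) ≤ fS P c v x + 4 * s * fE P c v x + 4 * s ^ 2 +
      (2 * (fE P c v x + 2 * s) * (fE P c v y + C0 * (1 + ‖y‖) * phiH P c v s)
        + (fS P c v y + (C0 * (1 + ‖y‖)) ^ 2 * phiH P c v s)) := by
  obtain ⟨ω0⟩ := P.nonempty_of_neZero
  have C1 := (h.C ω0).C1
  have := mix_step (P := P) (c := c) (v := v) (A := tau c v 0 0 x) (B := tau c v 0 0 (x + y)) (h.tm _ _ _)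
    (s := s) (M := C0 * (1 + ‖y‖)) (M' := C0 * (1 + ‖0 - x‖)) (g := fE P c v y) (g2 := fS P c v y)
    (by linarith) (h.nonneg _ _ _) (h.ub _ _ _) (fun r => by have := h.meas_minus 0 r 0 x; rwa [zero_add] at this)
    (Y := fun j => tau c v ((j + 1) * s + s) x (x + y)) (fun j => h.tm _ _ _) (fun j => h.meas_plus _ _ _)
    (fun j => h.nonneg _ _ _) (fun j ω => by simpa using h.ub ((j + 1) * s + s) x (x + y) ω)
    (fun j => by simpa [fE] using h.law_int measurable_id ((j + 1) * s + s) x (x + y))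
    (fun j => by simpa [fS] using h.law_int (measurable_id.pow_const 2) ((j + 1) * s + s) x (x + y))
    (h.tm _ _ _) (h.nonneg _ _ _)
    (fun j ω hj => by
      have h1 := (h.C ω).after hj (y' := x) (T := (j + 1) * s + s) (by simpa using hs)
      have h2 := (h.C ω).le_of_reach h1 (z := x + y)
      simpa [tau] using h2)
  have iA := h.int 0 0 x
  have iA2 := h.int2 0 0 x
  constructor
  · refine this.1.trans (le_of_eq ?_)
    rw [integral_add iA (integrable_const _)]
    simp [fE]
  · refine this.2.trans (le_of_eq ?_)
    generalize fE P c v y + C0 * (1 + ‖y‖) * phiH P c v s = G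
    generalize (fS P c v y + (C0 * (1 + ‖y‖)) ^ 2 * phiH P c v s) = G2
    have e : ∀ ω, (tau c v 0 0 x ω + 2 * s) ^ 2 + (2 * (tau c v 0 0 x ω + 2 * s) * G + G2)
      = tau c v 0 0 x ω ^ 2 + ((4 * s + 2 * G) * tau c v 0 0 x ω + (4 * s ^ 2 + 4 * s * G + G2)) :=
      fun ω => by ring
    simp_rw [e]
    have i3 : Integrable (fun ω => (4 * s + 2 * G) * tau c v 0 0 x ω + (4 * s ^ 2 + 4 * s * G + G2)) P :=
      (iA.const_mul _).add (integrable_const _)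
    rw [integral_add iA2 i3, integral_add (iA.const_mul _) (integrable_const _), integral_const_mul]
    simp only [integral_const, probReal_univ, one_smul]
    rw [← fE, ← fS]
    ring

lemma phi_sum {α : ℝ} (hα : 0 < α) (hC : 1 ≤ C0)
    (hmix : Tendsto (fun s : ℝ => s ^ α * phiH P c v s) atTop (nhds 0)) :
    Summable fun k : ℕ => phiH P c v (C0 * (3 / 2) ^ k) := by
  have h1 : Tendsto (fun k : ℕ => C0 * (3 / 2 : ℝ) ^ k) atTop atTop :=
    (tendsto_pow_atTop_atTop_of_one_lt (by norm_num)).const_mul_atTop (by linarith)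
  have h2 := h1.eventually (hmix.eventually_lt_const zero_lt_one)
  have hr : 1 < (3 / 2 : ℝ) ^ α := Real.one_lt_rpow (by norm_num) hα
  refine Summable.of_norm_bounded_eventually_nat (g := fun k => (((3 / 2 : ℝ) ^ α)⁻¹) ^ k)
    (summable_geometric_of_lt_one (by positivity) (inv_lt_one_of_one_lt₀ hr)) ?_
  filter_upwards [h2] with k hk
  have φ0 := phi_nonneg (P := P) (c := c) (v := v) (C0 * (3 / 2) ^ k)
  rw [Real.norm_of_nonneg φ0, inv_pow, ← one_div, le_div_iff₀ (by positivity)]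
  refine le_trans ?_ hk.le
  rw [mul_comm]
  refine mul_le_mul_of_nonneg_right ?_ φ0
  rw [← Real.rpow_natCast, ← Real.rpow_mul (by norm_num), mul_comm α, Real.rpow_mul (by norm_num), Real.rpow_natCast]
  refine Real.rpow_le_rpow (by positivity) ?_ hα.le
  have : (0:ℝ) < (3 / 2) ^ k := by positivity
  nlinarith

lemma Env.conv (h : Env P K C0 c v) {α : ℝ} (hα : 0 < α)
    (hmix : Tendsto (fun s : ℝ => s ^ α * phiH P c v s) atTop (nhds 0)) (x : Euc d) :
    (∃ l, Tendsto (fun k : ℕ => fE P c v ((2:ℝ) ^ k • x) / 2 ^ k) atTop (nhds l)) ∧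
    Summable (fun k : ℕ => fS P c v ((2:ℝ) ^ k • x) / 4 ^ k - (fE P c v ((2:ℝ) ^ k • x) / 2 ^ k) ^ 2) := by
  obtain ⟨ω0⟩ := P.nonempty_of_neZero
  have C1 := (h.C ω0).C1
  have hφ := phi_sum (P := P) (c := c) (v := v) hα C1 hmix
  set D := C0 * (1 + ‖x‖) with hD
  have D0 : 0 ≤ D := by positivity
  have CD : C0 ≤ D := by rw [hD]; nlinarith [norm_nonneg x]
  set φ : ℕ → ℝ := fun k => phiH P c v (C0 * (3 / 2) ^ k) with hφd
  have φ0 : ∀ k, 0 ≤ φ k := fun k => phi_nonneg _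
  have φ1 : ∀ k, φ k ≤ 1 := fun k => phi_le_one _
  set e : ℕ → ℝ := fun k => fE P c v ((2:ℝ) ^ k • x) / 2 ^ k with he
  set m : ℕ → ℝ := fun k => fS P c v ((2:ℝ) ^ k • x) / 4 ^ k with hm
  set q : ℕ → ℝ := fun k => (3 / 4) ^ k with hq
  have q0 : ∀ k, 0 ≤ q k := fun k => by positivity
  have q1 : ∀ k, q k ≤ 1 := fun k => pow_le_one₀ (by norm_num) (by norm_num)
  have qs : Summable q := summable_geometric_of_lt_one (by norm_num) (by norm_num)
  have hM : ∀ k, C0 * (1 + ‖(2:ℝ) ^ k • x‖) ≤ D * 2 ^ k := by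
    intro k
    rw [norm_smul, norm_pow, Real.norm_of_nonneg (by norm_num : (0:ℝ) ≤ 2), hD, mul_assoc]
    refine mul_le_mul_of_nonneg_left ?_ (by linarith)
    have : (1:ℝ) ≤ 2 ^ k := one_le_pow₀ (by norm_num)
    linarith
  have fM : ∀ k, fE P c v ((2:ℝ) ^ k • x) ≤ D * 2 ^ k := by
    intro k
    refine le_trans ?_ (hM k)
    have := integral_mono (h.int 0 0 ((2:ℝ) ^ k • x)) (integrable_const _) (h.ub 0 0 ((2:ℝ) ^ k • x))
    simpa [fE] using this
  have f0 : ∀ k, 0 ≤ fE P c v ((2:ℝ) ^ k • x) := fun k => integral_nonneg (h.nonneg _ _ _)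
  have e0 : ∀ k, 0 ≤ e k := fun k => div_nonneg (f0 k) (by positivity)
  have eD : ∀ k, e k ≤ D := fun k => by
    simp only [he]; rw [div_le_iff₀ (by positivity)]; exact fM k
  have m0 : ∀ k, 0 ≤ m k := fun k => div_nonneg (integral_nonneg fun _ => sq_nonneg _) (by positivity)
  have p2 : ∀ k : ℕ, (0:ℝ) < 2 ^ k := fun k => by positivity
  have efE : ∀ k, fE P c v ((2:ℝ) ^ k • x) = e k * 2 ^ k := fun k => by
    simp only [he]; rw [div_mul_cancel₀ _ (p2 k).ne']
  have efS : ∀ k, fS P c v ((2:ℝ) ^ k • x) = m k * (2 ^ k * 2 ^ k) := fun k => by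
    simp only [hm]; rw [← mul_pow]; norm_num
  have es : ∀ k, C0 * (3 / 2 : ℝ) ^ k ≤ D * q k * 2 ^ k := fun k => by
    simp only [hq]; rw [mul_assoc, ← mul_pow]; norm_num; gcongr
  have hdbl : ∀ k, ((2:ℝ) ^ (k + 1)) • x = (2:ℝ) ^ k • x + (2:ℝ) ^ k • x := fun k => by
    rw [← add_smul, pow_succ]; ring_nf
  have st := fun k => h.step (s := C0 * (3 / 2) ^ k) (by
    have : (1:ℝ) ≤ (3 / 2) ^ k := one_le_pow₀ (by norm_num)
    nlinarith) ((2:ℝ) ^ k • x) ((2:ℝ) ^ k • x)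
  have st1 : ∀ k, e (k + 1) ≤ e k + D * (q k + φ k) := by
    intro k
    have h1 := (st k).1
    rw [← hdbl, efE, efE, pow_succ] at h1
    have h2 : C0 * (1 + ‖(2:ℝ) ^ k • x‖) * φ k ≤ D * 2 ^ k * φ k :=
      mul_le_mul_of_nonneg_right (hM k) (φ0 k)
    have h3 := es k
    have h5 : e (k + 1) * 2 ^ k ≤ (e k + D * (q k + φ k)) * 2 ^ k := by
      have h6 : 0 ≤ D * 2 ^ k * φ k := by have := φ0 k; positivity
      simp only [hφd] at *
      linarith
    exact le_of_mul_le_mul_right h5 (p2 k)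
  have st2 : ∀ k, 4 * m (k + 1) ≤ 2 * m k + 2 * e k ^ 2 + D ^ 2 * (16 * q k + 3 * φ k) := by
    intro k
    have h1 := (st k).2
    rw [← hdbl, efE, efS, efS, pow_succ] at h1
    have h3 := es k
    have hM' := hM k
    have hMM : 0 ≤ C0 * (1 + ‖(2:ℝ) ^ k • x‖) := by positivity
    have hss : 0 ≤ C0 * (3 / 2 : ℝ) ^ k := by positivity
    rw [show phiH P c v (C0 * (3 / 2) ^ k) = φ k from rfl] at h1
    generalize C0 * (1 + ‖(2:ℝ) ^ k • x‖) = M at *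
    generalize C0 * (3 / 2 : ℝ) ^ k = s at *
    have hek := e0 k
    have heD := eD k
    have hf0 := φ0 k
    have hf1 := φ1 k
    have hq0 := q0 k
    have hq1 := q1 k
    have hp := p2 k
    generalize (2:ℝ) ^ k = N at *
    generalize φ k = f at *
    generalize q k = r at *
    generalize e k = E at *
    have b1 : m (k + 1) * (N * 2 * (N * 2)) ≤ m k * (N * N) + 4 * (D * r * N) * (E * N) + 4 * (D * r * N) ^ 2
        + (2 * (E * N + 2 * (D * r * N)) * (E * N + D * N * f) + (m k * (N * N) + (D * N) ^ 2 * f)) := by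
      refine h1.trans ?_
      gcongr
    have b2 : 4 * m (k + 1) * (N * N) ≤ (2 * m k + 2 * E ^ 2 + D ^ 2 * (16 * r + 3 * f)) * (N * N) := by
      refine le_trans (le_of_eq (by ring)) (b1.trans ?_)
      have b3 : 4 * (D * r) * E + 4 * (D * r) ^ 2 + 2 * (E + 2 * (D * r)) * (E + D * f) + D ^ 2 * f ≤
          2 * E ^ 2 + D ^ 2 * (16 * r + 3 * f) := by
        have c1 : (D * r) * E ≤ D * r * D := by gcongr
        have c2 : (D * r) ^ 2 ≤ D ^ 2 * r := by
          rw [mul_pow]; gcongr; nlinarith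
        have c3 : E * (D * f) ≤ D * (D * f) := by gcongr
        have c4 : (D * r) * (D * f) ≤ (D * r) * (D * 1) := by gcongr
        nlinarith
      have := mul_le_mul_of_nonneg_right b3 (show 0 ≤ N * N by positivity)
      nlinarith
    exact le_of_mul_le_mul_right b2 (by positivity)
  have V0 : ∀ k, 0 ≤ m k - e k ^ 2 := by
    intro k
    have h1 : 0 ≤ ∫ ω, (tau c v 0 0 ((2:ℝ) ^ k • x) ω - e k * 2 ^ k) ^ 2 ∂P := integral_nonneg fun _ => sq_nonneg _
    have e1 : ∀ ω, (tau c v 0 0 ((2:ℝ) ^ k • x) ω - e k * 2 ^ k) ^ 2 = tau c v 0 0 ((2:ℝ) ^ k • x) ω ^ 2 +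
      (-2 * (e k * 2 ^ k) * tau c v 0 0 ((2:ℝ) ^ k • x) ω + (e k * 2 ^ k) ^ 2) := fun ω => by ring
    simp_rw [e1] at h1
    have iA := h.int 0 0 ((2:ℝ) ^ k • x)
    have i3 : Integrable (fun ω => -2 * (e k * 2 ^ k) * tau c v 0 0 ((2:ℝ) ^ k • x) ω + (e k * 2 ^ k) ^ 2) P :=
      (iA.const_mul _).add (integrable_const _)
    rw [integral_add (h.int2 0 0 _) i3, integral_add (iA.const_mul _) (integrable_const _), integral_const_mul] at h1
    simp only [integral_const, probReal_univ, one_smul] at h1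
    rw [← fE, ← fS, efE, efS] at h1
    have : 0 ≤ (m k - e k ^ 2) * (2 ^ k * 2 ^ k) := by linarith
    exact nonneg_of_mul_nonneg_left this (by positivity)
  refine ⟨almost_anti e0 (fun k => ?_) ((qs.add hφ).mul_left D) st1, ?_⟩
  · have := φ0 k
    have := q0 k
    simp only [hφd] at *
    positivity
  · refine sum_var m0 V0 (err := fun k => D ^ 2 * (4 * q k + φ k)) (fun k => ?_) (((qs.mul_left 4).add hφ).mul_left _) fun k => ?_
    · have := φ0 k
      have := q0 k
      positivity
    · have := st2 k
      have := mul_nonneg (sq_nonneg D) (φ0 k)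
      nlinarith
end

section
variable {d : ℕ}

structure Gauge (K C0 : ℝ) (p : Euc d → ℝ) : Prop where
  nn : ∀ x, 0 ≤ p x
  add : ∀ x y, p (x + y) ≤ p x + p y
  hom : ∀ (t : ℝ) x, 0 ≤ t → p (t • x) = t * p x
  lip : ∀ x y, p y ≤ p x + C0 * ‖x - y‖
  lb : ∀ x, ‖x‖ ≤ 2 * K * p x

lemma hom_of_two {p : Euc d → ℝ} {C : ℝ} (nn : ∀ x, 0 ≤ p x) (add : ∀ x y, p (x + y) ≤ p x + p y)
    (two : ∀ x, p ((2:ℝ) • x) = 2 * p x) (lip : ∀ x y, p y ≤ p x + C * ‖x - y‖) (t : ℝ) (x : Euc d) (ht : 0 ≤ t) :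
    p (t • x) = t * p x := by
  have p0 : p 0 = 0 := by have := two 0; rw [smul_zero] at this; linarith
  have hn : ∀ (n : ℕ) x, p ((n:ℝ) • x) ≤ n * p x := by
    intro n x
    induction n with
    | zero => simp [p0]
    | succ n ih => push_cast; rw [add_smul, one_smul]; linarith [add ((n:ℝ) • x) x]
  have h2 : ∀ (k : ℕ) x, p ((2:ℝ) ^ k • x) = 2 ^ k * p x := by
    intro k x
    induction k with
    | zero => simp
    | succ k ih => rw [pow_succ', mul_smul, two, ih]; ring
  have hN : ∀ (n : ℕ) x, p ((n:ℝ) • x) = n * p x := by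
    intro n x
    refine le_antisymm (hn n x) ?_
    have hlt : n ≤ 2 ^ n := Nat.lt_two_pow_self.le
    have h3 := add ((n:ℝ) • x) (((2 ^ n - n : ℕ) : ℝ) • x)
    have h4 := hn (2 ^ n - n) x
    rw [← add_smul] at h3
    push_cast [Nat.cast_sub hlt] at h3 h4
    rw [add_sub_cancel, h2] at h3
    linarith
  have C0 : 0 ≤ C * ‖x‖ := by
    have := lip x 0; have := lip 0 x
    simp [p0] at *
    linarith [nn x]
  have key : ∀ n : ℕ, n * |p (t • x) - t * p x| ≤ C * ‖x‖ + p x := by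
    intro n
    have e1 : (n:ℝ) * |p (t • x) - t * p x| = |p ((n * t) • x) - n * t * p x| := by
      rw [mul_smul, hN, mul_assoc, ← mul_sub, abs_mul, Nat.abs_cast]
    rw [e1]
    have h0 : 0 ≤ n * t := by positivity
    have f1 := Nat.floor_le h0
    have f2 := Nat.lt_floor_add_one (n * t)
    have e2 := hN ⌊n * t⌋₊ x
    have nx : ∀ a b : ℝ, ‖a • x - b • x‖ = |a - b| * ‖x‖ := fun a b => by
      rw [← sub_smul, norm_smul, Real.norm_eq_abs]
    have l1 := lip ((n * t) • x) ((⌊n * t⌋₊:ℝ) • x)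
    have l2 := lip ((⌊n * t⌋₊:ℝ) • x) ((n * t) • x)
    rw [nx] at l1 l2
    rw [e2] at l1 l2
    have a1 : |n * t - ⌊n * t⌋₊| ≤ 1 := by rw [abs_le]; constructor <;> linarith
    have a2 : |⌊n * t⌋₊ - n * t| ≤ 1 := by rw [abs_le]; constructor <;> linarith
    have b1 : C * (|n * t - ⌊n * t⌋₊| * ‖x‖) ≤ C * ‖x‖ := by nlinarith
    have b2 : C * (|⌊n * t⌋₊ - n * t| * ‖x‖) ≤ C * ‖x‖ := by nlinarith
    have := nn x
    rw [abs_le]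
    constructor <;> nlinarith
  by_contra hne
  have hpos : 0 < |p (t • x) - t * p x| := abs_pos.2 (sub_ne_zero.2 hne)
  obtain ⟨n, hn⟩ := exists_nat_gt ((C * ‖x‖ + p x) / |p (t • x) - t * p x|)
  rw [div_lt_iff₀ hpos] at hn
  linarith [key n]

variable {Ω : Type*} [MeasurableSpace Ω] {P : Measure Ω} [IsProbabilityMeasure P] {K C0 : ℝ}
  {c : ℝ → Euc d → Ω → ℝ} {v : ℝ → Euc d → Ω → Euc d}

lemma Env.gauge (h : Env P K C0 c v) {α : ℝ} (hα : 0 < α)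
    (hmix : Tendsto (fun s : ℝ => s ^ α * phiH P c v s) atTop (nhds 0)) :
    ∃ p : Euc d → ℝ, Gauge K C0 p ∧ ∀ (r : ℝ) (x y : Euc d), ∀ᵐ ω ∂P,
      Tendsto (fun k : ℕ => tau c v (2 ^ k * r) ((2:ℝ) ^ k • x) ((2:ℝ) ^ k • y) ω / 2 ^ k) atTop (nhds (p (y - x))) := by
  obtain ⟨ω0⟩ := P.nonempty_of_neZero
  have C1 := (h.C ω0).C1
  choose p hp using fun x => (h.conv hα hmix x).1
  have hV := fun x => (h.conv hα hmix x).2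
  have p2 : ∀ k : ℕ, (0:ℝ) < 2 ^ k := fun k => by positivity
  have nrm : ∀ (k : ℕ) (x : Euc d), ‖(2:ℝ) ^ k • x‖ = 2 ^ k * ‖x‖ := fun k x => by
    rw [norm_smul, norm_pow, Real.norm_of_nonneg (by norm_num : (0:ℝ) ≤ 2)]
  have i2 : Tendsto (fun k : ℕ => ((2:ℝ) ^ k)⁻¹) atTop (nhds 0) := by
    simpa using tendsto_pow_atTop_nhds_zero_of_lt_one (r := (2:ℝ)⁻¹) (by norm_num) (by norm_num)
  have nn : ∀ x, 0 ≤ p x := fun x => ge_of_tendsto' (hp x) fun k =>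
    div_nonneg (integral_nonneg (h.nonneg _ _ _)) (p2 k).le
  have lb : ∀ x, ‖x‖ ≤ 2 * K * p x := fun x => by
    refine ge_of_tendsto' ((hp x).const_mul _) fun k => ?_
    rw [← mul_div_assoc, le_div_iff₀ (p2 k), mul_comm, ← nrm, fE, ← integral_const_mul]
    have := integral_mono (integrable_const _) ((h.int 0 0 ((2:ℝ) ^ k • x)).const_mul (2 * K))
      fun ω => (h.C ω).lb 0 0 ((2:ℝ) ^ k • x)
    simpa using this
  have lip : ∀ x y, p y ≤ p x + C0 * ‖x - y‖ := fun x y => by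
    have t1 : Tendsto (fun k : ℕ => fE P c v ((2:ℝ) ^ k • x) / 2 ^ k + (C0 * ((2:ℝ) ^ k)⁻¹ + C0 * ‖x - y‖)) atTop
        (nhds (p x + (C0 * 0 + C0 * ‖x - y‖))) := (hp x).add ((i2.const_mul _).add_const _)
    rw [mul_zero, zero_add] at t1
    refine le_of_tendsto_of_tendsto' (hp y) t1 fun k => ?_
    have := integral_mono (h.int 0 0 ((2:ℝ) ^ k • y)) ((h.int 0 0 ((2:ℝ) ^ k • x)).add (integrable_const _))
      fun ω => (h.C ω).ext 0 0 ((2:ℝ) ^ k • x) ((2:ℝ) ^ k • y)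
    rw [integral_add' (h.int 0 0 _) (integrable_const _)] at this
    simp only [integral_const, probReal_univ, one_smul, ← smul_sub, nrm] at this
    rw [← fE, ← fE] at this
    rw [div_add' _ _ _ (p2 k).ne', div_le_div_iff_of_pos_right (p2 k), add_mul, mul_assoc, inv_mul_cancel₀ (p2 k).ne']
    linarith
  have two : ∀ x, p ((2:ℝ) • x) = 2 * p x := fun x => by
    have t1 := ((hp x).comp (tendsto_add_atTop_nat 1)).const_mul 2
    refine tendsto_nhds_unique (hp _) (t1.congr fun k => ?_)
    simp only [Function.comp_def]
    rw [smul_smul, ← pow_succ]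
    field_simp
    ring
  have hφ := (phi_sum (P := P) (c := c) (v := v) hα C1 hmix).tendsto_atTop_zero
  have add : ∀ x y, p (x + y) ≤ p x + p y := fun x y => by
    have q4 : Tendsto (fun k : ℕ => (3 / 4 : ℝ) ^ k) atTop (nhds 0) :=
      tendsto_pow_atTop_nhds_zero_of_lt_one (by norm_num) (by norm_num)
    have t1 := (hp x).add ((q4.const_mul (2 * C0)).add ((hp y).add (hφ.const_mul (C0 * (1 + ‖y‖)))))
    simp only [mul_zero, zero_add, add_zero] at t1
    refine le_of_tendsto_of_tendsto' (hp _) t1 fun k => ?_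
    have o1 : (1:ℝ) ≤ (3 / 2) ^ k := one_le_pow₀ (by norm_num)
    have o2 : (1:ℝ) ≤ 2 ^ k := one_le_pow₀ (by norm_num)
    have := (h.step (s := C0 * (3 / 2) ^ k) (by nlinarith) ((2:ℝ) ^ k • x) ((2:ℝ) ^ k • y)).1
    rw [← smul_add, nrm] at this
    rw [div_le_iff₀ (p2 k), add_mul, add_mul, add_mul, div_mul_cancel₀ _ (p2 k).ne', div_mul_cancel₀ _ (p2 k).ne',
      mul_assoc (2 * C0), ← mul_pow]
    have φ0 := phi_nonneg (P := P) (c := c) (v := v) (C0 * (3 / 2) ^ k)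
    have h3 : C0 * (1 + 2 ^ k * ‖y‖) * phiH P c v (C0 * (3 / 2) ^ k) ≤
      C0 * (1 + ‖y‖) * phiH P c v (C0 * (3 / 2) ^ k) * 2 ^ k := by
      have : C0 * (1 + 2 ^ k * ‖y‖) ≤ C0 * (1 + ‖y‖) * 2 ^ k := by nlinarith [norm_nonneg y]
      nlinarith
    have h4 : (3 / 4 * 2 : ℝ) ^ k = (3 / 2) ^ k := by norm_num
    rw [h4]
    linarith
  refine ⟨p, ⟨nn, add, fun t x ht => hom_of_two nn add two lip t x ht, lip, lb⟩, fun r x y => ?_⟩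
  set e : ℕ → ℝ := fun k => fE P c v ((2:ℝ) ^ k • (y - x)) / 2 ^ k with he
  have hZ : ∀ k : ℕ, Integrable (fun ω => (tau c v (2 ^ k * r) ((2:ℝ) ^ k • x) ((2:ℝ) ^ k • y) ω / 2 ^ k - e k) ^ 2) P ∧
      ∫ ω, (tau c v (2 ^ k * r) ((2:ℝ) ^ k • x) ((2:ℝ) ^ k • y) ω / 2 ^ k - e k) ^ 2 ∂P =
      fS P c v ((2:ℝ) ^ k • (y - x)) / 4 ^ k - e k ^ 2 := by
    intro k
    have ex : ∀ a : ℝ, (a / 2 ^ k - e k) ^ 2 = (4 ^ k)⁻¹ * a ^ 2 + (-2 * e k / 2 ^ k * a + e k ^ 2) := by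
      intro a
      have : (4:ℝ) ^ k = 2 ^ k * 2 ^ k := by rw [← mul_pow]; norm_num
      rw [this]; field_simp; ring
    have int : ∀ t x y, Integrable (fun ω => -2 * e k / 2 ^ k * tau c v t x y ω + e k ^ 2) P :=
      fun t x y => ((h.int t x y).const_mul _).add (integrable_const _)
    constructor
    · simp_rw [ex]
      exact ((h.int2 _ _ _).const_mul _).add (int _ _ _)
    · rw [h.law_int (g := fun a => (a / 2 ^ k - e k) ^ 2) (by fun_prop), ← smul_sub]
      simp_rw [ex]
      rw [integral_add ((h.int2 _ _ _).const_mul _) (int _ _ _),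
        integral_add ((h.int _ _ _).const_mul _) (integrable_const _), integral_const_mul, integral_const_mul]
      simp only [integral_const, probReal_univ, one_smul]
      rw [← fE, ← fS, show fE P c v ((2:ℝ) ^ k • (y - x)) = e k * 2 ^ k from (div_mul_cancel₀ _ (p2 k).ne').symm]
      field_simp
      ring
  have := ae_zero (fun k => (hZ k).1) (fun k ω => sq_nonneg _) (by simp_rw [fun k => (hZ k).2]; exact hV _)
  filter_upwards [this] with ω hω
  have h1 := hω.sqrt
  simp only [Real.sqrt_sq_eq_abs, Real.sqrt_zero] at h1
  have h2 := (tendsto_zero_iff_abs_tendsto_zero _).2 h1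
  have h3 := h2.add (hp (y - x))
  rw [zero_add] at h3
  exact h3.congr fun k => by simp [he]
end

section
variable {d : ℕ}

def UConv (p : Euc d → ℝ) (c : ℝ → Euc d → ℝ) (v : ℝ → Euc d → Euc d) : Prop :=
  ∀ R δ : ℝ, 0 < δ → ∃ N0 : ℝ, 0 < N0 ∧ ∀ N, N0 ≤ N → ∀ x y : Euc d, ‖x‖ ≤ R → ‖y‖ ≤ R →
    |travelTime c v 0 (N • x) (N • y) - N * p (y - x)| ≤ δ * N

lemma uconv {K C0 : ℝ} {c : ℝ → Euc d → ℝ} {v : ℝ → Euc d → Euc d} (h : Ctl K C0 c v) {p : Euc d → ℝ}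
    (g : Gauge K C0 p) (D : ℕ → Euc d) (hD : DenseRange D)
    (hc : ∀ (r : ℚ) (i j : ℕ), Tendsto (fun k : ℕ =>
      travelTime c v (2 ^ k * (r : ℝ)) ((2:ℝ) ^ k • D i) ((2:ℝ) ^ k • D j) / 2 ^ k) atTop (nhds (p (D j - D i)))) :
    UConv p c v := by
  intro R δ hδ
  have C1 := h.C1
  obtain ⟨η, hη⟩ : ∃ η, η = δ / (8 * C0) := ⟨_, rfl⟩
  have η0 : 0 < η := by rw [hη]; positivity
  have ηδ : 8 * C0 * η = δ := by rw [hη]; field_simp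
  have ηC : η ≤ C0 * η := by nlinarith
  obtain ⟨r, r1, r2⟩ := exists_rat_btwn (show 2 * C0 * η < 3 * C0 * η by nlinarith)
  obtain ⟨F, hF⟩ := (isCompact_closedBall (0 : Euc d) (2 * R)).elim_finite_subcover (fun i => ball (D i) η)
    (fun i => isOpen_ball) (fun x _ => by
      obtain ⟨i, hi⟩ := hD.exists_dist_lt x η0
      exact Set.mem_iUnion.2 ⟨i, hi⟩)
  have ev : ∀ r : ℚ, ∀ᶠ k : ℕ in atTop, ∀ i ∈ F, ∀ j ∈ F,
      |travelTime c v (2 ^ k * (r : ℝ)) ((2:ℝ) ^ k • D i) ((2:ℝ) ^ k • D j) / 2 ^ k - p (D j - D i)| < η := by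
    intro r
    rw [eventually_all_finset]; intro i _
    rw [eventually_all_finset]; intro j _
    have := (hc r i j).eventually (ball_mem_nhds _ η0)
    simpa [Real.dist_eq] using this
  have ev2 : ∀ᶠ k : ℕ in atTop, 1 / η ≤ 2 ^ k :=
    (tendsto_pow_atTop_atTop_of_one_lt (one_lt_two)).eventually_ge_atTop _
  obtain ⟨k0, hk0⟩ := eventually_atTop.1 ((ev r).and ((ev (-r)).and ev2))
  refine ⟨2 ^ k0, by positivity, fun N hN x y hx hy => ?_⟩
  obtain ⟨k, hk1, hk2⟩ := exists_nat_pow_near ((one_le_pow₀ one_le_two).trans hN) (one_lt_two (α := ℝ))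
  have hk : k0 ≤ k := by
    have := (pow_lt_pow_iff_right₀ (one_lt_two (α := ℝ))).1 (hN.trans_lt hk2)
    omega
  obtain ⟨c1, c2, c3⟩ := hk0 k hk
  have p2 : (0:ℝ) < 2 ^ k := by positivity
  obtain ⟨θ, hθ⟩ : ∃ θ, θ = N / 2 ^ k := ⟨_, rfl⟩
  have hNθ : N = 2 ^ k * θ := by rw [hθ]; field_simp
  have θ1 : 1 ≤ θ := by rw [hθ, le_div_iff₀ p2]; linarith
  have θ2 : θ ≤ 2 := by rw [hθ, div_le_iff₀ p2]; rw [pow_succ] at hk2; linarith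
  have pick : ∀ x : Euc d, ‖x‖ ≤ R → ∃ i ∈ F, ‖θ • x - D i‖ < η := by
    intro x hx
    have : θ • x ∈ closedBall (0 : Euc d) (2 * R) := by
      rw [mem_closedBall_zero_iff, norm_smul, Real.norm_of_nonneg (by linarith)]
      gcongr
    have := hF this
    simp only [Set.mem_iUnion, mem_ball, dist_eq_norm] at this
    obtain ⟨i, hi, h⟩ := this
    exact ⟨i, hi, h⟩
  obtain ⟨i, hi, hxi⟩ := pick x hx
  obtain ⟨j, hj, hyj⟩ := pick y hy
  rw [div_le_iff₀ η0] at c3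
  have sc : ∀ (z w : Euc d), ‖θ • z - w‖ < η → C0 * (1 + ‖N • z - (2:ℝ) ^ k • w‖) ≤ 2 ^ k * (2 * C0 * η) := by
    intro z w hz
    rw [hNθ, mul_smul, ← smul_sub, norm_smul, Real.norm_of_nonneg p2.le]
    have : 1 + 2 ^ k * ‖θ • z - w‖ ≤ 2 ^ k * (2 * η) := by nlinarith
    nlinarith
  have d1 := sc x _ hxi
  have d2 := sc y _ hyj
  have c1 := c1 i hi j hj
  have c2 := c2 i hi j hj
  have gp : p (θ • (y - x)) = θ * p (y - x) := g.hom _ _ (by linarith)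
  have nd : ‖θ • (y - x) - (D j - D i)‖ ≤ 2 * η := by
    have : θ • (y - x) - (D j - D i) = (θ • y - D j) - (θ • x - D i) := by rw [smul_sub]; abel
    rw [this]
    exact (norm_sub_le _ _).trans (by linarith)
  have g1 := g.lip (θ • (y - x)) (D j - D i)
  have g2 := g.lip (D j - D i) (θ • (y - x))
  rw [norm_sub_rev] at g2
  rw [gp] at g1 g2
  have nd' : C0 * ‖θ • (y - x) - (D j - D i)‖ ≤ C0 * (2 * η) := by gcongr
  have u := h.mono (t := 0) (s := 2 ^ k * r) (x := N • x) (x' := (2:ℝ) ^ k • D i) ((2:ℝ) ^ k • D j) (N • y)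
    (by rw [sub_zero]; refine d1.trans ?_; gcongr)
  have l := h.mono (t := 2 ^ k * (-r : ℚ)) (s := 0) (x := (2:ℝ) ^ k • D i) (x' := N • x) (N • y) ((2:ℝ) ^ k • D j)
    (by rw [norm_sub_rev]; refine d1.trans ?_; push_cast; nlinarith)
  rw [norm_sub_rev] at u
  obtain ⟨c1a, c1b⟩ := abs_lt.1 c1
  obtain ⟨c2a, c2b⟩ := abs_lt.1 c2
  have c1b : travelTime c v (2 ^ k * (r:ℝ)) ((2:ℝ) ^ k • D i) ((2:ℝ) ^ k • D j) < (p (D j - D i) + η) * 2 ^ k := by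
    rw [← div_lt_iff₀ p2]; linarith
  have c2a : (p (D j - D i) - η) * 2 ^ k < travelTime c v (2 ^ k * ((-r : ℚ):ℝ)) ((2:ℝ) ^ k • D i) ((2:ℝ) ^ k • D j) := by
    rw [← lt_div_iff₀ p2]; linarith
  have hδN : δ * 2 ^ k ≤ δ * N := by gcongr
  have g1' : p (D j - D i) * 2 ^ k ≤ (θ * p (y - x) + C0 * (2 * η)) * 2 ^ k := by gcongr; linarith
  have g2' : θ * p (y - x) * 2 ^ k ≤ (p (D j - D i) + C0 * (2 * η)) * 2 ^ k := by gcongr; linarith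
  have e : N * p (y - x) = θ * p (y - x) * 2 ^ k := by rw [hNθ]; ring
  have r3 : 2 ^ k * (r:ℝ) ≤ 2 ^ k * (3 * C0 * η) := by gcongr
  have ηC' : η * 2 ^ k ≤ C0 * η * 2 ^ k := by gcongr
  have hδk : δ * 2 ^ k = 8 * C0 * η * 2 ^ k := by rw [ηδ]
  push_cast at l c2a
  rw [e, abs_le]
  constructor
  · linarith
  · linarith

variable {Ω : Type*} [MeasurableSpace Ω] {P : Measure Ω} [IsProbabilityMeasure P] {K C0 : ℝ}
  {c : ℝ → Euc d → Ω → ℝ} {v : ℝ → Euc d → Ω → Euc d}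

lemma Env.uconv (h : Env P K C0 c v) {α : ℝ} (hα : 0 < α)
    (hmix : Tendsto (fun s : ℝ => s ^ α * phiH P c v s) atTop (nhds 0)) :
    ∃ p : Euc d → ℝ, Gauge K C0 p ∧ ∀ᵐ ω ∂P, UConv p (fun a b => c a b ω) (fun a b => v a b ω) := by
  obtain ⟨p, g, hp⟩ := h.gauge hα hmix
  refine ⟨p, g, ?_⟩
  have : ∀ᵐ ω ∂P, ∀ (r : ℚ) (i j : ℕ), Tendsto (fun k : ℕ => tau c v (2 ^ k * (r : ℝ))
      ((2:ℝ) ^ k • TopologicalSpace.denseSeq (Euc d) i) ((2:ℝ) ^ k • TopologicalSpace.denseSeq (Euc d) j) ω / 2 ^ k) atTop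
      (nhds (p (TopologicalSpace.denseSeq (Euc d) j - TopologicalSpace.denseSeq (Euc d) i))) := by
    rw [ae_all_iff]; intro r
    rw [ae_all_iff]; intro i
    rw [ae_all_iff]; intro j
    exact hp _ _ _
  filter_upwards [this] with ω hω
  exact _root_.uconv (h.C ω) g _ (TopologicalSpace.denseRange_denseSeq _) hω
end

section
variable {d : ℕ}

lemma final_match {K C0 : ℝ} {c : ℝ → Euc d → ℝ} {v : ℝ → Euc d → Euc d} (h : Ctl K C0 c v) {p : Euc d → ℝ}
    (g : Gauge K C0 p) (hU : UConv p c v) (T R Λ η : ℝ) (hη : 0 < η) :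
    ∃ N1 : ℝ, 0 < N1 ∧ ∀ N, N1 ≤ N → ∀ t x w, 0 ≤ t → t ≤ T → ‖x‖ ≤ R → ‖w‖ ≤ Λ →
      (∀ y, N • (x + w) ∈ reachSet c v (N * t) 0 (N • y) → ∃ s, p s < 1 ∧ ‖(y - w) - (x - t • s)‖ ≤ η) ∧
      (∀ s, p s < 1 → ∃ y, N • (x + w) ∈ reachSet c v (N * t) 0 (N • y) ∧ ‖(y - w) - (x - t • s)‖ ≤ η) := by
  have K0 := h.reg.K0
  have C1 := h.C1
  obtain ⟨δ, hδ⟩ : ∃ δ, δ = η / (12 * K + 1) := ⟨_, rfl⟩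
  have δ0 : 0 < δ := by rw [hδ]; positivity
  have δη : 12 * K * δ + δ = η := by rw [hδ]; field_simp
  obtain ⟨N0, hN0, hN⟩ := hU (R + Λ + 2 * K * T) δ δ0
  refine ⟨max N0 (C0 / δ), by positivity, fun N hNN t x w t0 tT hx hw => ?_⟩
  have hN := hN N (le_trans (le_max_left _ _) hNN)
  have hNC : C0 ≤ N * δ := by
    rw [← div_le_iff₀ δ0]; exact le_trans (le_max_right _ _) hNN
  have N1 : 0 < N := hN0.trans_le (le_trans (le_max_left _ _) hNN)
  have T0 : 0 ≤ 2 * K * T := by have := t0.trans tT; positivity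
  have hxw : ‖x + w‖ ≤ R + Λ := (norm_add_le _ _).trans (by linarith)
  have sp : ∀ y, N • (x + w) ∈ reachSet c v (N * t) 0 (N • y) → ‖(x + w) - y‖ ≤ 2 * K * t := by
    intro y hy
    have := reach_speed h.reg hy
    rw [← smul_sub, norm_smul, Real.norm_of_nonneg N1.le] at this
    refine le_of_mul_le_mul_left (a := N) ?_ N1
    linarith
  have Kt : 2 * K * t ≤ 2 * K * T := by gcongr
  constructor
  · intro y hy
    have h1 := sp y hy
    have hyR : ‖y‖ ≤ R + Λ + 2 * K * T := by
      have : y = (x + w) - ((x + w) - y) := by abel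
      rw [this]
      exact (norm_sub_le _ _).trans (by linarith)
    have h2 := (abs_le.1 (hN y (x + w) hyR (by linarith))).1
    have h3 := h.le (by positivity) hy
    have h4 : p (x + w - y) ≤ t + δ := by
      refine le_of_mul_le_mul_left (a := N) ?_ N1
      linarith
    have hp : 0 < t + 2 * δ := by positivity
    refine ⟨(t + 2 * δ)⁻¹ • (x + w - y), ?_, ?_⟩
    · rw [g.hom _ _ (by positivity), inv_mul_lt_iff₀ hp]; linarith
    · have e : (y - w) - (x - t • (t + 2 * δ)⁻¹ • (x + w - y)) = (-(2 * δ / (t + 2 * δ))) • (x + w - y) := by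
        have : -(2 * δ / (t + 2 * δ)) = t * (t + 2 * δ)⁻¹ - 1 := by field_simp; ring
        rw [this, sub_smul, mul_smul, one_smul]; abel
      rw [e, norm_smul, norm_neg, Real.norm_of_nonneg (by positivity)]
      calc 2 * δ / (t + 2 * δ) * ‖x + w - y‖ ≤ 2 * δ / (t + 2 * δ) * (2 * K * t) := by gcongr
        _ = 4 * K * δ * (t / (t + 2 * δ)) := by ring
        _ ≤ 4 * K * δ * 1 := by
          gcongr
          rw [div_le_one hp]; linarith
        _ ≤ η := by nlinarith
  · intro s hs
    have s2 : ‖s‖ ≤ 2 * K := (g.lb s).trans (by nlinarith)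
    rcases le_total (3 * δ) t with ht | ht
    · have ht' : 0 ≤ t - 3 * δ := by linarith
      have h1 : p ((t - 3 * δ) • s) ≤ t - 3 * δ := by rw [g.hom _ _ ht']; nlinarith
      have h2 : ‖(t - 3 * δ) • s‖ ≤ 2 * K * T := by
        rw [norm_smul, Real.norm_of_nonneg ht']
        calc (t - 3 * δ) * ‖s‖ ≤ T * (2 * K) := by gcongr <;> linarith
          _ = _ := by ring
      refine ⟨x + w - (t - 3 * δ) • s, ?_, ?_⟩
      · have h3 := (abs_le.1 (hN (x + w - (t - 3 * δ) • s) (x + w)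
          ((norm_sub_le _ _).trans (by linarith)) (by linarith))).2
        rw [sub_sub_cancel] at h3
        have h4 : N * p ((t - 3 * δ) • s) ≤ N * (t - 3 * δ) := by gcongr
        refine h.after (s := N * (t - δ)) (y := N • (x + w)) ?_ ?_
        · have : 0 < N * δ := by positivity
          linarith
        · simp; linarith
      · have e : x + w - (t - 3 * δ) • s - w - (x - t • s) = (3 * δ) • s := by rw [sub_smul]; abel
        rw [e, norm_smul, Real.norm_of_nonneg (by positivity)]
        nlinarith
    · obtain ⟨y0, hy0⟩ := h.bwd 0 (N * t) (N • (x + w)) (by positivity)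
      have hy : N • (x + w) ∈ reachSet c v (N * t) 0 (N • (N⁻¹ • y0)) := by
        rw [smul_inv_smul₀ N1.ne']; exact hy0
      refine ⟨N⁻¹ • y0, hy, ?_⟩
      have h1 := sp _ hy
      have e : N⁻¹ • y0 - w - (x - t • s) = t • s - (x + w - N⁻¹ • y0) := by abel
      rw [e]
      have h2 : ‖t • s‖ ≤ t * (2 * K) := by rw [norm_smul, Real.norm_of_nonneg t0]; gcongr
      have h3 : K * t ≤ K * (3 * δ) := by gcongr
      refine (norm_sub_le _ _).trans ?_
      linarith

lemma sup_close {X W : Set ℝ} {e : ℝ} (hX : X.Nonempty) (hW : W.Nonempty) (bW : BddAbove W)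
    (h1 : ∀ x ∈ X, ∃ w ∈ W, x ≤ w + e) (h2 : ∀ w ∈ W, ∃ x ∈ X, w ≤ x + e) : |sSup X - sSup W| ≤ e := by
  have b : ∀ x ∈ X, x ≤ sSup W + e := fun x hx => by
    obtain ⟨w, hw, h⟩ := h1 x hx
    linarith [le_csSup bW hw]
  have bX : BddAbove X := ⟨_, b⟩
  have u1 := csSup_le hX b
  have u2 : sSup W ≤ sSup X + e := csSup_le hW fun w hw => by
    obtain ⟨x, hx, h⟩ := h2 w hw
    linarith [le_csSup bX hx]
  rw [abs_le]; constructor <;> linarith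

lemma final_lim {K C0 : ℝ} {c : ℝ → Euc d → ℝ} {v : ℝ → Euc d → Euc d} (h : Ctl K C0 c v) {p : Euc d → ℝ}
    (g : Gauge K C0 p) (hU : UConv p c v) (u0 : Euc d → ℝ) (uε : ℝ → Euc d → ℝ) (Λ : ℝ) (yε : ℝ → Euc d) (ρ : ℝ → ℝ)
    (hu0 : UniformContinuous u0) (hy : ∀ ε ∈ Set.Ioo (0:ℝ) 1, yε ε ∈ Metric.ball (0 : Euc d) Λ)
    (hρ : Tendsto ρ (nhdsWithin 0 (Set.Ioi 0)) (nhds 0))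
    (hu : ∀ ε ∈ Set.Ioo (0:ℝ) 1, ∀ x : Euc d, |uε ε (x + yε ε) - u0 x| ≤ ρ ε) :
    TendstoLocallyUniformlyOn
            (fun ε : ℝ => fun q : ℝ × Euc d =>
              sSup {r | ∃ y : Euc d, r = uε ε y ∧
                ε⁻¹ • (q.2 + yε ε) ∈ reachSet c v (ε⁻¹ * q.1) 0 (ε⁻¹ • y)})
            (fun q : ℝ × Euc d => sSup (u0 '' {y | ∃ s ∈ {s | p s < 1}, y = q.2 - q.1 • s}))
            (nhdsWithin 0 (Set.Ioi 0))
            (Set.Ici (0:ℝ) ×ˢ (Set.univ : Set (Euc d))) := by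
  have p0 : p 0 = 0 := by have := g.hom 0 0 le_rfl; simpa using this
  rw [Metric.tendstoLocallyUniformlyOn_iff]
  rintro e he ⟨t0, x0⟩ -
  refine ⟨(Set.Iio (t0 + 1) ×ˢ ball x0 1) ∩ (Set.Ici (0:ℝ) ×ˢ (Set.univ : Set (Euc d))), ?_, ?_⟩
  · rw [Set.inter_comm]; exact inter_mem_nhdsWithin _ (prod_mem_nhds (Iio_mem_nhds (by simp)) (ball_mem_nhds _ one_pos))
  obtain ⟨η, η0, hη⟩ := Metric.uniformContinuous_iff.1 hu0 (e / 3) (by positivity)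
  obtain ⟨N1, hN1, hm⟩ := final_match h g hU (t0 + 1) (‖x0‖ + 1) Λ (η / 2) (by positivity)
  have ev1 : ∀ᶠ ε : ℝ in nhdsWithin 0 (Set.Ioi 0), N1 ≤ ε⁻¹ := tendsto_inv_nhdsGT_zero.eventually_ge_atTop N1
  have ev2 : ∀ᶠ ε : ℝ in nhdsWithin 0 (Set.Ioi 0), ε ∈ Set.Ioo (0:ℝ) 1 := Ioo_mem_nhdsGT one_pos
  have ev3 := hρ.eventually_lt_const (show 0 < e / 3 by positivity)
  filter_upwards [ev1, ev2, ev3] with ε h1 h2 h3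
  rintro ⟨t, x⟩ ⟨⟨ht, hx⟩, ⟨ht0, -⟩⟩
  simp only [Set.mem_Iio, Set.mem_Ici, mem_ball, dist_eq_norm] at ht hx ht0
  have hxR : ‖x‖ ≤ ‖x0‖ + 1 := by
    have : x = x0 + (x - x0) := by abel
    rw [this]; exact (norm_add_le _ _).trans (by linarith)
  have hyΛ := hy ε h2
  rw [mem_ball_zero_iff] at hyΛ
  obtain ⟨m1, m2⟩ := hm _ h1 t x (yε ε) ht0 ht.le hxR hyΛ.le
  have cl : ∀ y s, ‖(y - yε ε) - (x - t • s)‖ ≤ η / 2 → |uε ε y - u0 (x - t • s)| < 2 * (e / 3) := by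
    intro y s hys
    have a1 := hu ε h2 (y - yε ε)
    rw [sub_add_cancel] at a1
    have a2 := hη (a := y - yε ε) (b := x - t • s) (by rw [dist_eq_norm]; linarith)
    rw [Real.dist_eq] at a2
    have := abs_sub_le (uε ε y) (u0 (y - yε ε)) (u0 (x - t • s))
    linarith
  rw [dist_comm, Real.dist_eq]
  refine lt_of_le_of_lt (sup_close (e := 2 * (e / 3)) ?_ ?_ ?_ ?_ ?_) (by linarith : 2 * (e / 3) < e)
  · obtain ⟨y, hy, -⟩ := m2 0 (by rw [p0]; exact one_pos)
    exact ⟨_, y, rfl, hy⟩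
  · exact ⟨_, _, ⟨0, by simp [p0], rfl⟩, rfl⟩
  · have hc : IsCompact (u0 '' closedBall x (t * (2 * K))) := (isCompact_closedBall _ _).image hu0.continuous
    refine hc.bddAbove.mono (Set.image_mono ?_)
    rintro _ ⟨s, hs, rfl⟩
    have K0 := h.reg.K0
    have hs : p s < 1 := hs
    have s2 : ‖s‖ ≤ 2 * K := (g.lb s).trans (by nlinarith)
    rw [mem_closedBall, dist_eq_norm, sub_sub_cancel_left, norm_neg, norm_smul, Real.norm_of_nonneg ht0]
    gcongr
  · rintro _ ⟨y, rfl, hy⟩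
    obtain ⟨s, hs, hys⟩ := m1 y hy
    refine ⟨_, ⟨_, ⟨s, hs, rfl⟩, rfl⟩, ?_⟩
    have := (abs_lt.1 (cl y s hys)).2
    simp only
    linarith
  · rintro _ ⟨_, ⟨s, hs, rfl⟩, rfl⟩
    obtain ⟨y, hy, hys⟩ := m2 s hs
    refine ⟨_, ⟨y, rfl, hy⟩, ?_⟩
    have := (abs_lt.1 (cl y s hys)).1
    simp only
    linarith
end

section
lemma joint_cont {d : ℕ} {E : Type*} [SeminormedAddCommGroup E] {f : ℝ → Euc d → E} {L : ℝ}
    (h1 : ∀ ε : ℝ, 0 < ε → ∃ δ : ℝ, 0 < δ ∧ ∀ t t' : ℝ, |t - t'| ≤ δ → ∀ x, ‖f t x - f t' x‖ ≤ ε)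
    (h2 : ∀ t x x', ‖f t x - f t x'‖ ≤ L * ‖x - x'‖) : Continuous fun p : ℝ × Euc d => f p.1 p.2 := by
  rw [Metric.continuous_iff]
  rintro ⟨t, x⟩ ε hε
  obtain ⟨δ, δ0, hδ⟩ := h1 (ε / 3) (by positivity)
  have L0 : 0 < |L| + 1 := by positivity
  refine ⟨min δ (ε / (3 * (|L| + 1))), by positivity, ?_⟩
  rintro ⟨s, y⟩ hs
  rw [Prod.dist_eq, max_lt_iff] at hs
  simp only [Real.dist_eq, dist_eq_norm] at hs ⊢
  have a1 := hδ s t (hs.1.le.trans (min_le_left _ _)) y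
  have a2 := h2 t y x
  have a3 : ‖y - x‖ < ε / (3 * (|L| + 1)) := hs.2.trans_le (min_le_right _ _)
  rw [lt_div_iff₀ (by positivity)] at a3
  have a4 : L * ‖y - x‖ ≤ (|L| + 1) * ‖y - x‖ := by gcongr; linarith [le_abs_self L]
  have : f s y - f t x = (f s y - f t y) + (f t y - f t x) := by abel
  rw [this]
  refine (norm_add_le _ _).trans_lt ?_
  linarith
end

/-- **Almost-sure homogenization for G-equations.**
Under the G-equation hypotheses and polynomial decay of `φ_H`, there is a convex bounded open
set `S ∋ 0` such that almost surely: for any uniformly continuous data `u₀`, `u^ε(0,·,ω)` with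
`y_ε ∈ B_Λ(0)` and `sup_ω ‖u^ε(0,·+y_ε,ω) − u₀‖_∞ ≤ ρ(ε) → 0`, the solutions
`u^ε(t,x,ω) = sup{ u^ε(0,y,ω) : x ∈ εΓ(ε⁻¹t,ω;0,ε⁻¹y) }` satisfy
`u^ε(t, x+y_ε, ω) → sup_{y ∈ x−tS} u₀(y)` locally uniformly on `[0,∞) × ℝ^d` as `ε → 0⁺`. -/
theorem gequation_homogenization_almost_sure
    {d : ℕ} {Ω : Type*} [MeasurableSpace Ω] (P : Measure Ω) [IsProbabilityMeasure P]
    (c : ℝ → Euc d → Ω → ℝ) (v : ℝ → Euc d → Ω → Euc d)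
    -- `c` is positive, `(c,v)` are bounded
    (hc_pos : ∀ t x ω, 0 < c t x ω)
    (hbdd : ∃ K : ℝ, ∀ t x ω, c t x ω ≤ K ∧ ‖v t x ω‖ ≤ K)
    -- uniform continuity in `t`, uniformly in `(x,ω)`
    (huct : ∀ ε : ℝ, 0 < ε → ∃ δ : ℝ, 0 < δ ∧ ∀ t t' : ℝ, |t - t'| ≤ δ → ∀ x ω,
      |c t x ω - c t' x ω| ≤ ε ∧ ‖v t x ω - v t' x ω‖ ≤ ε)
    -- uniform Lipschitz continuity in `x`
    (hlip : ∃ L : ℝ, ∀ t : ℝ, ∀ x x' : Euc d, ∀ ω,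
      |c t x ω - c t x' ω| ≤ L * ‖x - x'‖ ∧ ‖v t x ω - v t x' ω‖ ≤ L * ‖x - x'‖)
    -- `v(t,·,ω)` is divergence-free (a.e. vanishing trace of the a.e. derivative)
    (hdiv : ∀ t : ℝ, ∀ ω, ∀ᵐ x ∂(volume : Measure (Euc d)),
      LinearMap.trace ℝ (Euc d) (fderiv ℝ (fun y => v t y ω) x).toLinearMap = 0)
    -- the averaged smallness condition (1.14): inf_L sup |avg of v over L-boxes| < inf c
    (hGc4 : ∃ L : ℝ, 0 < L ∧ ∃ a b : ℝ, a < b ∧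
      (∀ t x ω,
        ‖(L ^ d)⁻¹ • ∫ y in {y : Euc d | ∀ i, y i ∈ Set.Icc (0:ℝ) L}, v t (x + y) ω‖ ≤ a) ∧
      (∀ t x ω, b ≤ c t x ω))
    -- space-time stationarity with respect to a measure-preserving group
    (Υ : ℝ × Euc d → Ω → Ω)
    (hmp : ∀ p, MeasurePreserving (Υ p) P P)
    (hid : Υ 0 = id)
    (hgrp : ∀ p q, Υ p ∘ Υ q = Υ (p + q))
    (hstat : ∀ t s : ℝ, ∀ x y : Euc d, ∀ ω,
      c t x (Υ (s, y) ω) = c (t + s) (x + y) ω ∧ v t x (Υ (s, y) ω) = v (t + s) (x + y) ω)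
    -- measurability in ω of the travel times
    (hτmeas : ∀ t0 : ℝ, ∀ x0 x : Euc d,
      Measurable fun ω => travelTime (fun a b => c a b ω) (fun a b => v a b ω) t0 x0 x)
    -- polynomial decay of the mixing coefficient
    (α : ℝ) (hα : 0 < α)
    (hmix : Tendsto (fun s : ℝ => s ^ α * phiH P c v s) atTop (nhds 0)) :
    ∃ S : Set (Euc d), Convex ℝ S ∧ IsOpen S ∧ Bornology.IsBounded S ∧ (0 : Euc d) ∈ S ∧
      ∀ᵐ ω ∂P,
        ∀ (u0 : Euc d → ℝ) (u0ε : ℝ → Ω → Euc d → ℝ) (Λ : ℝ) (yε : ℝ → Euc d) (ρ : ℝ → ℝ),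
          UniformContinuous u0 →
          (∀ ε ∈ Set.Ioo (0:ℝ) 1, ∀ ω1, UniformContinuous (u0ε ε ω1)) →
          (∀ ε ∈ Set.Ioo (0:ℝ) 1, yε ε ∈ Metric.ball (0 : Euc d) Λ) →
          Tendsto ρ (nhdsWithin 0 (Set.Ioi 0)) (nhds 0) →
          (∀ ε ∈ Set.Ioo (0:ℝ) 1, ∀ ω1, ∀ x : Euc d, |u0ε ε ω1 (x + yε ε) - u0 x| ≤ ρ ε) →
          TendstoLocallyUniformlyOn
            (fun ε : ℝ => fun p : ℝ × Euc d =>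
              sSup {r | ∃ y : Euc d, r = u0ε ε ω y ∧
                ε⁻¹ • (p.2 + yε ε) ∈ reachSet (fun a b => c a b ω) (fun a b => v a b ω)
                  (ε⁻¹ * p.1) 0 (ε⁻¹ • y)})
            (fun p : ℝ × Euc d => sSup (u0 '' {y | ∃ s ∈ S, y = p.2 - p.1 • s}))
            (nhdsWithin 0 (Set.Ioi 0))
            (Set.Ici (0:ℝ) ×ˢ (Set.univ : Set (Euc d))) := by
  obtain ⟨ω0⟩ := P.nonempty_of_neZero
  obtain ⟨K, hK⟩ := hbdd
  obtain ⟨Lp, hLp⟩ := hlip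
  obtain ⟨L, L0, a, b, hab, hav, hcb⟩ := hGc4
  obtain ⟨δ, δ0, hδ⟩ := huct ((b - a) / 6) (by linarith)
  have K0 : 0 ≤ K := (hc_pos 0 0 ω0).le.trans (hK 0 0 ω0).1
  have hp : Par K (max Lp 0) L a b ((b - a) / 6) δ :=
    ⟨K0, le_max_right _ _, L0, by linarith, by linarith, δ0, (norm_nonneg _).trans (hav 0 0 ω0)⟩
  have hG : ∀ ω, Good K (max Lp 0) L a b ((b - a) / 6) δ (fun s z => c s z ω) (fun s z => v s z ω) := by
    intro ω
    refine ⟨⟨?_, ?_, fun t x => (hc_pos t x ω).le, fun t x => (hK t x ω).1, fun t x => (hK t x ω).2⟩,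
      fun t x => hcb t x ω, fun t t' h x => (hδ t t' h x ω).2, fun t x x' => ?_, fun t => hdiv t ω, fun t x => ?_⟩
    · refine joint_cont (f := fun s z => c s z ω) (L := Lp) (fun ε hε => ?_) fun t x x' => (hLp t x x' ω).1
      obtain ⟨δ, δ0, hδ⟩ := huct ε hε
      exact ⟨δ, δ0, fun t t' h x => (hδ t t' h x ω).1⟩
    · refine joint_cont (f := fun s z => v s z ω) (L := Lp) (fun ε hε => ?_) fun t x x' => (hLp t x x' ω).2
      obtain ⟨δ, δ0, hδ⟩ := huct ε hε
      exact ⟨δ, δ0, fun t t' h x => (hδ t t' h x ω).2⟩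
    · exact (hLp t x x' ω).2.trans (mul_le_mul_of_nonneg_right (le_max_left _ _) (norm_nonneg _))
    · rw [boxN_int L0]; exact hav t x ω
  obtain ⟨C0, hC0, hctl⟩ := ctrl d hp
  have hE : Env P K (max C0 1) c v := by
    refine ⟨fun ω => ⟨(hG ω).reg, le_max_right _ _, fun t x y T hT => ?_, fun t T y hT => (hG ω).bwd hp t hT y⟩,
      ⟨Υ, hmp, hstat⟩, hτmeas⟩
    refine hctl _ _ (hG ω) t x y T (le_trans ?_ hT)
    gcongr
    exact le_max_left _ _
  obtain ⟨p, g, hU⟩ := hE.uconv hα hmix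
  have p0 : p 0 = 0 := by have := g.hom 0 0 le_rfl; simpa using this
  have pc : Continuous p := by
    have : LipschitzWith (Real.toNNReal (max C0 1)) p := LipschitzWith.of_le_add_mul' _ fun x y => by
      rw [dist_eq_norm, norm_sub_rev]; exact g.lip y x
    exact this.continuous
  refine ⟨{s | p s < 1}, ?_, isOpen_lt pc continuous_const, ?_, ?_, ?_⟩
  · intro x hx y hy s t hs ht hst
    simp only [Set.mem_setOf_eq] at hx hy ⊢
    have h1 := g.add (s • x) (t • y)
    rw [g.hom _ _ hs, g.hom _ _ ht] at h1
    rcases hs.eq_or_lt with h0 | h0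
    · subst h0
      nlinarith
    · nlinarith
  · refine (isBounded_closedBall (x := (0 : Euc d)) (r := 2 * K)).subset fun s hs => ?_
    rw [mem_closedBall_zero_iff]
    have hs : p s < 1 := hs
    exact (g.lb s).trans (by nlinarith)
  · simp [p0]
  · filter_upwards [hU] with ω hω
    intro u0 u0ε Λ yε ρ hu0 _ hy hρ hu
    exact final_lim (hE.C ω) g hω u0 (fun ε => u0ε ε ω) Λ yε ρ hu0 hy hρ fun ε hε x => hu ε hε ω x
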